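/- Let $d\in\{2,3\}$, $k\ge 1$ and $\sigma>0$. There is a constant $C>0$, depending only on $d$, $k$ and $\sigma$, such that the following holds. Let $\Omega\subset\mathbb R^d$ be an open polygonal (polyhedral) Lipschitz domain or, more generally, any open set with a finite conforming simplicial triangulation $\mathcal T_h$ of $\overline\Omega$ whose elements have their interior in $\Omega$. Write $h_T$ for the diameter of an element $T$, $\rho_T$ for the diameter of the largest ball inscribed in $T$ and $h=\max_{T\in\mathcal T_h}h_T$, and assume that $\mathcal T_h$ is shape-regular with constant $\sigma$: $h_T\le\sigma\rho_T$ for all $T\in\mathcal T_h$. Let $\nu>0$, and let $(L,u)\in[H^k(\Omega)]^{d\times d}\times[H^{k+1}(\Omega)]^d$ with $L=\nu\nabla u$, where $(\nabla u)_{ij}=\partial_j u_i$. Notation. $\langle\cdot,\cdot\rangle_{\partial\mathcal T_h}=\sum_{T}\langle\cdot,\cdot\rangle_{L^2(\partial T)}$ and $\|\cdot\|_{\mathcal T_h}^2=\sum_T\|\cdot\|_{L^2(T)}^2$; on $\partial T$ functions on $T$ are replaced by their traces from $T$, $n$ is the outward unit normal of $T$ and $\eta=h_T^{-1}$; $\nabla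 v_h$ is taken elementwise. $\Pi_k^o$ and $\Pi_k^\partial$ are the componentwise $L^2$ projections onto polynomials of degree at most $k$ on each element and on each face (edge if $d=2$), respectively. $RT_k(T)=[P_k(T)]^d+x\,P_k(T)$, and $\Pi_k^{RT}u|_T\in RT_k(T)$ is determined by $\langle\Pi_k^{RT}u\cdot n,w\rangle_E=\langle u\cdot n,w\rangle_E$ for all $w\in P_k(E)$ and all faces $E$ of $T$, and $(\Pi_k^{RT}u,w)_T=(u,w)_T$ for all $w\in[P_{k-1}(T)]^d$. $\Sigma_h$ is the space of tensor fields that are in $[P_k(T)]^{d\times d}$ on each element $T$; $V_h^0$ is the space of $v_h\in H(\mathrm{div};\Omega)$ with $v_h|_T\in RT_k(T)$ for each element $T$ and $v_h\cdot n=0$ on $\partial\Omega$; $\widehat V_h^0$ is the space of vector fields on the union of all faces of the triangulation that are in $[P_k(E)]^d$ on each face $E$ and vanish on $\partial\Omega$. Set $$E(L,u;v_h,\hat v_h)=\langle(\Pi_k^oL-L)n,\hat v_h-v_h\rangle_{\partial\mathcal T_h}+\nu\langle\eta(\Pi_k^{RT}u-u),\Pi_k^\partial v_h-\hat v_h\rangle_{\partial\mathcal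 T_h},$$ $$|||(G_h,v_h,\hat v_h)|||^2=\nu^{-1}\|G_h\|_{\mathcal T_h}^2+\nu\|\nabla v_h\|_{\mathcal T_h}^2+\nu\|\eta^{1/2}(\Pi_k^\partial v_h-\hat v_h)\|_{\partial\mathcal T_h}^2 .$$ Claim. For all $(G_h,v_h,\hat v_h)\in\Sigma_h\times V_h^0\times\widehat V_h^0$, $$|E(L,u;v_h,\hat v_h)|\le C\,\nu^{1/2}h^k|u|_{k+1}\,|||(G_h,v_h,\hat v_h)|||,$$ where $|u|_{k+1}^2=\sum_i\sum_{|\alpha|=k+1}\|\partial^\alpha u_i\|_{L^2(\Omega)}^2$. In particular the constant does not depend on $h$, $h_T$ or $\nu$. -/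

import Mathlib

open MeasureTheory Filter Topology
open scoped ContDiff ENNReal

noncomputable section

namespace HDG

/-- The Euclidean space `ℝ^d`. -/
abbrev Pt (d : ℕ) : Type := EuclideanSpace ℝ (Fin d)

/-- Vector fields on `ℝ^d`, given by their components. -/
abbrev VectorField (d : ℕ) : Type := Fin d → Pt d → ℝ

/-- Tensor (matrix) fields on `ℝ^d`, given by their entries. -/
abbrev TensorField (d : ℕ) : Type := Fin d → Fin d → Pt d → ℝ

/-! ### Weak derivatives and Sobolev spaces -/

/-- The classical partial derivative `∂_i φ`. -/
def partialDeriv {d : ℕ} (i : Fin d) (φ : Pt d → ℝ) : Pt d → ℝ :=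
  fun x => fderiv ℝ φ x (EuclideanSpace.single i 1)

/-- The classical derivative `∂^α φ = ∂_0^{α_0} ⋯ ∂_{d-1}^{α_{d-1}} φ` for a multi-index `α`. -/
def multiDeriv {d : ℕ} (α : Fin d → ℕ) (φ : Pt d → ℝ) : Pt d → ℝ :=
  (List.finRange d).foldr (fun i ψ => (partialDeriv i)^[α i] ψ) φ

/-- `φ` is a test function on the open set `Ω`: `φ ∈ C_c^∞(Ω)`. -/
def IsTestFunction {d : ℕ} (Ω : Set (Pt d)) (φ : Pt d → ℝ) : Prop :=
  ContDiff ℝ ∞ φ ∧ HasCompactSupport φ ∧ tsupport φ ⊆ Ω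

/-- `g` is the weak derivative `∂^α f` on the open set `Ω`. -/
def HasWeakDeriv {d : ℕ} (Ω : Set (Pt d)) (α : Fin d → ℕ) (f g : Pt d → ℝ) : Prop :=
  LocallyIntegrableOn f Ω ∧ LocallyIntegrableOn g Ω ∧
    ∀ φ : Pt d → ℝ, IsTestFunction Ω φ →
      ∫ x in Ω, f x * multiDeriv α φ x = (-1) ^ (∑ i, α i) * ∫ x in Ω, g x * φ x

open Classical in
/-- The weak derivative `∂^α f` on `Ω` (unique up to a null set of `Ω`; `0` if there is none). -/
def weakDeriv {d : ℕ} (Ω : Set (Pt d)) (α : Fin d → ℕ) (f : Pt d → ℝ) : Pt d → ℝ :=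
  if h : ∃ g, HasWeakDeriv Ω α f g then h.choose else 0

/-- `f ∈ H^m(Ω)`: all weak derivatives of order at most `m` exist and lie in `L²(Ω)`. -/
def MemSobolev {d : ℕ} (Ω : Set (Pt d)) (m : ℕ) (f : Pt d → ℝ) : Prop :=
  ∀ α : Fin d → ℕ, ∑ i, α i ≤ m →
    ∃ g, HasWeakDeriv Ω α f g ∧ MemLp g 2 (volume.restrict Ω)

/-- The Sobolev seminorm `|u|_{m,Ω}` of a vector field:
`|u|_m² = ∑_i ∑_{|α| = m} ‖∂^α u_i‖²_{L²(Ω)}`. -/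
def sobolevSeminorm {d : ℕ} (Ω : Set (Pt d)) (m : ℕ) (u : VectorField d) : ℝ :=
  Real.sqrt (∑ i, ∑ α ∈ Finset.piAntidiag (Finset.univ : Finset (Fin d)) m,
    ∫ x in Ω, weakDeriv Ω α (u i) x ^ 2)

/-- `M = ∇u` weakly on `Ω`, with the convention `(∇u)_{ij} = ∂_j u_i`. -/
def IsWeakGradient {d : ℕ} (Ω : Set (Pt d)) (u : VectorField d) (M : TensorField d) : Prop :=
  ∀ i j, HasWeakDeriv Ω (Pi.single j 1) (u i) (M i j)

/-- `v ∈ H(div; Ω)`: `v` is in `L²(Ω)^d` and has a weak divergence in `L²(Ω)`. -/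
def MemHDiv {d : ℕ} (Ω : Set (Pt d)) (v : VectorField d) : Prop :=
  (∀ i, MemLp (v i) 2 (volume.restrict Ω)) ∧
    ∃ q : Pt d → ℝ, MemLp q 2 (volume.restrict Ω) ∧
      ∀ φ : Pt d → ℝ, IsTestFunction Ω φ →
        ∫ x in Ω, ∑ i, v i x * partialDeriv i φ x = -∫ x in Ω, q x * φ x

/-! ### Geometry of a simplex

A simplex is represented by the finite set of its vertices. The faces `E ⊂ ∂T` of codimension one
of a simplex `T` with `d + 1` vertices are the members of `T.powersetCard d`. -/

/-- The closed simplex with the given vertices. -/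
def hull {d : ℕ} (S : Finset (Pt d)) : Set (Pt d) := convexHull ℝ (S : Set (Pt d))

/-- The diameter `h_T`. -/
def elementDiam {d : ℕ} (T : Finset (Pt d)) : ℝ := Metric.diam (hull T)

/-- The diameter `ρ_T` of the largest ball inscribed in `T`. -/
def inscribedDiam {d : ℕ} (T : Finset (Pt d)) : ℝ :=
  sSup {δ : ℝ | 0 ≤ δ ∧ ∃ c : Pt d, Metric.closedBall c (δ / 2) ⊆ hull T}

/-- Lebesgue measure on the element `T`. -/
def elementMeasure {d : ℕ} (T : Finset (Pt d)) : Measure (Pt d) := volume.restrict (hull T)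

/-- The `(d-1)`-dimensional surface measure on the face `F`. -/
def faceMeasure {d : ℕ} (F : Finset (Pt d)) : Measure (Pt d) :=
  (Measure.euclideanHausdorffMeasure (d - 1)).restrict (hull F)

/-- The unit normal to the face `F` of `T` that points out of `T`: the normalized component
orthogonal to `F` of the vector from the barycentre of `T` to the barycentre of `F`. -/
def outwardNormal {d : ℕ} (T F : Finset (Pt d)) : Pt d :=
  let w : Pt d := (vectorSpan ℝ (F : Set (Pt d)))ᗮ.starProjection
    (F.centroid ℝ id - T.centroid ℝ id)
  ‖w‖⁻¹ • w

/-! ### Traces of `H¹(T)` functions -/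

/-- `g ∈ L²(F)` is the trace on the face `F` of `w ∈ H¹(T)`: there are smooth functions that
converge to `w` in `H¹(T)` and whose restrictions to `F` converge to `g` in `L²(F)`. -/
def IsFaceTrace {d : ℕ} (T F : Finset (Pt d)) (w g : Pt d → ℝ) : Prop :=
  MemLp g 2 (faceMeasure F) ∧
    ∃ φ : ℕ → Pt d → ℝ, (∀ n, ContDiff ℝ ∞ (φ n)) ∧
      Tendsto (fun n => eLpNorm (fun x => φ n x - w x) 2 (elementMeasure T)) atTop (𝓝 0) ∧
      (∀ j, Tendsto (fun n => eLpNorm (fun x => partialDeriv j (φ n) x -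
        weakDeriv (interior (hull T)) (Pi.single j 1) w x) 2 (elementMeasure T)) atTop (𝓝 0)) ∧
      Tendsto (fun n => eLpNorm (fun x => φ n x - g x) 2 (faceMeasure F)) atTop (𝓝 0)

open Classical in
/-- The trace on the face `F` of the restriction of `w` to `T`. -/
def faceTrace {d : ℕ} (T F : Finset (Pt d)) (w : Pt d → ℝ) : Pt d → ℝ :=
  if h : ∃ g, IsFaceTrace T F w g then h.choose else 0

/-! ### Polynomials and projections -/

/-- The polynomial function on `ℝ^d` given by `p`. -/
def polyFun {d : ℕ} (p : MvPolynomial (Fin d) ℝ) : Pt d → ℝ :=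
  fun x => MvPolynomial.eval (fun i => x i) p

/-- `p` is the `L²(μ)`-orthogonal projection of `w` onto the polynomials of degree at most `k`. -/
def IsL2Proj {d : ℕ} (μ : Measure (Pt d)) (k : ℕ) (w : Pt d → ℝ)
    (p : MvPolynomial (Fin d) ℝ) : Prop :=
  p.totalDegree ≤ k ∧ ∀ q : MvPolynomial (Fin d) ℝ, q.totalDegree ≤ k →
    ∫ x, polyFun p x * polyFun q x ∂μ = ∫ x, w x * polyFun q x ∂μ

open Classical in
/-- The `L²(μ)`-orthogonal projection of `w` onto the polynomials of degree at most `k`. -/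
def l2Proj {d : ℕ} (μ : Measure (Pt d)) (k : ℕ) (w : Pt d → ℝ) : Pt d → ℝ :=
  if h : ∃ p, IsL2Proj μ k w p then polyFun h.choose else 0

/-- The elementwise projection `Π_k^o` on the element `T`. -/
def elementProj {d : ℕ} (k : ℕ) (T : Finset (Pt d)) (w : Pt d → ℝ) : Pt d → ℝ :=
  l2Proj (elementMeasure T) k w

/-- The facewise projection `Π_k^∂` on the face `F`. -/
def faceProj {d : ℕ} (k : ℕ) (F : Finset (Pt d)) (w : Pt d → ℝ) : Pt d → ℝ :=
  l2Proj (faceMeasure F) k w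

/-- Membership in `RT_k = [P_k]^d + x P_k`. -/
def IsRT {d : ℕ} (k : ℕ) (q : Fin d → MvPolynomial (Fin d) ℝ) : Prop :=
  ∃ (p : Fin d → MvPolynomial (Fin d) ℝ) (r : MvPolynomial (Fin d) ℝ),
    (∀ i, (p i).totalDegree ≤ k) ∧ r.totalDegree ≤ k ∧ ∀ i, q i = p i + MvPolynomial.X i * r

/-- `q ∈ RT_k(T)` is the Raviart–Thomas projection of `w ∈ [H¹(T)]^d`: equal normal moments of
degree at most `k` on the faces of `T`, equal moments of degree at most `k - 1` in `T`. -/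
def IsRTProj {d : ℕ} (k : ℕ) (T : Finset (Pt d)) (w : VectorField d)
    (q : Fin d → MvPolynomial (Fin d) ℝ) : Prop :=
  IsRT k q ∧
    (∀ F ∈ T.powersetCard d, ∀ m : MvPolynomial (Fin d) ℝ, m.totalDegree ≤ k →
      ∫ x, (∑ i, polyFun (q i) x * outwardNormal T F i) * polyFun m x ∂(faceMeasure F) =
        ∫ x, (∑ i, faceTrace T F (w i) x * outwardNormal T F i) * polyFun m x
          ∂(faceMeasure F)) ∧
    (∀ m : Fin d → MvPolynomial (Fin d) ℝ, (∀ i, (m i).totalDegree < k) →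
      ∫ x, ∑ i, polyFun (q i) x * polyFun (m i) x ∂(elementMeasure T) =
        ∫ x, ∑ i, w i x * polyFun (m i) x ∂(elementMeasure T))

open Classical in
/-- The Raviart–Thomas projection `Π_k^{RT} w` on the element `T`. -/
def rtProj {d : ℕ} (k : ℕ) (T : Finset (Pt d)) (w : VectorField d) : VectorField d :=
  if h : ∃ q, IsRTProj k T w q then fun i => polyFun (h.choose i) else 0

/-! ### Triangulations -/

/-- A conforming simplicial triangulation of the open set `Ω`: a finite simplicial complex whose
underlying set is the closure of `Ω` and whose `d`-simplices have their interior in `Ω` (which is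
automatic when `Ω` is the interior of its closure, as for a Lipschitz domain). -/
structure Triangulation {d : ℕ} (Ω : Set (Pt d)) where
  /-- the underlying simplicial complex -/
  complex : Geometry.SimplicialComplex ℝ (Pt d)
  finite_faces : complex.faces.Finite
  space_eq : complex.space = closure Ω
  interior_subset : ∀ T ∈ complex.faces, T.card = d + 1 → interior (hull T) ⊆ Ω

namespace Triangulation

variable {d : ℕ} {Ω : Set (Pt d)} (𝒯 : Triangulation Ω)

/-- The elements `T ∈ T_h`: the simplices with `d + 1` vertices. -/
def elements : Finset (Finset (Pt d)) := {T ∈ 𝒯.finite_faces.toFinset | T.card = d + 1}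

/-- The edges (`d = 2`) or faces (`d = 3`) `E ∈ E_h`: the simplices with `d` vertices. -/
def skeleton : Finset (Finset (Pt d)) := {F ∈ 𝒯.finite_faces.toFinset | F.card = d}

/-- The mesh size `h = max_T h_T`. -/
def meshSize : ℝ := sSup (elementDiam '' (𝒯.elements : Set (Finset (Pt d))))

/-- Shape regularity with constant `σ`: `h_T ≤ σ ρ_T` for every element `T`. -/
def ShapeRegular (σ : ℝ) : Prop := ∀ T ∈ 𝒯.elements, elementDiam T ≤ σ * inscribedDiam T

/-- The space `Σ_h` of elementwise `[P_k]^{d×d}` tensor fields. -/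
def SigmaSpace (k : ℕ) : Set (TensorField d) :=
  {G | ∀ T ∈ 𝒯.elements, ∀ i j, ∃ p : MvPolynomial (Fin d) ℝ,
    p.totalDegree ≤ k ∧ G i j =ᵐ[elementMeasure T] polyFun p}

/-- The space `V_h^0` of `H(div; Ω)`-conforming, elementwise `RT_k` vector fields whose normal
trace vanishes on `∂Ω`. -/
def VSpace (k : ℕ) : Set (VectorField d) :=
  {v | MemHDiv Ω v ∧
    (∀ T ∈ 𝒯.elements, ∃ q, IsRT k q ∧ ∀ i, v i =ᵐ[elementMeasure T] polyFun (q i)) ∧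
    (∀ T ∈ 𝒯.elements, ∀ F ∈ T.powersetCard d, hull F ⊆ frontier Ω →
      ∀ᵐ x ∂(faceMeasure F), ∑ i, faceTrace T F (v i) x * outwardNormal T F i = 0)}

/-- The space `V̂_h^0` of facewise `[P_k]^d` fields on the skeleton that vanish on `∂Ω`. -/
def VhatSpace (k : ℕ) : Set (VectorField d) :=
  {vhat | (∀ F ∈ 𝒯.skeleton, ∀ i, ∃ p : MvPolynomial (Fin d) ℝ,
      p.totalDegree ≤ k ∧ vhat i =ᵐ[faceMeasure F] polyFun p) ∧
    (∀ F ∈ 𝒯.skeleton, hull F ⊆ frontier Ω → ∀ i, vhat i =ᵐ[faceMeasure F] 0)}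

/-- `‖G‖²_{T_h}`. -/
def tensorNormSq (G : TensorField d) : ℝ :=
  ∑ T ∈ 𝒯.elements, ∫ x, ∑ i, ∑ j, G i j x ^ 2 ∂(elementMeasure T)

/-- `‖∇v‖²_{T_h}`, with the elementwise gradient. -/
def gradNormSq (v : VectorField d) : ℝ :=
  ∑ T ∈ 𝒯.elements, ∫ x, ∑ i, ∑ j,
    weakDeriv (interior (hull T)) (Pi.single j 1) (v i) x ^ 2 ∂(elementMeasure T)

/-- `‖η^{1/2}(Π_k^∂ v - v̂)‖²_{∂T_h}`, where `η = h_T⁻¹` on `∂T`. -/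
def jumpNormSq (k : ℕ) (v vhat : VectorField d) : ℝ :=
  ∑ T ∈ 𝒯.elements, ∑ F ∈ T.powersetCard d, (elementDiam T)⁻¹ *
    ∫ x, ∑ i, (faceProj k F (faceTrace T F (v i)) x - vhat i x) ^ 2 ∂(faceMeasure F)

/-- The triple norm of `(G, v, v̂)`. -/
def tripleNorm (k : ℕ) (ν : ℝ) (G : TensorField d) (v vhat : VectorField d) : ℝ :=
  Real.sqrt (ν⁻¹ * 𝒯.tensorNormSq G + ν * 𝒯.gradNormSq v + ν * 𝒯.jumpNormSq k v vhat)

/-- The consistency error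
`E(L, u; v, v̂) = ⟨(Π_k^o L - L) n, v̂ - v⟩_{∂T_h} + ν ⟨η (Π_k^{RT} u - u), Π_k^∂ v - v̂⟩_{∂T_h}`. -/
def consistencyError (k : ℕ) (ν : ℝ) (L : TensorField d) (u v vhat : VectorField d) : ℝ :=
  (∑ T ∈ 𝒯.elements, ∑ F ∈ T.powersetCard d, ∫ x, ∑ i,
      (∑ j, faceTrace T F (fun y => elementProj k T (L i j) y - L i j y) x *
        outwardNormal T F j) * (vhat i x - faceTrace T F (v i) x) ∂(faceMeasure F)) +
    ν * ∑ T ∈ 𝒯.elements, ∑ F ∈ T.powersetCard d, (elementDiam T)⁻¹ * ∫ x, ∑ i,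
      faceTrace T F (fun y => rtProj k T u i y - u i y) x *
        (faceProj k F (faceTrace T F (v i)) x - vhat i x) ∂(faceMeasure F)

end Triangulation

end HDG

end

noncomputable section

namespace HDG

/-! ### The `L²` norm as a real number -/

section L2

variable {α : Type*} [MeasurableSpace α] {μ : Measure α} {f g : α → ℝ}

/-- The `L²(μ)` norm of a real function. -/
def l2Norm (μ : Measure α) (f : α → ℝ) : ℝ := Real.sqrt (∫ x, f x ^ 2 ∂μ)

theorem l2Norm_nonneg (μ : Measure α) (f : α → ℝ) : 0 ≤ l2Norm μ f := Real.sqrt_nonneg _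

theorem l2Norm_sq (μ : Measure α) (f : α → ℝ) : l2Norm μ f ^ 2 = ∫ x, f x ^ 2 ∂μ :=
  Real.sq_sqrt (integral_nonneg fun _ => sq_nonneg _)

theorem eLpNorm_eq_l2Norm (hf : MemLp f 2 μ) : eLpNorm f 2 μ = ENNReal.ofReal (l2Norm μ f) := by
  rw [hf.eLpNorm_eq_integral_rpow_norm (by norm_num) (by norm_num), l2Norm, Real.sqrt_eq_rpow]
  simp

theorem l2Norm_eq_toReal (hf : MemLp f 2 μ) : l2Norm μ f = (eLpNorm f 2 μ).toReal := by
  rw [eLpNorm_eq_l2Norm hf, ENNReal.toReal_ofReal (l2Norm_nonneg _ _)]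

theorem l2Norm_add_le (hf : MemLp f 2 μ) (hg : MemLp g 2 μ) :
    l2Norm μ (fun x => f x + g x) ≤ l2Norm μ f + l2Norm μ g := by
  have h := eLpNorm_add_le hf.1 hg.1 (p := 2) (by norm_num)
  have h2 : MemLp (fun x => f x + g x) 2 μ := hf.add hg
  rw [show f + g = fun x => f x + g x from rfl, eLpNorm_eq_l2Norm hf, eLpNorm_eq_l2Norm hg,
    eLpNorm_eq_l2Norm h2, ← ENNReal.ofReal_add (l2Norm_nonneg _ _) (l2Norm_nonneg _ _)] at h
  exact (ENNReal.ofReal_le_ofReal_iff (add_nonneg (l2Norm_nonneg _ _) (l2Norm_nonneg _ _))).1 h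

theorem l2Norm_const_mul (c : ℝ) (f : α → ℝ) :
    l2Norm μ (fun x => c * f x) = |c| * l2Norm μ f := by
  simp only [l2Norm, mul_pow, integral_const_mul]
  rw [Real.sqrt_mul (sq_nonneg c), Real.sqrt_sq_eq_abs]

theorem l2Norm_neg (f : α → ℝ) : l2Norm μ (fun x => -f x) = l2Norm μ f := by
  simp [l2Norm]

theorem l2Norm_sub_comm (f g : α → ℝ) :
    l2Norm μ (fun x => f x - g x) = l2Norm μ (fun x => g x - f x) := by
  rw [← l2Norm_neg]; simp

theorem l2Norm_sub_le (hf : MemLp f 2 μ) (hg : MemLp g 2 μ) :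
    l2Norm μ (fun x => f x - g x) ≤ l2Norm μ f + l2Norm μ g := by
  have h := l2Norm_add_le hf (g := fun x => -g x) hg.neg
  rw [l2Norm_neg] at h
  simpa [sub_eq_add_neg] using h

theorem l2Norm_congr_ae (h : f =ᵐ[μ] g) : l2Norm μ f = l2Norm μ g := by
  unfold l2Norm
  congr 1
  exact integral_congr_ae (h.mono fun x hx => by simp only [hx])

theorem l2Norm_le_add_sub (hf : MemLp f 2 μ) (hg : MemLp g 2 μ) :
    l2Norm μ f ≤ l2Norm μ g + l2Norm μ (fun x => f x - g x) := by
  have h := l2Norm_add_le hg (g := fun x => f x - g x) (hf.sub hg)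
  simpa using h

theorem l2Norm_mono (hg : MemLp g 2 μ) (h : ∀ᵐ x ∂μ, |f x| ≤ |g x|) :
    l2Norm μ f ≤ l2Norm μ g := by
  refine Real.sqrt_le_sqrt (integral_mono_of_nonneg (ae_of_all _ fun x => sq_nonneg _)
    hg.integrable_sq (h.mono fun x hx => sq_le_sq.2 hx))

theorem l2Norm_le_of_bound [IsProbabilityMeasure μ] {M : ℝ} (hM : 0 ≤ M)
    (h : ∀ᵐ x ∂μ, |f x| ≤ M) : l2Norm μ f ≤ M := by
  have := l2Norm_mono (μ := μ) (f := f) (g := fun _ => M) (memLp_const M)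
    (h.mono fun x hx => hx.trans (le_abs_self M))
  refine this.trans_eq ?_
  simp [l2Norm, Real.sqrt_sq hM]

theorem memLp_finset_sum {ι : Type*} (s : Finset ι) {f : ι → α → ℝ}
    (hf : ∀ i ∈ s, MemLp (f i) 2 μ) : MemLp (fun x => ∑ i ∈ s, f i x) 2 μ := by
  simpa using memLp_finsetSum s hf

theorem l2Norm_sum_le {ι : Type*} (s : Finset ι) {f : ι → α → ℝ}
    (hf : ∀ i ∈ s, MemLp (f i) 2 μ) :
    l2Norm μ (fun x => ∑ i ∈ s, f i x) ≤ ∑ i ∈ s, l2Norm μ (f i) := by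
  classical
  induction s using Finset.induction_on with
  | empty => simp [l2Norm]
  | insert a s ha ih =>
    simp only [Finset.sum_insert ha]
    refine (l2Norm_add_le (hf a (by simp))
      (memLp_finset_sum s fun i hi => hf i (by simp [hi]))).trans ?_
    exact add_le_add_right (ih fun i hi => hf i (by simp [hi])) _

theorem abs_integral_mul_le (hf : MemLp f 2 μ) (hg : MemLp g 2 μ) :
    |∫ x, f x * g x ∂μ| ≤ l2Norm μ f * l2Norm μ g := by
  have h := integral_mul_norm_le_Lp_mul_Lq (μ := μ) (f := f) (g := g)
    Real.HolderConjugate.two_two (by simpa using hf) (by simpa using hg)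
  have h1 : |∫ x, f x * g x ∂μ| ≤ ∫ x, ‖f x‖ * ‖g x‖ ∂μ := by
    refine (norm_integral_le_integral_norm (fun x => f x * g x)).trans_eq ?_
    simp [norm_mul]
  refine (h1.trans h).trans_eq ?_
  simp [l2Norm, Real.sqrt_eq_rpow]

theorem l2Norm_smul_measure (c : ℝ) (hc : 0 ≤ c) (f : α → ℝ) :
    l2Norm (ENNReal.ofReal c • μ) f = Real.sqrt c * l2Norm μ f := by
  simp [l2Norm, integral_smul_measure, ENNReal.toReal_ofReal hc, Real.sqrt_mul hc]

theorem tendsto_l2Norm_sub {F : ℕ → α → ℝ} (hF : ∀ n, MemLp (F n) 2 μ) (hf : MemLp f 2 μ)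
    (h : Tendsto (fun n => eLpNorm (fun x => F n x - f x) 2 μ) atTop (𝓝 0)) :
    Tendsto (fun n => l2Norm μ (fun x => F n x - f x)) atTop (𝓝 0) := by
  have := (ENNReal.tendsto_toReal ENNReal.zero_ne_top).comp h
  refine this.congr fun n => ?_
  exact (l2Norm_eq_toReal ((hF n).sub hf)).symm

theorem tendsto_eLpNorm_sub {F : ℕ → α → ℝ} (hF : ∀ n, MemLp (F n) 2 μ) (hf : MemLp f 2 μ)
    (h : Tendsto (fun n => l2Norm μ (fun x => F n x - f x)) atTop (𝓝 0)) :
    Tendsto (fun n => eLpNorm (fun x => F n x - f x) 2 μ) atTop (𝓝 0) := by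
  have := ENNReal.tendsto_ofReal h
  rw [ENNReal.ofReal_zero] at this
  refine this.congr fun n => ?_
  exact (eLpNorm_eq_l2Norm ((hF n).sub hf)).symm

theorem tendsto_l2Norm {F : ℕ → α → ℝ} (hF : ∀ n, MemLp (F n) 2 μ) (hf : MemLp f 2 μ)
    (h : Tendsto (fun n => l2Norm μ (fun x => F n x - f x)) atTop (𝓝 0)) :
    Tendsto (fun n => l2Norm μ (F n)) atTop (𝓝 (l2Norm μ f)) := by
  rw [tendsto_iff_dist_tendsto_zero]
  refine squeeze_zero (fun _ => dist_nonneg) (fun n => ?_) h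
  rw [Real.dist_eq, abs_le]
  have h1 := l2Norm_le_add_sub (hF n) hf
  have h2 := l2Norm_le_add_sub hf (hF n)
  rw [l2Norm_sub_comm] at h2
  constructor <;> linarith

theorem ae_eq_zero_of_l2Norm_eq_zero (hf : MemLp f 2 μ) (h : l2Norm μ f = 0) : f =ᵐ[μ] 0 := by
  have := eLpNorm_eq_l2Norm hf
  rw [h, ENNReal.ofReal_zero] at this
  exact (eLpNorm_eq_zero_iff hf.1 (by norm_num)).1 this

/-- Jensen's inequality for the square with respect to a probability measure. -/
theorem sq_lintegral_le [IsProbabilityMeasure μ] {f : α → ℝ≥0∞} (hf : AEMeasurable f μ) :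
    (∫⁻ x, f x ∂μ) ^ 2 ≤ ∫⁻ x, f x ^ 2 ∂μ := by
  have h := ENNReal.lintegral_mul_le_Lp_mul_Lq μ Real.HolderConjugate.two_two hf
    (aemeasurable_const (b := (1 : ℝ≥0∞)))
  simp only [Pi.mul_apply, mul_one, ENNReal.one_rpow, lintegral_const, measure_univ] at h
  calc (∫⁻ x, f x ∂μ) ^ 2 ≤ ((∫⁻ x, f x ^ (2 : ℝ) ∂μ) ^ (1 / 2 : ℝ)) ^ 2 :=
        pow_le_pow_left' h 2
    _ = ∫⁻ x, f x ^ 2 ∂μ := by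
        rw [← ENNReal.rpow_natCast, ← ENNReal.rpow_mul]
        norm_num

end L2

/-! ### Symmetric positive semidefinite forms in finite dimension -/

section Forms

variable {V : Type*} [AddCommGroup V] [Module ℝ V] [FiniteDimensional ℝ V]

theorem exists_riesz (B : V →ₗ[ℝ] V →ₗ[ℝ] ℝ) (ℓ : V →ₗ[ℝ] ℝ)
    (hℓ : ∀ v, B v v = 0 → ℓ v = 0) : ∃ v, ∀ w, B v w = ℓ w := by
  by_contra hcon
  push Not at hcon
  have hn : ℓ ∉ LinearMap.range B := by
    rintro ⟨v, hv⟩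
    obtain ⟨w, hw⟩ := hcon v
    exact hw (by rw [hv])
  obtain ⟨φ, hφ, hφ'⟩ := Submodule.exists_le_ker_of_notMem hn
  obtain ⟨v, rfl⟩ := (Module.evalEquiv ℝ V).surjective φ
  have h0 : ∀ w, B w v = 0 := fun w => by
    have := hφ' (LinearMap.mem_range_self B w)
    simpa using this
  exact hφ (by simpa using hℓ v (h0 v))

theorem exists_bound_of_posDef (B : V →ₗ[ℝ] V →ₗ[ℝ] ℝ) (hsymm : ∀ v w, B v w = B w v)
    (hnonneg : ∀ v, 0 ≤ B v v) (ℓ : V →ₗ[ℝ] ℝ) (hℓ : ∀ v, B v v = 0 → ℓ v = 0) :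
    ∃ C : ℝ, 0 ≤ C ∧ ∀ v, |ℓ v| ≤ C * Real.sqrt (B v v) := by
  obtain ⟨u, hu⟩ := exists_riesz B ℓ hℓ
  refine ⟨Real.sqrt (B u u), Real.sqrt_nonneg _, fun w => ?_⟩
  have h := LinearMap.BilinForm.apply_mul_apply_le_of_forall_zero_le B hnonneg u w
  rw [hsymm w u, hu w] at h
  rw [← Real.sqrt_mul (hnonneg u)]
  exact Real.abs_le_sqrt (by rw [sq]; exact h)

end Forms

end HDG

end

noncomputable section

namespace HDG

/-! ### The reference simplex -/

/-- The reference simplex with vertices `0, e_1, …, e_n`. -/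
def refSimplex (n : ℕ) : Set (Pt n) := {x | (∀ i, 0 ≤ x i) ∧ ∑ i, x i ≤ 1}

/-- The affine map that sends the vertices of the reference simplex to the points `a i`. -/
def simplexMap {n d : ℕ} (a : Fin (n + 1) → Pt d) (x : Pt n) : Pt d :=
  a 0 + ∑ i, x i • (a i.succ - a 0)

/-- The linear part of `simplexMap`. -/
def simplexLin {n d : ℕ} (a : Fin (n + 1) → Pt d) : Pt n →L[ℝ] Pt d :=
  ∑ i, (EuclideanSpace.proj i : Pt n →L[ℝ] ℝ).smulRight (a i.succ - a 0)

section

variable {n d : ℕ}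

theorem simplexLin_apply (a : Fin (n + 1) → Pt d) (x : Pt n) :
    simplexLin a x = ∑ i, x i • (a i.succ - a 0) := by
  simp [simplexLin]

theorem simplexMap_eq (a : Fin (n + 1) → Pt d) (x : Pt n) :
    simplexMap a x = a 0 + simplexLin a x := by
  rw [simplexLin_apply, simplexMap]

theorem simplexMap_eq_sum (a : Fin (n + 1) → Pt d) (x : Pt n) :
    simplexMap a x = (1 - ∑ i, x i) • a 0 + ∑ i, x i • a i.succ := by
  simp only [simplexMap, smul_sub, Finset.sum_sub_distrib, sub_smul, one_smul, Finset.sum_smul]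
  abel

theorem continuous_simplexMap (a : Fin (n + 1) → Pt d) : Continuous (simplexMap a) := by
  have : simplexMap a = fun x => a 0 + simplexLin a x := funext (simplexMap_eq a)
  rw [this]
  fun_prop

theorem convex_refSimplex : Convex ℝ (refSimplex n) := by
  intro x hx y hy s t hs ht hst
  refine ⟨fun i => ?_, ?_⟩
  · have h1 := mul_nonneg hs (hx.1 i)
    have h2 := mul_nonneg ht (hy.1 i)
    simpa using add_nonneg h1 h2
  · have : ∑ i, (s • x + t • y) i = s * ∑ i, x i + t * ∑ i, y i := by
      simp [Finset.sum_add_distrib, Finset.mul_sum]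
    rw [this]
    nlinarith [hx.2, hy.2]

theorem isClosed_refSimplex : IsClosed (refSimplex n) := by
  have : refSimplex n = (⋂ i, {x : Pt n | 0 ≤ x i}) ∩ {x | ∑ i, x i ≤ 1} := by
    ext x; simp [refSimplex]
  rw [this]
  refine IsClosed.inter (isClosed_iInter fun i => ?_) ?_
  · exact isClosed_le continuous_const (by fun_prop)
  · exact isClosed_le (by fun_prop) continuous_const

theorem le_one_of_mem_refSimplex {x : Pt n} (hx : x ∈ refSimplex n) (i : Fin n) : x i ≤ 1 :=
  (Finset.single_le_sum (fun j _ => hx.1 j) (Finset.mem_univ i)).trans hx.2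

theorem norm_le_of_mem_refSimplex {x : Pt n} (hx : x ∈ refSimplex n) : ‖x‖ ≤ 1 := by
  rw [EuclideanSpace.norm_eq, Real.sqrt_le_one]
  refine le_trans (Finset.sum_le_sum fun i _ => ?_) hx.2
  rw [Real.norm_eq_abs, sq_abs]
  nlinarith [hx.1 i, le_one_of_mem_refSimplex hx i]

theorem isCompact_refSimplex : IsCompact (refSimplex n) := by
  refine Metric.isCompact_of_isClosed_isBounded isClosed_refSimplex ?_
  exact (Metric.isBounded_closedBall (x := (0 : Pt n)) (r := 1)).subset fun x hx => by
    simpa using norm_le_of_mem_refSimplex hx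

theorem measurableSet_refSimplex : MeasurableSet (refSimplex n) :=
  isClosed_refSimplex.measurableSet

/-- An open box contained in the reference simplex. -/
theorem box_subset_refSimplex :
    {x : Pt n | ∀ i, x i ∈ Set.Ioo (0 : ℝ) (1 / (n + 1))} ⊆ refSimplex n := by
  intro x hx
  refine ⟨fun i => (hx i).1.le, ?_⟩
  calc ∑ i, x i ≤ ∑ _i : Fin n, (1 / ((n : ℝ) + 1)) := Finset.sum_le_sum fun i _ => (hx i).2.le
    _ = n / (n + 1) := by simp; ring
    _ ≤ 1 := by rw [div_le_one (by positivity)]; linarith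

theorem isOpen_box : IsOpen {x : Pt n | ∀ i, x i ∈ Set.Ioo (0 : ℝ) (1 / (n + 1))} := by
  have : {x : Pt n | ∀ i, x i ∈ Set.Ioo (0 : ℝ) (1 / (n + 1))} =
      ⋂ i, (fun x : Pt n => x i) ⁻¹' Set.Ioo (0 : ℝ) (1 / (n + 1)) := by
    ext x; simp
  rw [this]
  exact isOpen_iInter_of_finite fun i => isOpen_Ioo.preimage (by fun_prop)

theorem nonempty_box : {x : Pt n | ∀ i, x i ∈ Set.Ioo (0 : ℝ) (1 / (n + 1))}.Nonempty := by
  refine ⟨WithLp.toLp 2 fun _ => 1 / (2 * (n + 1)), fun i => ?_⟩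
  have : (0 : ℝ) < n + 1 := by positivity
  constructor
  · show (0 : ℝ) < 1 / (2 * (n + 1)); positivity
  · show (1 : ℝ) / (2 * (n + 1)) < 1 / (n + 1)
    exact one_div_lt_one_div_of_lt this (by linarith)

theorem volume_refSimplex_ne_zero : volume (refSimplex n) ≠ 0 := by
  have := isOpen_box.measure_pos volume (nonempty_box (n := n))
  exact (this.trans_le (measure_mono box_subset_refSimplex)).ne'

theorem volume_refSimplex_ne_top : volume (refSimplex n) ≠ ⊤ :=
  isCompact_refSimplex.measure_lt_top.ne

/-- Normalized Lebesgue measure on the reference simplex. -/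
def refMeasure (n : ℕ) : Measure (Pt n) :=
  (volume (refSimplex n))⁻¹ • volume.restrict (refSimplex n)

instance : IsProbabilityMeasure (refMeasure n) := ⟨by
  simpa [refMeasure] using
    ENNReal.inv_mul_cancel volume_refSimplex_ne_zero (volume_refSimplex_ne_top (n := n))⟩

theorem ae_mem_refSimplex : ∀ᵐ x ∂(refMeasure n), x ∈ refSimplex n :=
  Measure.ae_smul_measure (ae_restrict_mem measurableSet_refSimplex) _

theorem simplexMap_image (a : Fin (n + 1) → Pt d) :
    simplexMap a '' refSimplex n = convexHull ℝ (Set.range a) := by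
  apply Set.Subset.antisymm
  · rintro _ ⟨x, hx, rfl⟩
    rw [simplexMap_eq_sum]
    have key : (∑ i : Fin (n + 1), (Fin.cons (1 - ∑ i, x i) (fun i => x i) : Fin (n + 1) → ℝ) i •
        a i) ∈ convexHull ℝ (Set.range a) := by
      refine (convex_convexHull ℝ _).sum_mem (fun i _ => ?_) ?_
        (fun i _ => subset_convexHull ℝ _ ⟨i, rfl⟩)
      · refine Fin.cases ?_ (fun j => ?_) i
        · simpa using hx.2
        · simpa using hx.1 j
      · simp [Fin.sum_univ_succ]
    simpa [Fin.sum_univ_succ] using key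
  · refine convexHull_min ?_ ?_
    · rintro _ ⟨i, rfl⟩
      refine Fin.cases ?_ (fun j => ?_) i
      · exact ⟨0, ⟨by simp, by simp⟩, by simp [simplexMap]⟩
      · refine ⟨EuclideanSpace.single j 1, ⟨fun i => ?_, ?_⟩, ?_⟩
        · rw [PiLp.single_apply]; split_ifs <;> simp
        · simp [PiLp.single_apply]
        · simp [simplexMap, PiLp.single_apply]
    · have : simplexMap a '' refSimplex n = 
          (fun y => a 0 + y) '' ((simplexLin a).toLinearMap '' refSimplex n) := by
        rw [Set.image_image]
        exact Set.image_congr fun x _ => simplexMap_eq a x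
      rw [this]
      exact (convex_refSimplex.linear_image (simplexLin a).toLinearMap).translate _

/-- Normalized surface measure on the simplex with vertices `a i`. -/
def simplexMeasure (a : Fin (n + 1) → Pt d) : Measure (Pt d) := (refMeasure n).map (simplexMap a)

instance (a : Fin (n + 1) → Pt d) : IsProbabilityMeasure (simplexMeasure a) :=
  Measure.isProbabilityMeasure_map (continuous_simplexMap a).aemeasurable

theorem euclideanHausdorffMeasure_simplexMap_image (a : Fin (n + 1) → Pt d) (s : Set (Pt n)) :
    Measure.euclideanHausdorffMeasure n (simplexMap a '' s) =
      ENNReal.ofReal (simplexLin a).toLinearMap.normDet * volume s := by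
  have h := (simplexLin a).toLinearMap.euclideanHausdorffMeasure_image_eq_normDet_mul_volume s
  rw [finrank_euclideanSpace_fin] at h
  rw [← h]
  have h2 : simplexMap a '' s = (fun y => a 0 + y) '' ((simplexLin a).toLinearMap '' s) := by
    rw [Set.image_image]
    exact Set.image_congr fun x _ => simplexMap_eq a x
  rw [h2]
  exact (isometry_add_left (a 0)).euclideanHausdorffMeasure_image _

theorem injective_simplexLin {a : Fin (n + 1) → Pt d} (ha : AffineIndependent ℝ a) :
    Function.Injective (simplexLin a) := by
  rw [affineIndependent_iff_linearIndependent_vsub ℝ a 0] at ha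
  have h2 : LinearIndependent ℝ fun i : Fin n => a i.succ - a 0 :=
    ha.comp (fun i : Fin n => (⟨i.succ, Fin.succ_ne_zero i⟩ : {x : Fin (n + 1) // x ≠ 0}))
      fun i j h => by simpa using h
  refine (injective_iff_map_eq_zero (simplexLin a)).2 fun x hx => ?_
  have h3 : ∑ i, x i • (a i.succ - a 0) = 0 := by rw [← simplexLin_apply]; exact hx
  ext i
  exact Fintype.linearIndependent_iff.1 h2 (fun i => x i) h3 i

theorem normDet_simplexLin_pos {a : Fin (n + 1) → Pt d} (ha : AffineIndependent ℝ a) :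
    0 < (simplexLin a).toLinearMap.normDet := by
  refine lt_of_le_of_ne (LinearMap.normDet_nonneg _) (Ne.symm ?_)
  exact ((simplexLin a).toLinearMap.normDet_ne_zero_tfae.out 0 1).2
    (LinearMap.ker_eq_bot.2 (injective_simplexLin ha))

theorem measurableSet_convexHull_range (a : Fin (n + 1) → Pt d) :
    MeasurableSet (convexHull ℝ (Set.range a)) := by
  rw [← simplexMap_image]
  exact (isCompact_refSimplex.image (continuous_simplexMap a)).isClosed.measurableSet

/-- The `n`-dimensional measure of the simplex with vertices `a i`. -/
def simplexVol (a : Fin (n + 1) → Pt d) : ℝ :=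
  (simplexLin a).toLinearMap.normDet * (volume (refSimplex n)).toReal

theorem simplexVol_pos {a : Fin (n + 1) → Pt d} (ha : AffineIndependent ℝ a) :
    0 < simplexVol a :=
  mul_pos (normDet_simplexLin_pos ha)
    (ENNReal.toReal_pos volume_refSimplex_ne_zero volume_refSimplex_ne_top)

theorem restrict_convexHull_eq (a : Fin (n + 1) → Pt d) :
    (Measure.euclideanHausdorffMeasure n).restrict (convexHull ℝ (Set.range a)) =
      ENNReal.ofReal (simplexVol a) • simplexMeasure a := by
  ext s hs
  rw [Measure.restrict_apply hs, Measure.smul_apply, simplexMeasure,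
    Measure.map_apply (continuous_simplexMap a).measurable hs, refMeasure, Measure.smul_apply,
    Measure.restrict_apply ((continuous_simplexMap a).measurable hs), ← simplexMap_image,
    ← Set.image_preimage_inter, euclideanHausdorffMeasure_simplexMap_image, simplexVol,
    ENNReal.ofReal_mul (LinearMap.normDet_nonneg _), ENNReal.ofReal_toReal volume_refSimplex_ne_top,
    smul_eq_mul, smul_eq_mul, mul_assoc, ← mul_assoc (volume (refSimplex n)),
    ENNReal.mul_inv_cancel volume_refSimplex_ne_zero volume_refSimplex_ne_top, one_mul]

theorem simplexVol_eq (a : Fin (n + 1) → Pt d) :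
    ENNReal.ofReal (simplexVol a) =
      Measure.euclideanHausdorffMeasure n (convexHull ℝ (Set.range a)) := by
  have h := congrArg (fun μ => μ Set.univ) (restrict_convexHull_eq a)
  simpa using h.symm

theorem norm_simplexLin_le (a : Fin (n + 1) → Pt d) (x : Pt n) :
    ‖simplexLin a x‖ ≤ n * Metric.diam (convexHull ℝ (Set.range a)) * ‖x‖ := by
  rw [simplexLin_apply]
  refine (norm_sum_le _ _).trans ?_
  have hb : Bornology.IsBounded (convexHull ℝ (Set.range a)) := by
    rw [isBounded_convexHull]; exact (Set.finite_range a).isBounded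
  calc ∑ i, ‖x i • (a i.succ - a 0)‖
      ≤ ∑ _i : Fin n, Metric.diam (convexHull ℝ (Set.range a)) * ‖x‖ := by
        refine Finset.sum_le_sum fun i _ => ?_
        rw [norm_smul, mul_comm]
        refine mul_le_mul ?_ (PiLp.norm_apply_le x i) (norm_nonneg _) Metric.diam_nonneg
        rw [← dist_eq_norm]
        exact Metric.dist_le_diam_of_mem hb (subset_convexHull ℝ _ ⟨_, rfl⟩)
          (subset_convexHull ℝ _ ⟨_, rfl⟩)
    _ = _ := by simp; ring

theorem simplexVol_le (a : Fin (n + 1) → Pt d) :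
    simplexVol a ≤ (n * Metric.diam (convexHull ℝ (Set.range a))) ^ n *
      (volume (refSimplex n)).toReal := by
  set K : NNReal := ⟨n * Metric.diam (convexHull ℝ (Set.range a)), by positivity⟩ with hK
  have hL : LipschitzWith K (simplexLin a) :=
    AddMonoidHomClass.lipschitz_of_bound_nnnorm (simplexLin a) K fun x => norm_simplexLin_le a x
  have h1 := hL.hausdorffMeasure_image_le (d := n) (by positivity) (refSimplex n)
  have h2 : Measure.euclideanHausdorffMeasure n (simplexLin a '' refSimplex n) ≤
      (K : ℝ≥0∞) ^ n * volume (refSimplex n) := by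
    rw [← EuclideanSpace.euclideanHausdorffMeasure_eq_volume,
      Measure.euclideanHausdorffMeasure_def, Measure.euclideanHausdorffMeasure_def,
      Measure.smul_apply, Measure.smul_apply, ENNReal.smul_def, ENNReal.smul_def, smul_eq_mul,
      smul_eq_mul, mul_left_comm]
    gcongr
    simpa using h1
  have h3 := (simplexLin a).toLinearMap.euclideanHausdorffMeasure_image_eq_normDet_mul_volume
    (refSimplex n)
  rw [finrank_euclideanSpace_fin] at h3
  have h4 : ENNReal.ofReal (simplexLin a).toLinearMap.normDet * volume (refSimplex n) ≤
      (K : ℝ≥0∞) ^ n * volume (refSimplex n) := by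
    rw [← h3]; exact h2
  have h5 := ENNReal.toReal_mono
    (ENNReal.mul_ne_top (ENNReal.pow_ne_top ENNReal.coe_ne_top) volume_refSimplex_ne_top) h4
  rw [ENNReal.toReal_mul, ENNReal.toReal_mul, ENNReal.toReal_ofReal (LinearMap.normDet_nonneg _),
    ENNReal.toReal_pow] at h5
  exact h5

end

end HDG

end

noncomputable section

namespace HDG

/-! ### Integration over a simplex as over a cone -/

section

variable {n : ℕ}

/-- The point of `ℝ^{n+1}` with first coordinate `t` and the other coordinates those of `y`. -/
def consPt (t : ℝ) (y : Pt n) : Pt (n + 1) := WithLp.toLp 2 (Fin.cons t (fun i => y i))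

@[simp] theorem consPt_zero (t : ℝ) (y : Pt n) : consPt t y 0 = t := rfl

@[simp] theorem consPt_succ (t : ℝ) (y : Pt n) (i : Fin n) : consPt t y i.succ = y i := rfl

theorem continuous_consPt : Continuous fun p : ℝ × Pt n => consPt p.1 p.2 := by
  refine (PiLp.continuous_toLp 2 _).comp (continuous_pi fun i => ?_)
  refine Fin.cases ?_ (fun j => ?_) i
  · simpa using continuous_fst
  · simp only [Fin.cons_succ]
    fun_prop

theorem measurePreserving_consPt :
    MeasurePreserving (fun p : ℝ × Pt n => consPt p.1 p.2) (volume.prod volume) volume := by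
  have h1 := (MeasurePreserving.id (volume : Measure ℝ)).prod (PiLp.volume_preserving_ofLp (Fin n))
  have h2 := (volume_preserving_piFinSuccAbove (fun _ : Fin (n + 1) => ℝ) 0).symm
  have h3 := (PiLp.volume_preserving_toLp (Fin (n + 1)))
  have h4 : (fun p : ℝ × Pt n => consPt p.1 p.2) = WithLp.toLp 2 ∘
      ((MeasurableEquiv.piFinSuccAbove (fun _ : Fin (n + 1) => ℝ) 0).symm ∘
        Prod.map id WithLp.ofLp) := by
    funext p
    simp only [consPt, Function.comp_apply, Prod.map, id]
    congr 1
    exact (Fin.insertNth_zero' _ _).symm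
  rw [h4]
  exact h3.comp (h2.comp h1)

theorem consPt_mem_refSimplex {t : ℝ} {y : Pt n} :
    consPt t y ∈ refSimplex (n + 1) ↔ 0 ≤ t ∧ (∀ i, 0 ≤ y i) ∧ ∑ i, y i ≤ 1 - t := by
  simp only [refSimplex, Set.mem_ofPred_eq, Fin.forall_fin_succ, Fin.sum_univ_succ, consPt_zero,
    consPt_succ]
  constructor
  · rintro ⟨⟨h1, h2⟩, h3⟩; exact ⟨h1, h2, by linarith⟩
  · rintro ⟨h1, h2, h3⟩; exact ⟨⟨h1, h2⟩, by linarith⟩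

theorem lintegral_comp_smul_pt {r : ℝ} (hr : 0 < r) {f : Pt n → ℝ≥0∞} (hf : Measurable f) :
    ∫⁻ y, f y = ENNReal.ofReal (r ^ n) * ∫⁻ y, f (r • y) := by
  have h := Measure.map_addHaar_smul (volume : Measure (Pt n)) hr.ne'
  have h2 : ∫⁻ y, f (r • y) = ∫⁻ y, f y ∂(Measure.map (r • ·) volume) :=
    (lintegral_map hf (measurable_const_smul r)).symm
  rw [h2, h, lintegral_smul_measure, finrank_euclideanSpace_fin, abs_of_pos (by positivity),
    smul_eq_mul, ← mul_assoc, ← ENNReal.ofReal_mul (by positivity),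
    mul_inv_cancel₀ (by positivity), ENNReal.ofReal_one, one_mul]

theorem setLIntegral_refSimplex_succ {f : Pt (n + 1) → ℝ≥0∞} (hf : Measurable f) :
    ∫⁻ x in refSimplex (n + 1), f x =
      ∫⁻ y in refSimplex n, ∫⁻ t in Set.Ioo (0 : ℝ) 1,
        ENNReal.ofReal ((1 - t) ^ n) * f (consPt t ((1 - t) • y)) := by
  have hm : Measurable ((refSimplex (n + 1)).indicator f) :=
    hf.indicator measurableSet_refSimplex
  have hc : Measurable fun p : ℝ × Pt n => consPt p.1 p.2 := continuous_consPt.measurable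
  have hsm : Measurable fun p : Pt n × ℝ => consPt p.2 ((1 - p.2) • p.1) := by
    have : Continuous fun p : Pt n × ℝ => consPt p.2 ((1 - p.2) • p.1) :=
      continuous_consPt.comp (by fun_prop : Continuous fun p : Pt n × ℝ => (p.2, (1 - p.2) • p.1))
    exact this.measurable
  rw [lintegral_lintegral_swap]
  · rw [← lintegral_indicator measurableSet_refSimplex, ← measurePreserving_consPt.lintegral_comp hm,
      lintegral_prod (fun p : ℝ × Pt n => (refSimplex (n + 1)).indicator f (consPt p.1 p.2))
        (hm.comp hc).aemeasurable, ← lintegral_indicator measurableSet_Ioo]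
    refine lintegral_congr_ae ?_
    have h0 : ∀ᵐ t : ℝ, t ≠ 0 := by simp [ae_iff]
    have h1 : ∀ᵐ t : ℝ, t ≠ 1 := by simp [ae_iff]
    filter_upwards [h0, h1] with t ht0 ht1
    by_cases ht : t ∈ Set.Ioo (0 : ℝ) 1
    · rw [Set.indicator_of_mem ht]
      have hr : 0 < 1 - t := by linarith [ht.2]
      rw [lintegral_comp_smul_pt hr (by fun_prop), ← lintegral_indicator measurableSet_refSimplex,
        ← lintegral_const_mul' _ _ ENNReal.ofReal_ne_top]
      refine lintegral_congr fun y => ?_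
      have hiff : consPt t ((1 - t) • y) ∈ refSimplex (n + 1) ↔ y ∈ refSimplex n := by
        rw [consPt_mem_refSimplex]
        simp only [PiLp.smul_apply, smul_eq_mul, ← Finset.mul_sum, refSimplex, Set.mem_ofPred_eq,
          ht.1.le, true_and]
        refine and_congr (forall_congr' fun i => mul_nonneg_iff_of_pos_left hr) ?_
        rw [mul_le_iff_le_one_right hr]
      by_cases hy : y ∈ refSimplex n
      · rw [Set.indicator_of_mem hy, Set.indicator_of_mem (hiff.2 hy)]
      · rw [Set.indicator_of_notMem hy, Set.indicator_of_notMem fun h => hy (hiff.1 h), mul_zero]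
    · rw [Set.indicator_of_notMem ht]
      refine (lintegral_congr (g := fun _ : Pt n => (0 : ℝ≥0∞)) fun y => ?_).trans lintegral_zero
      refine Set.indicator_of_notMem (fun h => ht ?_) _
      rw [consPt_mem_refSimplex] at h
      have h2 : 0 ≤ ∑ i, y i := Finset.sum_nonneg fun i _ => h.2.1 i
      exact ⟨lt_of_le_of_ne h.1 ht0.symm, lt_of_le_of_ne (by linarith [h.2.2]) ht1⟩
  · refine (Measurable.mul ?_ ?_).aemeasurable
    · exact (by fun_prop : Measurable fun p : Pt n × ℝ => (1 - p.2) ^ n).ennreal_ofReal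
    · exact hf.comp hsm

theorem simplexMap_consPt {d : ℕ} (b : Fin (n + 2) → Pt d) (t : ℝ) (y : Pt n) :
    simplexMap b (consPt t ((1 - t) • y)) =
      (1 - t) • simplexMap (fun i => b (Fin.succAbove 1 i)) y + t • b 1 := by
  have h0 : (Fin.succAbove (1 : Fin (n + 2)) 0) = 0 := rfl
  have h1 : ∀ i : Fin n, Fin.succAbove (1 : Fin (n + 2)) i.succ = i.succ.succ := fun i => by
    rw [← Fin.succ_zero_eq_one, Fin.succ_succAbove_succ, Fin.succAbove_zero]
  simp only [simplexMap, Fin.sum_univ_succ, consPt_zero, consPt_succ, h0, h1, PiLp.smul_apply,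
    smul_eq_mul, smul_add, Finset.smul_sum, mul_smul, Fin.succ_zero_eq_one]
  module

/-- The normalized measure of the cone over a simplex with apex `b 1`. -/
theorem lintegral_cone {d : ℕ} (b : Fin (n + 2) → Pt d) {f : Pt d → ℝ≥0∞} (hf : Measurable f) :
    ∫⁻ y, (∫⁻ t in Set.Ioo (0 : ℝ) 1,
        ENNReal.ofReal ((1 - t) ^ n) * f ((1 - t) • y + t • b 1))
        ∂(simplexMeasure fun i => b (Fin.succAbove 1 i)) =
      (volume (refSimplex (n + 1)) / volume (refSimplex n)) * ∫⁻ x, f x ∂(simplexMeasure b) := by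
  have hm : Measurable fun p : Pt d × ℝ =>
      ENNReal.ofReal ((1 - p.2) ^ n) * f ((1 - p.2) • p.1 + p.2 • b 1) := by
    refine Measurable.mul ?_ (hf.comp ?_)
    · exact (by fun_prop : Measurable fun p : Pt d × ℝ => (1 - p.2) ^ n).ennreal_ofReal
    · exact (by fun_prop : Continuous fun p : Pt d × ℝ => (1 - p.2) • p.1 + p.2 • b 1).measurable
  rw [simplexMeasure, simplexMeasure, lintegral_map hf (continuous_simplexMap b).measurable,
    lintegral_map hm.lintegral_prod_right' (continuous_simplexMap _).measurable, refMeasure,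
    refMeasure, lintegral_smul_measure, lintegral_smul_measure,
    setLIntegral_refSimplex_succ (f := fun x => f (simplexMap b x))
      (hf.comp (continuous_simplexMap b).measurable), smul_eq_mul,
    smul_eq_mul, div_eq_mul_inv, mul_comm (volume (refSimplex (n + 1))), mul_assoc,
    ← mul_assoc (volume (refSimplex (n + 1))),
    ENNReal.mul_inv_cancel volume_refSimplex_ne_zero volume_refSimplex_ne_top, one_mul]
  simp only [simplexMap_consPt]

end

end HDG

end

noncomputable section

namespace HDG

/-! ### The trace inequality and the Poincaré inequality for smooth functions -/

section

variable {n d : ℕ}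

theorem ae_mem_convexHull (a : Fin (n + 1) → Pt d) :
    ∀ᵐ x ∂(simplexMeasure a), x ∈ convexHull ℝ (Set.range a) := by
  refine (ae_map_iff (continuous_simplexMap a).aemeasurable
    (measurableSet_convexHull_range a)).2 ?_
  filter_upwards [ae_mem_refSimplex] with x hx
  rw [← simplexMap_image]
  exact ⟨x, hx, rfl⟩

theorem isCompact_convexHull_range (a : Fin (n + 1) → Pt d) :
    IsCompact (convexHull ℝ (Set.range a)) := by
  rw [← simplexMap_image]
  exact isCompact_refSimplex.image (continuous_simplexMap a)

theorem dist_le_diam_convexHull (a : Fin (n + 1) → Pt d) {x y : Pt d}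
    (hx : x ∈ convexHull ℝ (Set.range a)) (hy : y ∈ convexHull ℝ (Set.range a)) :
    ‖x - y‖ ≤ Metric.diam (convexHull ℝ (Set.range a)) := by
  rw [← dist_eq_norm]
  exact Metric.dist_le_diam_of_mem (isCompact_convexHull_range a).isBounded hx hy

theorem memLp_simplexMeasure (a : Fin (n + 1) → Pt d) {f : Pt d → ℝ} (hf : Continuous f)
    (p : ℝ≥0∞) : MemLp f p (simplexMeasure a) := by
  obtain ⟨C, hC⟩ := (isCompact_convexHull_range a).exists_bound_of_continuousOn hf.continuousOn
  exact MemLp.of_bound hf.aestronglyMeasurable C ((ae_mem_convexHull a).mono hC)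

theorem integrable_simplexMeasure (a : Fin (n + 1) → Pt d) {f : Pt d → ℝ} (hf : Continuous f) :
    Integrable f (simplexMeasure a) :=
  memLp_one_iff_integrable.1 (memLp_simplexMeasure a hf 1)

theorem continuous_partialDeriv {φ : Pt d → ℝ} (hφ : ContDiff ℝ ∞ φ) (j : Fin d) :
    Continuous (partialDeriv j φ) :=
  (hφ.continuous_fderiv (by simp)).clm_apply continuous_const

theorem fderiv_apply_eq_sum (φ : Pt d → ℝ) (x v : Pt d) :
    fderiv ℝ φ x v = ∑ j, v j * partialDeriv j φ x := by
  have : v = ∑ j, v j • EuclideanSpace.single j (1 : ℝ) := by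
    ext i
    simp [Pi.single_apply]
  conv_lhs => rw [this]
  simp [partialDeriv]

theorem norm_fderiv_le_sum (φ : Pt d → ℝ) (x : Pt d) :
    ‖fderiv ℝ φ x‖ ≤ ∑ j, |partialDeriv j φ x| := by
  refine ContinuousLinearMap.opNorm_le_bound _ (Finset.sum_nonneg fun _ _ => abs_nonneg _)
    fun v => ?_
  rw [fderiv_apply_eq_sum, Finset.sum_mul]
  refine (norm_sum_le _ _).trans (Finset.sum_le_sum fun j _ => ?_)
  rw [norm_mul, mul_comm]
  exact mul_le_mul_of_nonneg_left (PiLp.norm_apply_le v j) (abs_nonneg _)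

theorem l2Norm_norm_fderiv_le (a : Fin (n + 1) → Pt d) {φ : Pt d → ℝ} (hφ : ContDiff ℝ ∞ φ) :
    l2Norm (simplexMeasure a) (fun x => ‖fderiv ℝ φ x‖) ≤
      ∑ j, l2Norm (simplexMeasure a) (partialDeriv j φ) := by
  have h1 : ∀ j ∈ Finset.univ,
      MemLp (fun x => |partialDeriv j φ x|) 2 (simplexMeasure a) := fun j _ =>
    memLp_simplexMeasure a (continuous_partialDeriv hφ j).abs 2
  refine (l2Norm_mono (memLp_finset_sum _ h1) (ae_of_all _ fun x => ?_)).trans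
    ((l2Norm_sum_le _ h1).trans_eq ?_)
  · rw [abs_of_nonneg (norm_nonneg _)]
    exact (norm_fderiv_le_sum φ x).trans (le_abs_self _)
  · simp [l2Norm]

theorem ofReal_sq_sub_le_lintegral {f f' : ℝ → ℝ} (hf : ∀ t, HasDerivAt f (f' t) t)
    (hf' : Continuous f') :
    ENNReal.ofReal ((f 1 - f 0) ^ 2) ≤ ∫⁻ t in Set.Ioo (0 : ℝ) 1, ENNReal.ofReal (f' t ^ 2) := by
  have : IsProbabilityMeasure (volume.restrict (Set.Ioo (0 : ℝ) 1)) := ⟨by simp⟩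
  have h1 : f 1 - f 0 = ∫ t in Set.Ioo (0 : ℝ) 1, f' t := by
    rw [← intervalIntegral.integral_eq_sub_of_hasDerivAt (fun t _ => hf t)
      (hf'.intervalIntegrable 0 1), intervalIntegral.integral_of_le zero_le_one,
      integral_Ioc_eq_integral_Ioo]
  have h2 : ∀ y : ℝ, ENNReal.ofReal (y ^ 2) = ‖y‖ₑ ^ 2 := fun y => by
    rw [← sq_abs, ENNReal.ofReal_pow (abs_nonneg y), ← Real.enorm_eq_ofReal_abs]
  simp only [h2]
  refine le_trans ?_ (sq_lintegral_le (hf'.measurable.enorm.aemeasurable))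
  rw [h1]
  exact pow_le_pow_left' (enorm_integral_le_lintegral_enorm _) 2

theorem lintegral_ofReal_simplexMeasure (a : Fin (n + 1) → Pt d) {f : Pt d → ℝ}
    (hf : Continuous f) (h0 : ∀ x, 0 ≤ f x) :
    ∫⁻ x, ENNReal.ofReal (f x) ∂(simplexMeasure a) =
      ENNReal.ofReal (∫ x, f x ∂(simplexMeasure a)) :=
  (ofReal_integral_eq_lintegral_ofReal (integrable_simplexMeasure a hf) (ae_of_all _ h0)).symm

theorem sq_le_lintegral_segment {φ : Pt d → ℝ} (hφ : ContDiff ℝ ∞ φ) {y a : Pt d} {h : ℝ}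
    (hay : ‖a - y‖ ≤ h) :
    ENNReal.ofReal (φ y ^ 2) ≤ ∫⁻ t in Set.Ioo (0 : ℝ) 1, ENNReal.ofReal ((1 - t) ^ n) *
      ENNReal.ofReal ((n + 2) * φ ((1 - t) • y + t • a) ^ 2 +
        h ^ 2 * ‖fderiv ℝ φ ((1 - t) • y + t • a)‖ ^ 2) := by
  set z : ℝ → Pt d := fun t => (1 - t) • y + t • a with hz
  have hzd : ∀ t, HasDerivAt z (a - y) t := fun t => by
    have h1 : HasDerivAt (fun t : ℝ => (1 - t) • y) ((-1 : ℝ) • y) t := by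
      simpa using ((hasDerivAt_id t).const_sub 1).smul_const y
    have h2 : HasDerivAt (fun t : ℝ => t • a) ((1 : ℝ) • a) t := (hasDerivAt_id t).smul_const a
    have h3 := h1.add h2
    rwa [show (-1 : ℝ) • y + (1 : ℝ) • a = a - y by module] at h3
  have hφd : ∀ x, HasFDerivAt φ (fderiv ℝ φ x) x := fun x =>
    (hφ.differentiable (by simp) x).hasFDerivAt
  have hcd : Continuous (fderiv ℝ φ) := hφ.continuous_fderiv (by simp)
  have hcz : Continuous z := by fun_prop
  have hcφ := hφ.continuous
  have hd1 : ∀ t, HasDerivAt (fun t => φ (z t)) (fderiv ℝ φ (z t) (a - y)) t := fun t =>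
    (hφd (z t)).comp_hasDerivAt t (hzd t)
  set F : ℝ → ℝ := fun t => -((1 - t) ^ (n + 1) * φ (z t) ^ 2) with hF
  set F' : ℝ → ℝ := fun t => (n + 1) * (1 - t) ^ n * φ (z t) ^ 2 -
    (1 - t) ^ (n + 1) * (2 * φ (z t) * fderiv ℝ φ (z t) (a - y)) with hF'
  have hFd : ∀ t, HasDerivAt F (F' t) t := fun t => by
    have h1 : HasDerivAt (fun t : ℝ => (1 - t) ^ (n + 1)) ((n + 1 : ℕ) * (1 - t) ^ n * (-1)) t := by
      simpa using ((hasDerivAt_id' t).const_sub 1).fun_pow (n + 1)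
    have h2 := (hd1 t).fun_pow 2
    have h3 := (h1.mul h2).neg
    convert! h3 using 1
    simp only [hF', Nat.cast_add, Nat.cast_one, Nat.cast_ofNat]
    ring
  have hF'c : Continuous F' := by
    have : Continuous fun t => fderiv ℝ φ (z t) (a - y) :=
      (hcd.comp hcz).clm_apply continuous_const
    fun_prop
  have hint : φ y ^ 2 = ∫ t in Set.Ioo (0 : ℝ) 1, F' t := by
    rw [← integral_Ioc_eq_integral_Ioo, ← intervalIntegral.integral_of_le zero_le_one,
      intervalIntegral.integral_eq_sub_of_hasDerivAt (fun t _ => hFd t)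
      (hF'c.intervalIntegrable 0 1)]
    simp [hF, hz]
  set g : ℝ → ℝ := fun t => (1 - t) ^ n *
    ((n + 2) * φ (z t) ^ 2 + h ^ 2 * ‖fderiv ℝ φ (z t)‖ ^ 2) with hg
  have hgc : Continuous g := by
    have : Continuous fun t => ‖fderiv ℝ φ (z t)‖ := (hcd.comp hcz).norm
    fun_prop
  have hgi : IntegrableOn g (Set.Ioo (0 : ℝ) 1) :=
    (hgc.integrableOn_Icc (a := 0) (b := 1)).mono_set Set.Ioo_subset_Icc_self
  have hFi : IntegrableOn F' (Set.Ioo (0 : ℝ) 1) :=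
    (hF'c.integrableOn_Icc (a := 0) (b := 1)).mono_set Set.Ioo_subset_Icc_self
  have hle : ∀ t ∈ Set.Ioo (0 : ℝ) 1, F' t ≤ g t := fun t ht => by
    have h1 : 0 ≤ 1 - t := by linarith [ht.2]
    have h2 : 1 - t ≤ 1 := by linarith [ht.1]
    have h3 : |fderiv ℝ φ (z t) (a - y)| ≤ h * ‖fderiv ℝ φ (z t)‖ := by
      refine ((fderiv ℝ φ (z t)).le_opNorm _).trans ?_
      rw [mul_comm]
      exact mul_le_mul_of_nonneg_right hay (norm_nonneg _)
    set D := fderiv ℝ φ (z t) (a - y)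
    have h4 : D ^ 2 ≤ h ^ 2 * ‖fderiv ℝ φ (z t)‖ ^ 2 := by
      rw [← mul_pow, ← sq_abs D]
      exact pow_le_pow_left₀ (abs_nonneg _) h3 2
    have h5 : -((1 - t) * (2 * φ (z t) * D)) ≤ φ (z t) ^ 2 + D ^ 2 := by
      nlinarith [sq_nonneg (φ (z t) + (1 - t) * D), sq_nonneg D,
        mul_nonneg h1 (sq_nonneg D), mul_nonneg (mul_nonneg h1 h1) (sq_nonneg D)]
    have h6 : F' t = (1 - t) ^ n * ((n + 1) * φ (z t) ^ 2 - (1 - t) * (2 * φ (z t) * D)) := by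
      simp only [hF', pow_succ]; ring
    rw [h6]
    refine mul_le_mul_of_nonneg_left ?_ (pow_nonneg h1 n)
    linarith
  have hg0 : ∀ᵐ t ∂(volume.restrict (Set.Ioo (0 : ℝ) 1)), 0 ≤ g t := by
    filter_upwards [ae_restrict_mem measurableSet_Ioo] with t ht
    have h1 : 0 ≤ 1 - t := by linarith [ht.2]
    positivity
  calc ENNReal.ofReal (φ y ^ 2) ≤ ENNReal.ofReal (∫ t in Set.Ioo (0 : ℝ) 1, g t) := by
        rw [hint]
        exact ENNReal.ofReal_le_ofReal (setIntegral_mono_on hFi hgi measurableSet_Ioo hle)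
    _ = ∫⁻ t in Set.Ioo (0 : ℝ) 1, ENNReal.ofReal (g t) :=
        ofReal_integral_eq_lintegral_ofReal hgi hg0
    _ = _ := by
        refine setLIntegral_congr_fun measurableSet_Ioo fun t ht => ?_
        have h1 : 0 ≤ 1 - t := by linarith [ht.2]
        exact ENNReal.ofReal_mul (pow_nonneg h1 n)

/-- The constant of the trace inequality. -/
def traceConst (n : ℕ) : ℝ :=
  Real.sqrt ((volume (refSimplex (n + 1)) / volume (refSimplex n)).toReal * (n + 2))

/-- The trace inequality for smooth functions, with normalized measures. -/
theorem l2Norm_face_le (b : Fin (n + 2) → Pt d) {φ : Pt d → ℝ} (hφ : ContDiff ℝ ∞ φ) :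
    l2Norm (simplexMeasure fun i => b (Fin.succAbove 1 i)) φ ≤
      traceConst n * (l2Norm (simplexMeasure b) φ +
        Metric.diam (convexHull ℝ (Set.range b)) *
          ∑ j, l2Norm (simplexMeasure b) (partialDeriv j φ)) := by
  set h := Metric.diam (convexHull ℝ (Set.range b)) with hh
  set R := volume (refSimplex (n + 1)) / volume (refSimplex n) with hR
  have hRt : R ≠ ⊤ := ENNReal.div_ne_top volume_refSimplex_ne_top volume_refSimplex_ne_zero
  have hcφ := hφ.continuous
  have hcd : Continuous fun x => ‖fderiv ℝ φ x‖ := (hφ.continuous_fderiv (by simp)).norm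
  set G : Pt d → ℝ := fun x => (n + 2) * φ x ^ 2 + h ^ 2 * ‖fderiv ℝ φ x‖ ^ 2 with hG
  have hGc : Continuous G := by fun_prop
  have hG0 : ∀ x, 0 ≤ G x := fun x => by positivity
  have hsub : convexHull ℝ (Set.range fun i => b (Fin.succAbove 1 i)) ⊆
      convexHull ℝ (Set.range b) :=
    convexHull_mono (by rintro _ ⟨i, rfl⟩; exact ⟨_, rfl⟩)
  have h1 : ∫⁻ y, ENNReal.ofReal (φ y ^ 2) ∂(simplexMeasure fun i => b (Fin.succAbove 1 i)) ≤
      R * ∫⁻ x, ENNReal.ofReal (G x) ∂(simplexMeasure b) := by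
    rw [hR, ← lintegral_cone b hGc.measurable.ennreal_ofReal]
    refine lintegral_mono_ae ?_
    filter_upwards [ae_mem_convexHull fun i => b (Fin.succAbove 1 i)] with y hy
    exact sq_le_lintegral_segment hφ
      (dist_le_diam_convexHull b (subset_convexHull ℝ _ ⟨1, rfl⟩) (hsub hy))
  rw [lintegral_ofReal_simplexMeasure (f := fun y => φ y ^ 2) _ (hcφ.pow 2) fun _ => sq_nonneg _,
    lintegral_ofReal_simplexMeasure _ hGc hG0, ← ENNReal.ofReal_toReal hRt,
    ← ENNReal.ofReal_mul ENNReal.toReal_nonneg,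
    ENNReal.ofReal_le_ofReal_iff (mul_nonneg ENNReal.toReal_nonneg
      (integral_nonneg hG0))] at h1
  have h2 : ∫ x, G x ∂(simplexMeasure b) = (n + 2) * l2Norm (simplexMeasure b) φ ^ 2 +
      h ^ 2 * l2Norm (simplexMeasure b) (fun x => ‖fderiv ℝ φ x‖) ^ 2 := by
    rw [l2Norm_sq, l2Norm_sq, ← integral_const_mul, ← integral_const_mul, ← integral_add]
    · exact integrable_simplexMeasure b (by fun_prop)
    · exact integrable_simplexMeasure b (by fun_prop)
  have h3 := l2Norm_norm_fderiv_le b hφ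
  have hh0 : 0 ≤ h := Metric.diam_nonneg
  set A := l2Norm (simplexMeasure b) φ
  set D := l2Norm (simplexMeasure b) (fun x => ‖fderiv ℝ φ x‖)
  set S := ∑ j, l2Norm (simplexMeasure b) (partialDeriv j φ)
  have hA : 0 ≤ A := l2Norm_nonneg _ _
  have hD : 0 ≤ D := l2Norm_nonneg _ _
  have hS : 0 ≤ S := hD.trans h3
  have h4 : (n + 2) * A ^ 2 + h ^ 2 * D ^ 2 ≤ (n + 2) * (A + h * S) ^ 2 := by
    have h5 : h * D ≤ h * S := mul_le_mul_of_nonneg_left h3 hh0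
    have h6 : 0 ≤ h * D := mul_nonneg hh0 hD
    have h7 : A ^ 2 + (h * D) ^ 2 ≤ (A + h * S) ^ 2 := by nlinarith
    have h8 : (0 : ℝ) ≤ n := Nat.cast_nonneg n
    nlinarith [sq_nonneg (h * D), mul_nonneg h8 (sq_nonneg (h * D)),
      mul_le_mul_of_nonneg_left h7 (by positivity : (0 : ℝ) ≤ n + 2)]
  rw [h2] at h1
  rw [l2Norm, traceConst, ← Real.sqrt_sq (by positivity : 0 ≤ A + h * S),
    ← Real.sqrt_mul (by positivity)]
  refine Real.sqrt_le_sqrt (h1.trans ?_)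
  rw [mul_assoc]
  exact mul_le_mul_of_nonneg_left h4 ENNReal.toReal_nonneg

end

end HDG

end

noncomputable section

namespace HDG

section

variable {n d : ℕ}

theorem simplexMap_combo (a : Fin (n + 1) → Pt d) (x y : Pt n) (t : ℝ) :
    simplexMap a ((1 - t) • x + t • y) = (1 - t) • simplexMap a x + t • simplexMap a y := by
  simp only [simplexMap_eq, map_add, map_smul]
  module

theorem lintegral_refMeasure_combo_le {g : Pt n → ℝ≥0∞} (hg : Measurable g) {y : Pt n}
    (hy : y ∈ refSimplex n) {t : ℝ} (h0 : 0 ≤ t) (h1 : t ≤ 1 / 2) :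
    ∫⁻ x, g ((1 - t) • x + t • y) ∂(refMeasure n) ≤ 2 ^ n * ∫⁻ x, g x ∂(refMeasure n) := by
  simp only [refMeasure, lintegral_smul_measure, smul_eq_mul]
  rw [mul_left_comm]
  refine mul_le_mul_right ?_ _
  have hr : 0 < 1 - t := by linarith
  have hm : Measurable ((refSimplex n).indicator g) := hg.indicator measurableSet_refSimplex
  rw [← lintegral_indicator measurableSet_refSimplex, ← lintegral_indicator measurableSet_refSimplex]
  calc ∫⁻ x, (refSimplex n).indicator (fun x => g ((1 - t) • x + t • y)) x
      ≤ ∫⁻ x, (refSimplex n).indicator g ((1 - t) • x + t • y) := by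
        refine lintegral_mono fun x => ?_
        by_cases hx : x ∈ refSimplex n
        · rw [Set.indicator_of_mem hx, Set.indicator_of_mem]
          exact convex_refSimplex hx hy hr.le h0 (by ring)
        · rw [Set.indicator_of_notMem hx]; exact zero_le
    _ ≤ 2 ^ n * (ENNReal.ofReal ((1 - t) ^ n) *
          ∫⁻ x, (refSimplex n).indicator g ((1 - t) • x + t • y)) := by
        rw [← mul_assoc]
        refine le_mul_of_one_le_left' ?_
        rw [show (2 : ℝ≥0∞) ^ n = ENNReal.ofReal (2 ^ n) by
          rw [ENNReal.ofReal_pow (by norm_num)]; simp, ← ENNReal.ofReal_mul (by positivity),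
          ← mul_pow, ENNReal.one_le_ofReal]
        exact one_le_pow₀ (by linarith)
    _ = 2 ^ n * ∫⁻ x, (refSimplex n).indicator g x := by
        rw [← lintegral_comp_smul_pt hr (f := fun x => (refSimplex n).indicator g (x + t • y))
          (hm.comp (measurable_add_const _)), lintegral_add_right_eq_self]

theorem lintegral_simplexMeasure_combo_le (a : Fin (n + 1) → Pt d) {g : Pt d → ℝ≥0∞}
    (hg : Measurable g) {y : Pt d} (hy : y ∈ convexHull ℝ (Set.range a)) {t : ℝ} (h0 : 0 ≤ t)
    (h1 : t ≤ 1 / 2) :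
    ∫⁻ x, g ((1 - t) • x + t • y) ∂(simplexMeasure a) ≤
      2 ^ n * ∫⁻ x, g x ∂(simplexMeasure a) := by
  rw [← simplexMap_image] at hy
  obtain ⟨y, hy, rfl⟩ := hy
  have hc : Measurable (simplexMap a) := (continuous_simplexMap a).measurable
  rw [simplexMeasure, lintegral_map hg hc, lintegral_map (by fun_prop) hc]
  simp only [← simplexMap_combo]
  exact lintegral_refMeasure_combo_le (hg.comp hc) hy h0 h1

theorem lintegral_sq_sub_midpoint_le (a : Fin (n + 1) → Pt d) {φ : Pt d → ℝ}
    (hφ : ContDiff ℝ ∞ φ) :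
    ∫⁻ y, ∫⁻ x, ENNReal.ofReal ((φ ((1 / 2 : ℝ) • x + (1 / 2 : ℝ) • y) - φ x) ^ 2)
        ∂(simplexMeasure a) ∂(simplexMeasure a) ≤
      2 ^ n * ENNReal.ofReal (Metric.diam (convexHull ℝ (Set.range a)) ^ 2) *
        ∫⁻ x, ENNReal.ofReal (‖fderiv ℝ φ x‖ ^ 2) ∂(simplexMeasure a) := by
  set h := Metric.diam (convexHull ℝ (Set.range a))
  have hcd : Continuous (fderiv ℝ φ) := hφ.continuous_fderiv (by simp)
  have hφd : ∀ x, HasFDerivAt φ (fderiv ℝ φ x) x := fun x =>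
    (hφ.differentiable (by simp) x).hasFDerivAt
  set G : Pt d → ℝ≥0∞ := fun x => ENNReal.ofReal (‖fderiv ℝ φ x‖ ^ 2) with hG
  have hGm : Measurable G := (by fun_prop : Continuous fun x => ‖fderiv ℝ φ x‖ ^ 2).measurable.ennreal_ofReal
  have key : ∀ y ∈ convexHull ℝ (Set.range a), ∀ x ∈ convexHull ℝ (Set.range a),
      ENNReal.ofReal ((φ ((1 / 2 : ℝ) • x + (1 / 2 : ℝ) • y) - φ x) ^ 2) ≤
      ∫⁻ t in Set.Ioo (0 : ℝ) 1, ENNReal.ofReal (h ^ 2) * G ((1 - t / 2) • x + (t / 2) • y) := by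
    intro y hy x hx
    set z : ℝ → Pt d := fun t => (1 - t / 2) • x + (t / 2) • y with hz
    have hzd : ∀ t, HasDerivAt z ((1 / 2 : ℝ) • (y - x)) t := fun t => by
      have h2 : HasDerivAt (fun t : ℝ => t / 2) (1 / 2) t := (hasDerivAt_id t).div_const 2
      have h1 := ((h2.const_sub 1).smul_const x).add (h2.smul_const y)
      rw [show (-(1 / 2) : ℝ) • x + (1 / 2 : ℝ) • y = (1 / 2 : ℝ) • (y - x) by module] at h1
      exact h1
    have hcz : Continuous z := by fun_prop
    have h3 := ofReal_sq_sub_le_lintegral (f := fun t => φ (z t))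
      (f' := fun t => fderiv ℝ φ (z t) ((1 / 2 : ℝ) • (y - x)))
      (fun t => (hφd (z t)).comp_hasDerivAt t (hzd t)) ((hcd.comp hcz).clm_apply continuous_const)
    have h4 : z 1 = (1 / 2 : ℝ) • x + (1 / 2 : ℝ) • y := by simp only [hz]; norm_num
    have h5 : z 0 = x := by simp [hz]
    simp only [h4, h5] at h3
    refine h3.trans (lintegral_mono fun t => ?_)
    rw [hG]
    simp only
    rw [← ENNReal.ofReal_mul (sq_nonneg _), ← mul_pow]
    refine ENNReal.ofReal_le_ofReal (sq_le_sq' ?_ ?_)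
    all_goals
      have h6 : |fderiv ℝ φ (z t) ((1 / 2 : ℝ) • (y - x))| ≤ h * ‖fderiv ℝ φ (z t)‖ := by
        refine ((fderiv ℝ φ (z t)).le_opNorm _).trans ?_
        rw [mul_comm]
        refine mul_le_mul_of_nonneg_right ?_ (norm_nonneg _)
        rw [norm_smul]
        have := dist_le_diam_convexHull a hy hx
        have h0 := norm_nonneg (y - x)
        rw [show ‖(1 / 2 : ℝ)‖ = 1 / 2 by norm_num]
        linarith
    · exact neg_le_of_abs_le h6
    · exact le_of_abs_le h6
  have inner : ∀ y ∈ convexHull ℝ (Set.range a),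
      ∫⁻ x, ENNReal.ofReal ((φ ((1 / 2 : ℝ) • x + (1 / 2 : ℝ) • y) - φ x) ^ 2)
        ∂(simplexMeasure a) ≤ 2 ^ n * ENNReal.ofReal (h ^ 2) * ∫⁻ x, G x ∂(simplexMeasure a) := by
    intro y hy
    have hm : Measurable fun p : Pt d × ℝ => G ((1 - p.2 / 2) • p.1 + (p.2 / 2) • y) :=
      hGm.comp (by fun_prop : Continuous fun p : Pt d × ℝ =>
        (1 - p.2 / 2) • p.1 + (p.2 / 2) • y).measurable
    calc _ ≤ ∫⁻ x, (∫⁻ t in Set.Ioo (0 : ℝ) 1,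
            ENNReal.ofReal (h ^ 2) * G ((1 - t / 2) • x + (t / 2) • y)) ∂(simplexMeasure a) :=
          lintegral_mono_ae ((ae_mem_convexHull a).mono fun x hx => key y hy x hx)
      _ = ∫⁻ t in Set.Ioo (0 : ℝ) 1, (∫⁻ x,
            ENNReal.ofReal (h ^ 2) * G ((1 - t / 2) • x + (t / 2) • y) ∂(simplexMeasure a)) :=
          lintegral_lintegral_swap (hm.const_mul _).aemeasurable
      _ ≤ ∫⁻ t in Set.Ioo (0 : ℝ) 1,
            (2 ^ n * ENNReal.ofReal (h ^ 2) * ∫⁻ x, G x ∂(simplexMeasure a)) := by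
          refine setLIntegral_mono measurable_const fun t ht => ?_
          rw [lintegral_const_mul' _ _ ENNReal.ofReal_ne_top, mul_comm (2 ^ n), mul_assoc]
          refine mul_le_mul_right ?_ _
          exact lintegral_simplexMeasure_combo_le a hGm hy (by linarith [ht.1]) (by linarith [ht.2])
      _ = _ := by simp
  calc _ ≤ ∫⁻ _y, (2 ^ n * ENNReal.ofReal (h ^ 2) * ∫⁻ x, G x ∂(simplexMeasure a))
        ∂(simplexMeasure a) :=
        lintegral_mono_ae ((ae_mem_convexHull a).mono fun y hy => inner y hy)
    _ = _ := by simp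

theorem lintegral_sq_sub_mean_le (a : Fin (n + 1) → Pt d) {φ : Pt d → ℝ} (hφ : ContDiff ℝ ∞ φ) :
    ∫⁻ x, ENNReal.ofReal ((φ x - ∫ y, φ y ∂(simplexMeasure a)) ^ 2) ∂(simplexMeasure a) ≤
      4 * ∫⁻ y, ∫⁻ x, ENNReal.ofReal ((φ ((1 / 2 : ℝ) • x + (1 / 2 : ℝ) • y) - φ x) ^ 2)
        ∂(simplexMeasure a) ∂(simplexMeasure a) := by
  set τ := simplexMeasure a with hτ
  have hcφ := hφ.continuous
  set m : ℝ := ∫ y, φ y ∂τ with hm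
  have hi : Integrable φ τ := integrable_simplexMeasure a hcφ
  have hsq : ∀ y : ℝ, ENNReal.ofReal (y ^ 2) = ‖y‖ₑ ^ 2 := fun y => by
    rw [← sq_abs, ENNReal.ofReal_pow (abs_nonneg y), ← Real.enorm_eq_ofReal_abs]
  have h1 : ∫⁻ x, ENNReal.ofReal ((φ x - m) ^ 2) ∂τ ≤
      ∫⁻ x, ∫⁻ y, ENNReal.ofReal ((φ x - φ y) ^ 2) ∂τ ∂τ := by
    refine lintegral_mono fun x => ?_
    simp only [hsq]
    have : φ x - m = ∫ y, (φ x - φ y) ∂τ := by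
      rw [integral_sub (integrable_const _) hi]; simp [hm]
    rw [this]
    refine le_trans (pow_le_pow_left' (enorm_integral_le_lintegral_enorm _) 2)
      (sq_lintegral_le ?_)
    exact (by fun_prop : Continuous fun y => φ x - φ y).measurable.enorm.aemeasurable
  obtain ⟨M, hM⟩ : ∃ M : Pt d → Pt d → ℝ≥0∞, ∀ x y, M x y =
      ENNReal.ofReal ((φ ((1 / 2 : ℝ) • x + (1 / 2 : ℝ) • y) - φ x) ^ 2) := ⟨_, fun _ _ => rfl⟩
  have hMm : Measurable fun p : Pt d × Pt d => M p.1 p.2 := by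
    simp only [hM]
    have hc : Continuous fun p : Pt d × Pt d =>
        (φ ((1 / 2 : ℝ) • p.1 + (1 / 2 : ℝ) • p.2) - φ p.1) ^ 2 := by fun_prop
    exact hc.measurable.ennreal_ofReal
  have hMm' : Measurable fun p : Pt d × Pt d => M p.2 p.1 := hMm.comp measurable_swap
  have h2 : ∫⁻ x, ∫⁻ y, ENNReal.ofReal ((φ x - φ y) ^ 2) ∂τ ∂τ ≤
      ∫⁻ x, ∫⁻ y, (2 * M x y + 2 * M y x) ∂τ ∂τ := by
    refine lintegral_mono fun x => lintegral_mono fun y => ?_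
    have e1 : (1 / 2 : ℝ) • y + (1 / 2 : ℝ) • x = (1 / 2 : ℝ) • x + (1 / 2 : ℝ) • y := add_comm _ _
    have e2 : ∀ r : ℝ, 2 * ENNReal.ofReal r = ENNReal.ofReal (2 * r) := fun r => by
      rw [ENNReal.ofReal_mul (by norm_num), ENNReal.ofReal_ofNat]
    simp only [hM, e1, e2]
    rw [← ENNReal.ofReal_add (by positivity) (by positivity)]
    refine ENNReal.ofReal_le_ofReal ?_
    set c := φ ((1 / 2 : ℝ) • x + (1 / 2 : ℝ) • y)
    nlinarith [sq_nonneg ((c - φ x) + (c - φ y))]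
  have h3 : ∫⁻ x, ∫⁻ y, (2 * M x y + 2 * M y x) ∂τ ∂τ = 4 * ∫⁻ y, ∫⁻ x, M x y ∂τ ∂τ := by
    have e1 : ∀ x, ∫⁻ y, (2 * M x y + 2 * M y x) ∂τ =
        2 * ∫⁻ y, M x y ∂τ + 2 * ∫⁻ y, M y x ∂τ := fun x => by
      have e0 : Measurable fun y => M x y := hMm.comp measurable_prodMk_left
      rw [lintegral_add_left (e0.const_mul 2),
        lintegral_const_mul' _ _ (by norm_num), lintegral_const_mul' _ _ (by norm_num)]
    simp only [e1]
    rw [lintegral_add_left (hMm.lintegral_prod_right'.const_mul 2),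
      lintegral_const_mul' _ _ (by norm_num), lintegral_const_mul' _ _ (by norm_num),
      lintegral_lintegral_swap hMm.aemeasurable, ← add_mul]
    norm_num
  simp only [← hM]
  exact (h1.trans h2).trans_eq h3

/-- The constant of the Poincaré inequality. -/
def poincareConst (n : ℕ) : ℝ := Real.sqrt (4 * 2 ^ n)

/-- The Poincaré inequality on a simplex for smooth functions. -/
theorem l2Norm_sub_mean_le (a : Fin (n + 1) → Pt d) {φ : Pt d → ℝ} (hφ : ContDiff ℝ ∞ φ) :
    l2Norm (simplexMeasure a) (fun x => φ x - ∫ y, φ y ∂(simplexMeasure a)) ≤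
      poincareConst n * (Metric.diam (convexHull ℝ (Set.range a)) *
          ∑ j, l2Norm (simplexMeasure a) (partialDeriv j φ)) := by
  set h := Metric.diam (convexHull ℝ (Set.range a)) with hh
  set τ := simplexMeasure a with hτ
  have hcφ := hφ.continuous
  have hcd : Continuous fun x => ‖fderiv ℝ φ x‖ := (hφ.continuous_fderiv (by simp)).norm
  set m : ℝ := ∫ y, φ y ∂τ with hm
  have h4 := lintegral_sq_sub_mean_le a hφ
  have h5 := h4.trans (mul_le_mul_right (lintegral_sq_sub_midpoint_le a hφ) 4)
  rw [lintegral_ofReal_simplexMeasure (f := fun x => (φ x - m) ^ 2) a (by fun_prop)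
    fun _ => sq_nonneg _, lintegral_ofReal_simplexMeasure (f := fun x => ‖fderiv ℝ φ x‖ ^ 2) a
    (by fun_prop) fun _ => sq_nonneg _, show (2 : ℝ≥0∞) ^ n = ENNReal.ofReal (2 ^ n) by
      rw [ENNReal.ofReal_pow (by norm_num)]; simp, show (4 : ℝ≥0∞) = ENNReal.ofReal 4 by simp,
    ← ENNReal.ofReal_mul (by positivity), ← ENNReal.ofReal_mul (by positivity),
    ← ENNReal.ofReal_mul (by positivity), ENNReal.ofReal_le_ofReal_iff (by positivity)] at h5
  have h6 := l2Norm_norm_fderiv_le a hφ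
  rw [← l2Norm_sq, ← l2Norm_sq] at h5
  set D := l2Norm τ fun x => ‖fderiv ℝ φ x‖
  have hD : 0 ≤ D := l2Norm_nonneg _ _
  have hh0 : 0 ≤ h := Metric.diam_nonneg
  have h7 : l2Norm τ (fun x => φ x - m) ≤ poincareConst n * (h * D) := by
    refine abs_le_of_sq_le_sq' ?_ (by unfold poincareConst; positivity) |>.2
    rw [mul_pow, poincareConst, Real.sq_sqrt (by positivity)]
    refine h5.trans_eq (by ring)
  refine h7.trans ?_
  unfold poincareConst
  gcongr

end

end HDG

end

noncomputable section

namespace HDG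

/-! ### Iterated partial derivatives of smooth functions -/

section

variable {d : ℕ}

theorem contDiff_partialDeriv {φ : Pt d → ℝ} (hφ : ContDiff ℝ ∞ φ) (i : Fin d) :
    ContDiff ℝ ∞ (partialDeriv i φ) :=
  (hφ.fderiv_right (m := ∞) (by simp)).clm_apply contDiff_const

theorem partialDeriv_comm {φ : Pt d → ℝ} (hφ : ContDiff ℝ ∞ φ) (i j : Fin d) :
    partialDeriv i (partialDeriv j φ) = partialDeriv j (partialDeriv i φ) := by
  have key : ∀ (i j : Fin d) (x : Pt d), partialDeriv i (partialDeriv j φ) x =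
      fderiv ℝ (fderiv ℝ φ) x (EuclideanSpace.single i 1) (EuclideanSpace.single j 1) := by
    intro i j x
    have h1 : DifferentiableAt ℝ (fderiv ℝ φ) x :=
      (hφ.fderiv_right (m := ∞) (by simp)).differentiable (by simp) x
    unfold partialDeriv
    rw [fderiv_clm_apply h1 (differentiableAt_const _)]
    simp
  funext x
  rw [key, key]
  exact (hφ.contDiffAt.isSymmSndFDerivAt (by simpa using WithTop.coe_le_coe.2 (le_top : (2 : ℕ∞) ≤ ⊤))) _ _

theorem partialDeriv_sub {φ ψ : Pt d → ℝ} (hφ : ContDiff ℝ ∞ φ) (hψ : ContDiff ℝ ∞ ψ) (i : Fin d) :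
    partialDeriv i (fun x => φ x - ψ x) = fun x => partialDeriv i φ x - partialDeriv i ψ x := by
  funext x
  simp only [partialDeriv]
  rw [fderiv_fun_sub (hφ.differentiable (by simp) x) (hψ.differentiable (by simp) x)]
  simp

theorem contDiff_iterate_partialDeriv (i : Fin d) (m : ℕ) {φ : Pt d → ℝ} (hφ : ContDiff ℝ ∞ φ) :
    ContDiff ℝ ∞ ((partialDeriv i)^[m] φ) := by
  induction m generalizing φ with
  | zero => exact hφ
  | succ m ih => exact ih (contDiff_partialDeriv hφ i)

theorem iterate_partialDeriv_comm (i j : Fin d) (m : ℕ) {φ : Pt d → ℝ} (hφ : ContDiff ℝ ∞ φ) :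
    (partialDeriv i)^[m] (partialDeriv j φ) = partialDeriv j ((partialDeriv i)^[m] φ) := by
  induction m generalizing φ with
  | zero => rfl
  | succ m ih =>
    rw [Function.iterate_succ_apply, Function.iterate_succ_apply, partialDeriv_comm hφ,
      ih (contDiff_partialDeriv hφ i)]

theorem contDiff_foldr (l : List (Fin d)) (α : Fin d → ℕ) {φ : Pt d → ℝ} (hφ : ContDiff ℝ ∞ φ) :
    ContDiff ℝ ∞ (l.foldr (fun i ψ => (partialDeriv i)^[α i] ψ) φ) := by
  induction l with
  | nil => exact hφ
  | cons i l ih => exact contDiff_iterate_partialDeriv i _ ih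

theorem contDiff_multiDeriv (α : Fin d → ℕ) {φ : Pt d → ℝ} (hφ : ContDiff ℝ ∞ φ) :
    ContDiff ℝ ∞ (multiDeriv α φ) :=
  contDiff_foldr _ α hφ

theorem multiDeriv_zero (φ : Pt d → ℝ) : multiDeriv 0 φ = φ := by
  unfold multiDeriv
  generalize List.finRange d = l
  induction l with
  | nil => rfl
  | cons i l ih => simp [ih]

theorem multiDeriv_add_single (α : Fin d → ℕ) (j : Fin d) {φ : Pt d → ℝ} (hφ : ContDiff ℝ ∞ φ) :
    multiDeriv (α + Pi.single j 1) φ = partialDeriv j (multiDeriv α φ) := by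
  have h1 : ∀ l : List (Fin d), j ∉ l →
      l.foldr (fun i ψ => (partialDeriv i)^[(α + Pi.single j 1 : Fin d → ℕ) i] ψ) φ =
        l.foldr (fun i ψ => (partialDeriv i)^[α i] ψ) φ := by
    intro l
    induction l with
    | nil => intro _; rfl
    | cons i l ih =>
      intro hj
      simp only [List.mem_cons, not_or] at hj
      rw [List.foldr_cons, List.foldr_cons, ih hj.2, Pi.add_apply, Pi.single_apply,
        if_neg (Ne.symm hj.1), add_zero]
  have h2 : ∀ l : List (Fin d), l.Nodup → j ∈ l →
      l.foldr (fun i ψ => (partialDeriv i)^[(α + Pi.single j 1 : Fin d → ℕ) i] ψ) φ =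
        partialDeriv j (l.foldr (fun i ψ => (partialDeriv i)^[α i] ψ) φ) := by
    intro l
    induction l with
    | nil => intro _ h; simp at h
    | cons i l ih =>
      intro hl hj
      rw [List.nodup_cons] at hl
      rcases eq_or_ne j i with rfl | hji
      · rw [List.foldr_cons, List.foldr_cons, h1 l hl.1, Pi.add_apply, Pi.single_eq_same,
          Function.iterate_succ_apply']
      · have hjl : j ∈ l := by simpa [hji] using hj
        rw [List.foldr_cons, List.foldr_cons, ih hl.2 hjl, Pi.add_apply, Pi.single_apply,
          if_neg (Ne.symm hji), add_zero]
        exact iterate_partialDeriv_comm i j _ (contDiff_foldr l α hφ)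
  exact h2 _ (List.nodup_finRange d) (List.mem_finRange j)

theorem multiDeriv_single (j : Fin d) {φ : Pt d → ℝ} (hφ : ContDiff ℝ ∞ φ) :
    multiDeriv (Pi.single j 1) φ = partialDeriv j φ := by
  have := multiDeriv_add_single 0 j hφ
  rwa [zero_add, multiDeriv_zero] at this

theorem exists_eq_add_single {α : Fin d → ℕ} {m : ℕ} (h : ∑ i, α i = m + 1) :
    ∃ (β : Fin d → ℕ) (j : Fin d), α = β + Pi.single j 1 ∧ ∑ i, β i = m := by
  obtain ⟨j, -, hj⟩ := Finset.exists_ne_zero_of_sum_ne_zero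
    (by rw [h]; exact Nat.succ_ne_zero m : ∑ i, α i ≠ 0)
  have he : α = (α - Pi.single j 1) + Pi.single j 1 := by
    funext i
    rcases eq_or_ne i j with rfl | hij
    · simp; omega
    · simp [hij]
  refine ⟨α - Pi.single j 1, j, he, ?_⟩
  have h2 := h
  rw [he] at h2
  simp only [Pi.add_apply, Finset.sum_add_distrib, Finset.sum_pi_single', Finset.mem_univ,
    if_true] at h2
  omega

theorem sum_add_single (α : Fin d → ℕ) (j : Fin d) :
    ∑ i, (α + Pi.single j 1 : Fin d → ℕ) i = ∑ i, α i + 1 := by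
  simp [Finset.sum_add_distrib, Finset.sum_pi_single']

/-- Induction on multi-indices. -/
theorem multiIndex_induction {P : (Fin d → ℕ) → Prop} (zero : P 0)
    (add : ∀ α j, P α → P (α + Pi.single j 1)) (α : Fin d → ℕ) : P α := by
  have : ∀ m, ∀ α : Fin d → ℕ, ∑ i, α i = m → P α := by
    intro m
    induction m with
    | zero =>
      intro α h
      have : α = 0 := by
        funext i
        exact (Finset.sum_eq_zero_iff.1 h) i (Finset.mem_univ i)
      rwa [this]
    | succ m ih =>
      intro α h
      obtain ⟨β, j, rfl, hβ⟩ := exists_eq_add_single h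
      exact add β j (ih β hβ)
  exact this _ α rfl

theorem multiDeriv_sub (α : Fin d → ℕ) {φ ψ : Pt d → ℝ} (hφ : ContDiff ℝ ∞ φ)
    (hψ : ContDiff ℝ ∞ ψ) :
    multiDeriv α (fun x => φ x - ψ x) = fun x => multiDeriv α φ x - multiDeriv α ψ x := by
  refine multiIndex_induction (P := fun α => multiDeriv α (fun x => φ x - ψ x) =
    fun x => multiDeriv α φ x - multiDeriv α ψ x) ?_ (fun α j ih => ?_) α
  · simp [multiDeriv_zero]
  · rw [multiDeriv_add_single α j (hφ.sub hψ), multiDeriv_add_single α j hφ,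
      multiDeriv_add_single α j hψ, ih, partialDeriv_sub (contDiff_multiDeriv α hφ)
      (contDiff_multiDeriv α hψ)]

/-! ### Polynomial functions -/

theorem polyFun_add (p q : MvPolynomial (Fin d) ℝ) (x : Pt d) :
    polyFun (p + q) x = polyFun p x + polyFun q x := by simp [polyFun]

theorem polyFun_sub (p q : MvPolynomial (Fin d) ℝ) (x : Pt d) :
    polyFun (p - q) x = polyFun p x - polyFun q x := by simp [polyFun]

theorem polyFun_mul (p q : MvPolynomial (Fin d) ℝ) (x : Pt d) :
    polyFun (p * q) x = polyFun p x * polyFun q x := by simp [polyFun]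

theorem polyFun_sum {ι : Type*} (s : Finset ι) (p : ι → MvPolynomial (Fin d) ℝ) (x : Pt d) :
    polyFun (∑ i ∈ s, p i) x = ∑ i ∈ s, polyFun (p i) x := by simp [polyFun]

@[simp] theorem polyFun_zero (x : Pt d) : polyFun (0 : MvPolynomial (Fin d) ℝ) x = 0 := by
  simp [polyFun]

@[simp] theorem polyFun_C (c : ℝ) (x : Pt d) : polyFun (MvPolynomial.C c) x = c := by
  simp [polyFun]

@[simp] theorem polyFun_X (i : Fin d) (x : Pt d) : polyFun (MvPolynomial.X i) x = x i := by
  simp [polyFun]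

theorem polyFun_smul (c : ℝ) (p : MvPolynomial (Fin d) ℝ) (x : Pt d) :
    polyFun (c • p) x = c * polyFun p x := by simp [polyFun, MvPolynomial.smul_eval]

theorem hasFDerivAt_polyFun (p : MvPolynomial (Fin d) ℝ) (x : Pt d) :
    HasFDerivAt (polyFun p)
      (∑ i, polyFun (MvPolynomial.pderiv i p) x • (EuclideanSpace.proj i : Pt d →L[ℝ] ℝ)) x := by
  induction p using MvPolynomial.induction_on with
  | C a =>
    have : polyFun (MvPolynomial.C a : MvPolynomial (Fin d) ℝ) = fun _ => a :=
      funext fun x => polyFun_C a x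
    rw [this]
    simpa using hasFDerivAt_const a x
  | add p q hp hq =>
    have : polyFun (p + q) = fun x => polyFun p x + polyFun q x := funext (polyFun_add p q)
    rw [this]
    refine (hp.add hq).congr_fderiv ?_
    simp [polyFun_add, add_smul, Finset.sum_add_distrib]
  | mul_X p i hp =>
    have h1 : polyFun (p * MvPolynomial.X i) = fun x => polyFun p x * x i :=
      funext fun x => by simp [polyFun_mul]
    rw [h1]
    have h2 : HasFDerivAt (fun x : Pt d => x i) (EuclideanSpace.proj i : Pt d →L[ℝ] ℝ) x :=
      (EuclideanSpace.proj i : Pt d →L[ℝ] ℝ).hasFDerivAt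
    refine (hp.mul h2).congr_fderiv ?_
    ext v
    simp [MvPolynomial.pderiv_X, Pi.single_apply, apply_ite, polyFun, Finset.mul_sum, mul_comm]
    simp only [mul_add, Finset.sum_add_distrib]
    simp [mul_left_comm]

theorem partialDeriv_polyFun (p : MvPolynomial (Fin d) ℝ) (j : Fin d) :
    partialDeriv j (polyFun p) = polyFun (MvPolynomial.pderiv j p) := by
  funext x
  simp [partialDeriv, (hasFDerivAt_polyFun p x).fderiv]

theorem contDiff_polyFun (p : MvPolynomial (Fin d) ℝ) : ContDiff ℝ ∞ (polyFun p) := by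
  induction p using MvPolynomial.induction_on with
  | C a =>
    have : polyFun (MvPolynomial.C a : MvPolynomial (Fin d) ℝ) = fun _ => a :=
      funext fun x => polyFun_C a x
    rw [this]
    exact contDiff_const
  | add p q hp hq =>
    have : polyFun (p + q) = fun x => polyFun p x + polyFun q x := funext (polyFun_add p q)
    rw [this]
    exact hp.add hq
  | mul_X p i hp =>
    have h1 : polyFun (p * MvPolynomial.X i) = fun x => polyFun p x * x i :=
      funext fun x => by simp [polyFun_mul]
    rw [h1]
    exact hp.mul (EuclideanSpace.proj i : Pt d →L[ℝ] ℝ).contDiff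

theorem totalDegree_pderiv_le (p : MvPolynomial (Fin d) ℝ) (j : Fin d) :
    (MvPolynomial.pderiv j p).totalDegree ≤ p.totalDegree - 1 := by
  conv_lhs => rw [p.as_sum, map_sum]
  refine MvPolynomial.totalDegree_finsetSum_le fun s hs => ?_
  rw [MvPolynomial.pderiv_monomial]
  by_cases hsj : s j = 0
  · simp [hsj]
  · refine (MvPolynomial.totalDegree_monomial_le _ _).trans ?_
    have h1 := MvPolynomial.le_totalDegree hs
    have h2 : s = (s - Finsupp.single j 1) + Finsupp.single j 1 := by
      rw [tsub_add_cancel_of_le]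
      rw [Finsupp.single_le_iff]
      omega
    have h3 : (s.sum fun _ e => e) = ((s - Finsupp.single j 1).sum fun _ e => e) + 1 := by
      conv_lhs => rw [h2]
      rw [Finsupp.sum_add_index' (by simp) (by simp)]
      simp
    rw [h3] at h1
    change ((s - Finsupp.single j 1).sum fun _ e => e) ≤ _
    omega

theorem pderiv_eq_zero {p : MvPolynomial (Fin d) ℝ} (hp : p.totalDegree = 0) (j : Fin d) :
    MvPolynomial.pderiv j p = 0 := by
  rw [MvPolynomial.totalDegree_eq_zero_iff_eq_C] at hp
  rw [hp, MvPolynomial.pderiv_C]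

theorem multiDeriv_polyFun (p : MvPolynomial (Fin d) ℝ) (β : Fin d → ℕ) :
    ∃ q : MvPolynomial (Fin d) ℝ, multiDeriv β (polyFun p) = polyFun q ∧
      q.totalDegree ≤ p.totalDegree - ∑ i, β i ∧ (p.totalDegree < ∑ i, β i → q = 0) := by
  refine multiIndex_induction (P := fun β => ∃ q : MvPolynomial (Fin d) ℝ,
    multiDeriv β (polyFun p) = polyFun q ∧
      q.totalDegree ≤ p.totalDegree - ∑ i, β i ∧ (p.totalDegree < ∑ i, β i → q = 0)) ?_ ?_ β
  · exact ⟨p, multiDeriv_zero _, by simp, by simp⟩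
  · rintro β j ⟨q, hq, hdeg, hz⟩
    refine ⟨MvPolynomial.pderiv j q, ?_, ?_, fun h => ?_⟩
    · rw [multiDeriv_add_single β j (contDiff_polyFun p), hq, partialDeriv_polyFun]
    · rw [sum_add_single]
      have := totalDegree_pderiv_le q j
      omega
    · rw [sum_add_single] at h
      exact pderiv_eq_zero (by omega) j

theorem multiDeriv_polyFun_eq_zero {p : MvPolynomial (Fin d) ℝ} {β : Fin d → ℕ}
    (h : p.totalDegree < ∑ i, β i) : multiDeriv β (polyFun p) = fun _ => 0 := by
  obtain ⟨q, hq, -, hz⟩ := multiDeriv_polyFun p β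
  rw [hq, hz h]
  funext x
  simp

/-- The normalized monomial `x^γ / γ!`. -/
def normMonomial (γ : Fin d → ℕ) : MvPolynomial (Fin d) ℝ :=
  MvPolynomial.monomial (Finsupp.equivFunOnFinite.symm γ) (∏ i, ((γ i).factorial : ℝ))⁻¹

theorem totalDegree_normMonomial_le (γ : Fin d → ℕ) :
    (normMonomial γ).totalDegree ≤ ∑ i, γ i := by
  refine (MvPolynomial.totalDegree_monomial_le _ _).trans_eq ?_
  rw [Finsupp.sum_fintype _ _ (by simp)]
  rfl

theorem pderiv_normMonomial_add (γ : Fin d → ℕ) (j : Fin d) :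
    MvPolynomial.pderiv j (normMonomial (γ + Pi.single j 1)) = normMonomial γ := by
  rw [normMonomial, MvPolynomial.pderiv_monomial, normMonomial]
  have e : (Finsupp.equivFunOnFinite.symm (γ + Pi.single j 1) - Finsupp.single j 1 : Fin d →₀ ℕ) =
      Finsupp.equivFunOnFinite.symm γ := by
    ext i
    rcases eq_or_ne i j with rfl | hij
    · simp
    · simp [hij]
  rw [e]
  congr 1
  · have h : ∏ i, (((γ + Pi.single j 1 : Fin d → ℕ) i).factorial : ℝ) = (γ j + 1) * ∏ i, ((γ i).factorial : ℝ) := by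
      rw [← Finset.mul_prod_erase _ _ (Finset.mem_univ j),
        ← Finset.mul_prod_erase _ (fun i => ((γ i).factorial : ℝ)) (Finset.mem_univ j), ← mul_assoc]
      congr 1
      · simp [Nat.factorial_succ]
      · refine Finset.prod_congr rfl fun i hi => ?_
        simp [Finset.ne_of_mem_erase hi]
    rw [h]
    simp only [Finsupp.equivFunOnFinite_symm_apply_apply, Pi.add_apply, Pi.single_eq_same,
      Nat.cast_add, Nat.cast_one]
    rw [mul_inv, mul_comm, ← mul_assoc, mul_inv_cancel₀ (by positivity), one_mul]

theorem pderiv_normMonomial_of_eq_zero {γ : Fin d → ℕ} {j : Fin d} (h : γ j = 0) :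
    MvPolynomial.pderiv j (normMonomial γ) = 0 := by
  rw [normMonomial, MvPolynomial.pderiv_monomial]
  simp [h]

theorem multiDeriv_normMonomial (β γ : Fin d → ℕ) (h : ∑ i, β i = ∑ i, γ i) (x : Pt d) :
    multiDeriv β (polyFun (normMonomial γ)) x = if β = γ then 1 else 0 := by
  have key : ∀ β γ : Fin d → ℕ,
      multiDeriv β (polyFun (normMonomial (β + γ))) = polyFun (normMonomial γ) := by
    intro β
    refine multiIndex_induction (P := fun β => ∀ γ : Fin d → ℕ,
      multiDeriv β (polyFun (normMonomial (β + γ))) = polyFun (normMonomial γ)) ?_ ?_ β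
    · intro γ; rw [multiDeriv_zero, zero_add]
    · intro β j ih γ
      rw [multiDeriv_add_single β j (contDiff_polyFun _), add_assoc, ih, partialDeriv_polyFun,
        add_comm (Pi.single j 1), pderiv_normMonomial_add]
  have key2 : ∀ β γ : Fin d → ℕ, ¬ β ≤ γ →
      multiDeriv β (polyFun (normMonomial γ)) = fun _ => 0 := by
    intro β
    refine multiIndex_induction (P := fun β => ∀ γ : Fin d → ℕ, ¬ β ≤ γ →
      multiDeriv β (polyFun (normMonomial γ)) = fun _ => 0) ?_ ?_ β
    · intro γ hγ; exact absurd (fun i => Nat.zero_le _) hγ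
    · intro β j ih γ hγ
      rw [multiDeriv_add_single β j (contDiff_polyFun _)]
      by_cases hβ : β ≤ γ
      · have hj : (γ - β) j = 0 := by
          by_contra hne
          refine hγ fun i => ?_
          have : β i ≤ γ i := hβ i
          rcases eq_or_ne i j with rfl | hij
          · simp only [Pi.sub_apply] at hne
            simp only [Pi.add_apply, Pi.single_eq_same]; omega
          · simpa [hij] using this
        have he : γ = β + (γ - β) := by
          funext i; have : β i ≤ γ i := hβ i; simp only [Pi.add_apply, Pi.sub_apply]; omega
        rw [he, key, partialDeriv_polyFun, pderiv_normMonomial_of_eq_zero hj]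
        funext x; simp
      · rw [ih γ hβ]
        funext x
        simp [partialDeriv]
  by_cases hβ : β = γ
  · subst hβ
    have := key β 0
    rw [add_zero] at this
    rw [this]
    have h0 : (Finsupp.equivFunOnFinite.symm 0 : Fin d →₀ ℕ) = 0 := by ext; rfl
    simp [normMonomial, polyFun, h0]
  · rw [if_neg hβ, key2]
    intro hle
    refine hβ (funext fun i => ?_)
    by_contra hne
    have : ∑ i, β i < ∑ i, γ i :=
      Finset.sum_lt_sum (fun i _ => hle i) ⟨i, Finset.mem_univ i, lt_of_le_of_ne (hle i) hne⟩
    omega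

end

end HDG

end

noncomputable section

namespace HDG

/-! ### Polynomial approximation of smooth functions -/

section

variable {n d : ℕ}

/-- `∑_{|α| = m} ‖∂^α φ‖_{L²(τ)}`. -/
def derivSum (τ : Measure (Pt d)) (m : ℕ) (φ : Pt d → ℝ) : ℝ :=
  ∑ α ∈ Finset.piAntidiag (Finset.univ : Finset (Fin d)) m, l2Norm τ (multiDeriv α φ)

theorem mem_multiIndices {α : Fin d → ℕ} {m : ℕ} :
    α ∈ Finset.piAntidiag (Finset.univ : Finset (Fin d)) m ↔ ∑ i, α i = m := by
  simp [Finset.mem_piAntidiag]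

theorem derivSum_nonneg (τ : Measure (Pt d)) (m : ℕ) (φ : Pt d → ℝ) : 0 ≤ derivSum τ m φ :=
  Finset.sum_nonneg fun _ _ => l2Norm_nonneg _ _

theorem l2Norm_multiDeriv_le_derivSum (τ : Measure (Pt d)) {m : ℕ} {α : Fin d → ℕ}
    (h : ∑ i, α i = m) (φ : Pt d → ℝ) : l2Norm τ (multiDeriv α φ) ≤ derivSum τ m φ :=
  Finset.single_le_sum (f := fun α => l2Norm τ (multiDeriv α φ)) (fun _ _ => l2Norm_nonneg _ _)
    (mem_multiIndices.2 h)

theorem sum_partialDeriv_le_derivSum (τ : Measure (Pt d)) {m : ℕ} {α : Fin d → ℕ}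
    (h : ∑ i, α i = m) {φ : Pt d → ℝ} (hφ : ContDiff ℝ ∞ φ) :
    ∑ j, l2Norm τ (partialDeriv j (multiDeriv α φ)) ≤ d * derivSum τ (m + 1) φ := by
  calc ∑ j, l2Norm τ (partialDeriv j (multiDeriv α φ))
      ≤ ∑ _j : Fin d, derivSum τ (m + 1) φ := Finset.sum_le_sum fun j _ => by
        rw [← multiDeriv_add_single α j hφ]
        exact l2Norm_multiDeriv_le_derivSum τ (by rw [sum_add_single, h]) φ
    _ = d * derivSum τ (m + 1) φ := by simp

/-- A polynomial of degree at most `m` with prescribed derivatives of order `m`. -/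
theorem exists_polynomial_multiDeriv_eq (m : ℕ) (c : (Fin d → ℕ) → ℝ) :
    ∃ p : MvPolynomial (Fin d) ℝ, p.totalDegree ≤ m ∧
      ∀ β : Fin d → ℕ, ∑ i, β i = m → ∀ x, multiDeriv β (polyFun p) x = c β := by
  classical
  have key : ∀ (s : Finset (Fin d → ℕ)), (∀ γ ∈ s, ∑ i, γ i = m) →
      ∃ p : MvPolynomial (Fin d) ℝ, p.totalDegree ≤ m ∧ ∀ β : Fin d → ℕ, ∑ i, β i = m →
        ∀ x, multiDeriv β (polyFun p) x = if β ∈ s then c β else 0 := by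
    intro s
    induction s using Finset.induction_on with
    | empty =>
      intro _
      refine ⟨0, by simp, fun β _ x => ?_⟩
      have h0 : polyFun (0 : MvPolynomial (Fin d) ℝ) = fun x => (fun _ => (0 : ℝ)) x -
          (fun _ => (0 : ℝ)) x := by funext x; simp
      rw [h0, multiDeriv_sub β contDiff_const contDiff_const]
      simp
    | insert γ s hγ ih =>
      intro hs
      obtain ⟨p, hp, hpβ⟩ := ih fun γ' h' => hs γ' (by simp [h'])
      have hγm := hs γ (by simp)
      refine ⟨p - (-c γ) • normMonomial γ, ?_, fun β hβ x => ?_⟩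
      · refine (MvPolynomial.totalDegree_sub _ _).trans (max_le hp ?_)
        exact (MvPolynomial.totalDegree_smul_le _ _).trans
          ((totalDegree_normMonomial_le γ).trans hγm.le)
      · have h1 : polyFun (p - (-c γ) • normMonomial γ) = fun x => polyFun p x -
            polyFun ((-c γ) • normMonomial γ) x := funext fun x => polyFun_sub _ _ x
        have h2 : ∀ β, multiDeriv β (polyFun ((-c γ) • normMonomial γ)) =
            fun x => (-c γ) * multiDeriv β (polyFun (normMonomial γ)) x := by
          intro β
          refine multiIndex_induction (P := fun β =>
            multiDeriv β (polyFun ((-c γ) • normMonomial γ)) =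
            fun x => (-c γ) * multiDeriv β (polyFun (normMonomial γ)) x) ?_ ?_ β
          · rw [multiDeriv_zero, multiDeriv_zero]
            exact funext fun x => polyFun_smul _ _ x
          · intro β j ih
            rw [multiDeriv_add_single β j (contDiff_polyFun _), ih,
              multiDeriv_add_single β j (contDiff_polyFun _)]
            funext x
            simp only [partialDeriv]
            rw [fderiv_const_mul
              ((contDiff_multiDeriv β (contDiff_polyFun _)).differentiable (by simp) x)]
            simp
        rw [h1, multiDeriv_sub β (contDiff_polyFun _) (contDiff_polyFun _), h2]
        simp only [hpβ β hβ, multiDeriv_normMonomial β γ (hβ.trans hγm.symm)]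
        by_cases hβγ : β = γ
        · subst hβγ; simp [hγ]
        · simp [hβγ]
  obtain ⟨p, hp, hpβ⟩ := key (Finset.piAntidiag Finset.univ m) fun γ hγ => mem_multiIndices.1 hγ
  exact ⟨p, hp, fun β hβ x => by rw [hpβ β hβ, if_pos (mem_multiIndices.2 hβ)]⟩

theorem bramble_hilbert_smooth (n d m : ℕ) : ∃ C : ℝ, 0 ≤ C ∧ ∀ (a : Fin (n + 1) → Pt d)
    (φ : Pt d → ℝ), ContDiff ℝ ∞ φ → ∃ p : MvPolynomial (Fin d) ℝ, p.totalDegree ≤ m ∧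
      ∀ β : Fin d → ℕ, ∑ i, β i ≤ m + 1 →
        Metric.diam (convexHull ℝ (Set.range a)) ^ (∑ i, β i) *
          l2Norm (simplexMeasure a) (multiDeriv β (fun x => φ x - polyFun p x)) ≤
        C * (Metric.diam (convexHull ℝ (Set.range a)) ^ (m + 1) *
          derivSum (simplexMeasure a) (m + 1) φ) := by
  have hP0 : 0 ≤ poincareConst n := Real.sqrt_nonneg _
  induction m with
  | zero =>
    refine ⟨poincareConst n * d + 1, by positivity, fun a φ hφ => ?_⟩
    set h := Metric.diam (convexHull ℝ (Set.range a)) with hh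
    set τ := simplexMeasure a with hτ
    have hh0 : 0 ≤ h := Metric.diam_nonneg
    have hS := derivSum_nonneg τ (0 + 1) φ
    refine ⟨MvPolynomial.C (∫ y, φ y ∂τ), by simp, fun β hβ => ?_⟩
    rcases Nat.le_one_iff_eq_zero_or_eq_one.1 (by simpa using hβ) with h0 | h1
    · have hβ0 : β = 0 := funext fun i => (Finset.sum_eq_zero_iff.1 h0) i (Finset.mem_univ i)
      subst hβ0
      have h2 := sum_partialDeriv_le_derivSum τ h0 hφ
      rw [multiDeriv_zero] at h2
      have h3 := l2Norm_sub_mean_le a hφ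
      simp only [multiDeriv_zero, polyFun_C, Pi.zero_apply, Finset.sum_const_zero, pow_zero,
        one_mul]
      refine h3.trans ?_
      calc poincareConst n * (h * ∑ j, l2Norm τ (partialDeriv j φ))
          ≤ poincareConst n * (h * (d * derivSum τ (0 + 1) φ)) := by gcongr
        _ ≤ (poincareConst n * d + 1) * (h ^ (0 + 1) * derivSum τ (0 + 1) φ) := by
          have : 0 ≤ h * derivSum τ (0 + 1) φ := mul_nonneg hh0 hS
          rw [zero_add, pow_one] at *
          nlinarith
    · rw [h1, multiDeriv_sub β hφ (contDiff_polyFun _),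
        multiDeriv_polyFun_eq_zero (by rw [h1]; simp), pow_one]
      simp only [sub_zero]
      have h2 := l2Norm_multiDeriv_le_derivSum τ h1 φ
      calc h * l2Norm τ (multiDeriv β φ) ≤ h * derivSum τ 1 φ := by gcongr
        _ ≤ _ := by
          rw [zero_add] at *
          have h4 : 0 ≤ h * derivSum τ 1 φ := mul_nonneg hh0 hS
          have h5 : 0 ≤ poincareConst n * d := by positivity
          nlinarith
  | succ m ih =>
    obtain ⟨C, hC, hBH⟩ := ih
    set N : ℝ := ((Finset.piAntidiag (Finset.univ : Finset (Fin d)) (m + 1)).card : ℝ) with hN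
    have hN0 : 0 ≤ N := by positivity
    refine ⟨C * (N * (poincareConst n * d)) + 1, by positivity, fun a φ hφ => ?_⟩
    set h := Metric.diam (convexHull ℝ (Set.range a)) with hh
    set τ := simplexMeasure a with hτ
    have hh0 : 0 ≤ h := Metric.diam_nonneg
    have hS := derivSum_nonneg τ (m + 1 + 1) φ
    obtain ⟨pt, hpt, hptβ⟩ := exists_polynomial_multiDeriv_eq (m + 1)
      (fun β => ∫ y, multiDeriv β φ y ∂τ)
    have hψ : ContDiff ℝ ∞ (fun x => φ x - polyFun pt x) := hφ.sub (contDiff_polyFun _)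
    obtain ⟨p, hp, hpβ⟩ := hBH a _ hψ
    have e : (fun x => φ x - polyFun (pt + p) x) =
        fun x => (φ x - polyFun pt x) - polyFun p x := by
      funext x; rw [polyFun_add]; ring
    have hdeg : (pt + p).totalDegree ≤ m + 1 :=
      (MvPolynomial.totalDegree_add _ _).trans (max_le hpt (by omega))
    refine ⟨pt + p, hdeg, fun β hβ => ?_⟩
    have hX : 0 ≤ h ^ (m + 1 + 1) * derivSum τ (m + 1 + 1) φ := by positivity
    rcases Nat.lt_or_ge (∑ i, β i) (m + 2) with hlt | hge
    · have h1 : derivSum τ (m + 1) (fun x => φ x - polyFun pt x) ≤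
          N * (poincareConst n * (h * (d * derivSum τ (m + 1 + 1) φ))) := by
        rw [hN, ← nsmul_eq_mul]
        refine Finset.sum_le_card_nsmul _ _ _ fun α hα => ?_
        rw [mem_multiIndices] at hα
        rw [multiDeriv_sub α hφ (contDiff_polyFun _)]
        simp only [hptβ α hα]
        refine (l2Norm_sub_mean_le a (contDiff_multiDeriv α hφ)).trans ?_
        have := sum_partialDeriv_le_derivSum τ hα hφ
        gcongr
      rw [e]
      refine (hpβ β (by omega)).trans ?_
      calc C * (h ^ (m + 1) * derivSum τ (m + 1) (fun x => φ x - polyFun pt x))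
          ≤ C * (h ^ (m + 1) * (N * (poincareConst n * (h * (d * derivSum τ (m + 1 + 1) φ))))) := by
            gcongr
        _ = C * (N * (poincareConst n * d)) * (h ^ (m + 1 + 1) * derivSum τ (m + 1 + 1) φ) := by
            ring
        _ ≤ _ := by rw [add_mul]; linarith
    · have hβe : ∑ i, β i = m + 1 + 1 := le_antisymm hβ hge
      rw [multiDeriv_sub β hφ (contDiff_polyFun _),
        multiDeriv_polyFun_eq_zero (by rw [hβe]; omega), hβe]
      simp only [sub_zero]
      have h2 := l2Norm_multiDeriv_le_derivSum τ hβe φ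
      calc h ^ (m + 1 + 1) * l2Norm τ (multiDeriv β φ)
          ≤ h ^ (m + 1 + 1) * derivSum τ (m + 1 + 1) φ := by gcongr
        _ ≤ _ := by
          rw [add_mul]
          have : 0 ≤ C * (N * (poincareConst n * d)) *
            (h ^ (m + 1 + 1) * derivSum τ (m + 1 + 1) φ) := by positivity
          linarith

end

end HDG

end

noncomputable section

namespace HDG

/-! ### Weak derivatives -/

section

variable {d : ℕ} {Ω U : Set (Pt d)} {α : Fin d → ℕ} {f f' g g' φ : Pt d → ℝ}

theorem IsTestFunction.partialDeriv (hφ : IsTestFunction Ω φ) (j : Fin d) :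
    IsTestFunction Ω (partialDeriv j φ) := by
  have h : tsupport (HDG.partialDeriv j φ) ⊆ tsupport φ := tsupport_fderiv_apply_subset ℝ _
  exact ⟨contDiff_partialDeriv hφ.1 j, hφ.2.1.of_isClosed_subset isClosed_closure h,
    h.trans hφ.2.2⟩

theorem IsTestFunction.multiDeriv (hφ : IsTestFunction Ω φ) (α : Fin d → ℕ) :
    IsTestFunction Ω (multiDeriv α φ) := by
  refine multiIndex_induction (P := fun α => IsTestFunction Ω (HDG.multiDeriv α φ)) ?_
    (fun α j ih => ?_) α
  · rwa [multiDeriv_zero]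
  · rw [multiDeriv_add_single α j hφ.1]
    exact ih.partialDeriv j

theorem IsTestFunction.mono (hφ : IsTestFunction U φ) (h : U ⊆ Ω) : IsTestFunction Ω φ :=
  ⟨hφ.1, hφ.2.1, hφ.2.2.trans h⟩

theorem IsTestFunction.eq_zero (hφ : IsTestFunction U φ) {x : Pt d} (hx : x ∉ U) : φ x = 0 :=
  image_eq_zero_of_notMem_tsupport fun h => hx (hφ.2.2 h)

theorem IsTestFunction.setIntegral_eq (hφ : IsTestFunction U φ) (f : Pt d → ℝ) :
    ∫ x in U, f x * φ x = ∫ x, f x * φ x :=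
  setIntegral_eq_integral_of_forall_compl_eq_zero fun x hx => by rw [hφ.eq_zero hx, mul_zero]

theorem IsTestFunction.integrable_mul (hφ : IsTestFunction U φ) (hf : LocallyIntegrableOn f U) :
    Integrable (fun x => f x * φ x) (volume : Measure (Pt d)) := by
  have h1 : IntegrableOn f (tsupport φ) := hf.integrableOn_compact_subset hφ.2.2 hφ.2.1
  have h2 : IntegrableOn (fun x => f x * φ x) (tsupport φ) := by
    obtain ⟨C, hC⟩ := hφ.2.1.exists_bound_of_continuous hφ.1.continuous
    exact h1.mul_bdd hφ.1.continuous.aestronglyMeasurable (ae_of_all _ hC)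
  rw [integrableOn_iff_integrable_of_support_subset] at h2
  · exact h2
  · intro x hx
    refine subset_tsupport φ ?_
    rw [Function.mem_support] at hx ⊢
    exact right_ne_zero_of_mul hx

theorem HasWeakDeriv.ae_eq (hΩ : IsOpen Ω) (h : HasWeakDeriv Ω α f g)
    (h' : HasWeakDeriv Ω α f g') : g =ᵐ[volume.restrict Ω] g' := by
  have key := hΩ.ae_eq_zero_of_integral_contDiff_smul_eq_zero (μ := volume)
    (f := fun x => g x - g' x) (h.2.1.sub h'.2.1) fun φ h1 h2 h3 => by
      have hφ : IsTestFunction Ω φ := ⟨h1, h2, h3⟩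
      have e := (h.2.2 φ hφ).symm.trans (h'.2.2 φ hφ)
      have e2 := mul_left_cancel₀ (pow_ne_zero _ (by norm_num : (-1 : ℝ) ≠ 0)) e
      rw [hφ.setIntegral_eq, hφ.setIntegral_eq] at e2
      have : ∀ x, φ x • (g x - g' x) = g x * φ x - g' x * φ x := fun x => by
        simp only [smul_eq_mul]; ring
      simp only [this]
      rw [integral_sub (hφ.integrable_mul h.2.1) (hφ.integrable_mul h'.2.1), e2, sub_self]
  rw [EventuallyEq, ae_restrict_iff' hΩ.measurableSet]
  filter_upwards [key] with x hx hxΩ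
  exact sub_eq_zero.1 (hx hxΩ)

theorem HasWeakDeriv.mono (h : HasWeakDeriv Ω α f g) (hU : U ⊆ Ω) : HasWeakDeriv U α f g := by
  refine ⟨h.1.mono_set hU, h.2.1.mono_set hU, fun φ hφ => ?_⟩
  have h1 := h.2.2 φ (hφ.mono hU)
  rwa [((hφ.mono hU).multiDeriv α).setIntegral_eq, (hφ.mono hU).setIntegral_eq,
    ← (hφ.multiDeriv α).setIntegral_eq, ← hφ.setIntegral_eq] at h1

theorem HasWeakDeriv.weakDeriv (h : HasWeakDeriv Ω α f g) :
    HasWeakDeriv Ω α f (weakDeriv Ω α f) := by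
  have h' : ∃ g, HasWeakDeriv Ω α f g := ⟨g, h⟩
  rw [HDG.weakDeriv, dif_pos h']
  exact h'.choose_spec

theorem HasWeakDeriv.weakDeriv_ae_eq (hΩ : IsOpen Ω) (h : HasWeakDeriv Ω α f g) :
    HDG.weakDeriv Ω α f =ᵐ[volume.restrict Ω] g :=
  h.weakDeriv.ae_eq hΩ h

theorem LocallyIntegrableOn.congr_ae_restrict (hΩ : MeasurableSet Ω) (h : LocallyIntegrableOn f Ω)
    (hf : f =ᵐ[volume.restrict Ω] f') : LocallyIntegrableOn f' Ω := by
  intro x hx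
  obtain ⟨t, ht, hft⟩ := h x hx
  refine ⟨t ∩ Ω, inter_mem ht self_mem_nhdsWithin, ?_⟩
  exact (hft.mono_set Set.inter_subset_left).congr_fun_ae
    (ae_restrict_of_ae_restrict_of_subset Set.inter_subset_right hf)

theorem HasWeakDeriv.congr (hΩ : MeasurableSet Ω) (h : HasWeakDeriv Ω α f g)
    (hf : f =ᵐ[volume.restrict Ω] f') (hg : g =ᵐ[volume.restrict Ω] g') :
    HasWeakDeriv Ω α f' g' := by
  refine ⟨LocallyIntegrableOn.congr_ae_restrict hΩ h.1 hf,
    LocallyIntegrableOn.congr_ae_restrict hΩ h.2.1 hg, fun φ hφ => ?_⟩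
  have h1 : ∫ x in Ω, f' x * HDG.multiDeriv α φ x = ∫ x in Ω, f x * HDG.multiDeriv α φ x :=
    integral_congr_ae (hf.mono fun x hx => by simp only [hx])
  have h2 : ∫ x in Ω, g' x * φ x = ∫ x in Ω, g x * φ x :=
    integral_congr_ae (hg.mono fun x hx => by simp only [hx])
  rw [h1, h2, h.2.2 φ hφ]

theorem HasWeakDeriv.sub (h : HasWeakDeriv Ω α f g) (h' : HasWeakDeriv Ω α f' g') :
    HasWeakDeriv Ω α (fun x => f x - f' x) (fun x => g x - g' x) := by
  refine ⟨h.1.sub h'.1, h.2.1.sub h'.2.1, fun φ hφ => ?_⟩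
  have hm := hφ.multiDeriv α
  have e1 := h.2.2 φ hφ
  have e2 := h'.2.2 φ hφ
  rw [hm.setIntegral_eq, hφ.setIntegral_eq] at e1 e2 ⊢
  simp only [sub_mul]
  rw [integral_sub (hm.integrable_mul h.1) (hm.integrable_mul h'.1),
    integral_sub (hφ.integrable_mul h.2.1) (hφ.integrable_mul h'.2.1), e1, e2, mul_sub]

theorem hasWeakDeriv_of_contDiff (j : Fin d) (hf : ContDiff ℝ ∞ f) :
    HasWeakDeriv Ω (Pi.single j 1) f (partialDeriv j f) := by
  refine ⟨hf.continuous.locallyIntegrable.locallyIntegrableOn _,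
    (continuous_partialDeriv hf j).locallyIntegrable.locallyIntegrableOn _, fun φ hφ => ?_⟩
  have hp := hφ.partialDeriv j
  have hl : LocallyIntegrableOn f Ω := hf.continuous.locallyIntegrable.locallyIntegrableOn _
  have hl' : LocallyIntegrableOn (HDG.partialDeriv j f) Ω :=
    (continuous_partialDeriv hf j).locallyIntegrable.locallyIntegrableOn _
  rw [multiDeriv_single j hφ.1, hp.setIntegral_eq, hφ.setIntegral_eq]
  simp only [Finset.sum_pi_single', Finset.mem_univ, if_true, pow_one, neg_mul, one_mul]
  exact integral_mul_fderiv_eq_neg_fderiv_mul_of_integrable (hφ.integrable_mul hl')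
    (hp.integrable_mul hl) (hφ.integrable_mul hl)
    (fun x _ => hf.differentiable (by simp) x) (fun x _ => hφ.1.differentiable (by simp) x)

theorem LocallyIntegrableOn.const_mul' (c : ℝ) (hf : LocallyIntegrableOn f Ω) :
    LocallyIntegrableOn (fun x => c * f x) Ω := fun x hx => by
  obtain ⟨t, ht, hft⟩ := hf x hx
  exact ⟨t, ht, Integrable.const_mul hft c⟩

/-- Derivatives of the gradient are derivatives of the function. -/
theorem HasWeakDeriv.of_gradient {L : Pt d → ℝ} {c : ℝ} (hc : c ≠ 0) {j : Fin d}
    (hL : HasWeakDeriv Ω (Pi.single j 1) f (fun x => c⁻¹ * L x))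
    (hg : HasWeakDeriv Ω (α + Pi.single j 1) f g) :
    HasWeakDeriv Ω α L (fun x => c * g x) := by
  have e : L = fun x => c * (c⁻¹ * L x) := by funext x; field_simp
  refine ⟨?_, LocallyIntegrableOn.const_mul' c hg.2.1, fun φ hφ => ?_⟩
  · rw [e]; exact LocallyIntegrableOn.const_mul' c hL.2.1
  · have h1 := hL.2.2 _ (hφ.multiDeriv α)
    have h2 := hg.2.2 φ hφ
    rw [multiDeriv_single j (hφ.multiDeriv α).1] at h1
    rw [multiDeriv_add_single α j hφ.1, h1, sum_add_single] at h2
    simp only [Finset.sum_pi_single', Finset.mem_univ, if_true, pow_one, mul_assoc,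
      integral_const_mul, pow_succ] at h2 ⊢
    have h3 : c⁻¹ * ∫ x in Ω, L x * HDG.multiDeriv α φ x =
        (-1) ^ (∑ i, α i) * ∫ x in Ω, g x * φ x := by linarith
    calc ∫ x in Ω, L x * HDG.multiDeriv α φ x
        = c * (c⁻¹ * ∫ x in Ω, L x * HDG.multiDeriv α φ x) := by field_simp
      _ = _ := by rw [h3]; ring

end

end HDG

end

noncomputable section

namespace HDG

/-! ### Mollification -/

section

variable {d : ℕ}

/-- The convolution `G ⋆ ρ`. -/
def mollify (ρ G : Pt d → ℝ) (z : Pt d) : ℝ := ∫ t, G t * ρ (z - t)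

theorem mollify_eq_convolution (ρ G : Pt d → ℝ) :
    mollify ρ G = convolution G ρ (ContinuousLinearMap.lsmul ℝ ℝ) volume := by
  funext z
  simp [mollify, convolution]

theorem contDiff_mollify {ρ G : Pt d → ℝ} (hρ : ContDiff ℝ ∞ ρ) (hc : HasCompactSupport ρ)
    (hG : LocallyIntegrable G) : ContDiff ℝ ∞ (mollify ρ G) := by
  rw [mollify_eq_convolution]
  exact hc.contDiff_convolution_right (n := ⊤) _ hG hρ

theorem partialDeriv_mollify {ρ G : Pt d → ℝ} (hρ : ContDiff ℝ ∞ ρ) (hc : HasCompactSupport ρ)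
    (hG : LocallyIntegrable G) (j : Fin d) :
    partialDeriv j (mollify ρ G) = mollify (partialDeriv j ρ) G := by
  funext z
  rw [mollify_eq_convolution, mollify_eq_convolution, partialDeriv,
    (hc.hasFDerivAt_convolution_right (ContinuousLinearMap.lsmul ℝ ℝ) hG
      (hρ.of_le (by simp)) z).fderiv]
  exact convolution_precompR_apply _ hG (hc.fderiv ℝ) (hρ.continuous_fderiv (by simp)) z _

theorem multiDeriv_mollify {ρ G : Pt d → ℝ} (hρ : IsTestFunction Set.univ ρ)
    (hG : LocallyIntegrable G) (α : Fin d → ℕ) :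
    multiDeriv α (mollify ρ G) = mollify (multiDeriv α ρ) G := by
  refine multiIndex_induction (P := fun α =>
    multiDeriv α (mollify ρ G) = mollify (multiDeriv α ρ) G) ?_ (fun α j ih => ?_) α
  · rw [multiDeriv_zero, multiDeriv_zero]
  · rw [multiDeriv_add_single α j (contDiff_mollify hρ.1 hρ.2.1 hG), ih,
      multiDeriv_add_single α j hρ.1,
      partialDeriv_mollify (hρ.multiDeriv α).1 (hρ.multiDeriv α).2.1 hG]

theorem multiDeriv_comp_affine {F : Pt d → ℝ} (hF : ContDiff ℝ ∞ F) (b : Pt d) (s : ℝ)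
    (α : Fin d → ℕ) :
    multiDeriv α (fun x => F (b + s • x)) =
      fun x => s ^ (∑ i, α i) * multiDeriv α F (b + s • x) := by
  have hsm : ContDiff ℝ ∞ fun x : Pt d => b + s • x := by fun_prop
  have hFc : ContDiff ℝ ∞ fun x : Pt d => F (b + s • x) := hF.comp hsm
  refine multiIndex_induction (P := fun α => multiDeriv α (fun x => F (b + s • x)) =
      fun x => s ^ (∑ i, α i) * multiDeriv α F (b + s • x)) ?_ (fun α j ih => ?_) α
  · simp [multiDeriv_zero]
  · rw [multiDeriv_add_single α j hFc, ih, multiDeriv_add_single α j hF]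
    funext x
    have h1 : HasFDerivAt (fun x : Pt d => b + s • x) (s • ContinuousLinearMap.id ℝ (Pt d)) x :=
      ((hasFDerivAt_id x).const_smul s).const_add b
    have h2 : HasFDerivAt (multiDeriv α F) (fderiv ℝ (multiDeriv α F) (b + s • x)) (b + s • x) :=
      ((contDiff_multiDeriv α hF).differentiable (by simp) _).hasFDerivAt
    have h3 := (h2.comp x h1).const_mul (s ^ (∑ i, α i))
    have h4 : partialDeriv j (fun x => s ^ (∑ i, α i) * multiDeriv α F (b + s • x)) x = _ :=
      congrArg (fun D => D (EuclideanSpace.single j 1)) h3.fderiv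
    rw [h4, sum_add_single, pow_succ]
    simp [partialDeriv]
    ring

/-- A mollified function can be differentiated by mollifying the weak derivative. -/
theorem mollify_multiDeriv_eq {U : Set (Pt d)} (hU : IsOpen U) {α : Fin d → ℕ}
    {w g ρ : Pt d → ℝ} (hw : HasWeakDeriv U α w g) (hρ : IsTestFunction Set.univ ρ) {z : Pt d}
    (hz : ∀ y, z - y ∈ tsupport ρ → y ∈ U) :
    mollify (multiDeriv α ρ) (U.indicator w) z = mollify ρ (U.indicator g) z := by
  have hsm : ContDiff ℝ ∞ fun y : Pt d => z + (-1 : ℝ) • y := by fun_prop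
  have hcont : Continuous fun y : Pt d => z + (-1 : ℝ) • y := hsm.continuous
  set η : Pt d → ℝ := fun y => ρ (z + (-1 : ℝ) • y) with hη
  have hsub : tsupport η ⊆ (fun y : Pt d => z + (-1 : ℝ) • y) ⁻¹' tsupport ρ := by
    refine closure_minimal (fun y hy => subset_tsupport ρ ?_) ((isClosed_tsupport ρ).preimage hcont)
    exact hy
  have htest : IsTestFunction U η := by
    refine ⟨hρ.1.comp hsm, ?_, fun y hy => hz y ?_⟩
    · have : Topology.IsClosedEmbedding fun y : Pt d => z + (-1 : ℝ) • y := by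
        have h1 : (fun y : Pt d => z + (-1 : ℝ) • y) = fun y => z - y := by
          funext y; simp [sub_eq_add_neg]
        rw [h1]
        exact (Homeomorph.subLeft z).isClosedEmbedding
      exact hρ.2.1.comp_isClosedEmbedding this
    · have := hsub hy
      simpa [sub_eq_add_neg] using this
  have key := hw.2.2 η htest
  have e1 : multiDeriv α η = fun x => (-1) ^ (∑ i, α i) * multiDeriv α ρ (z + (-1 : ℝ) • x) :=
    multiDeriv_comp_affine hρ.1 z (-1) α
  have e2 : ∀ (v σ : Pt d → ℝ), mollify σ (U.indicator v) z =
      ∫ x in U, v x * σ (z + (-1 : ℝ) • x) := by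
    intro v σ
    rw [← integral_indicator hU.measurableSet, mollify]
    refine integral_congr_ae (ae_of_all _ fun x => ?_)
    by_cases hx : x ∈ U
    · simp [hx, sub_eq_add_neg]
    · simp [hx]
  rw [e2, e2]
  rw [e1] at key
  have e3 : ∀ x, w x * ((-1) ^ (∑ i, α i) * multiDeriv α ρ (z + (-1 : ℝ) • x)) =
      (-1) ^ (∑ i, α i) * (w x * multiDeriv α ρ (z + (-1 : ℝ) • x)) := fun x => by ring
  simp only [e3, integral_const_mul] at key
  exact mul_left_cancel₀ (pow_ne_zero _ (by norm_num : (-1 : ℝ) ≠ 0)) key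

theorem integrable_mul_mollifier {ρ G : Pt d → ℝ} (hρ : Continuous ρ) (hc : HasCompactSupport ρ)
    (hG : LocallyIntegrable G) (z : Pt d) : Integrable fun t => G t * ρ (z - t) :=
  hc.convolutionExists_right (ContinuousLinearMap.lsmul ℝ ℝ) hG hρ z

theorem mollify_sub {ρ G H : Pt d → ℝ} (hρ : Continuous ρ) (hc : HasCompactSupport ρ)
    (hG : LocallyIntegrable G) (hH : LocallyIntegrable H) (z : Pt d) :
    mollify ρ (fun x => G x - H x) z = mollify ρ G z - mollify ρ H z := by
  unfold mollify
  rw [← integral_sub (integrable_mul_mollifier hρ hc hG z) (integrable_mul_mollifier hρ hc hH z)]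
  simp only [sub_mul]

theorem lintegral_comp_affine (b : Pt d) {s : ℝ} (hs : 0 < s) {f : Pt d → ℝ≥0∞}
    (hf : Measurable f) :
    ∫⁻ x, f (b + s • x) = ENNReal.ofReal ((s ^ d)⁻¹) * ∫⁻ x, f x := by
  have h := lintegral_comp_smul_pt hs (f := fun x => f (b + x)) (hf.comp (measurable_const_add b))
  rw [lintegral_add_left_eq_self] at h
  rw [h, ← mul_assoc, ← ENNReal.ofReal_mul (by positivity), inv_mul_cancel₀ (by positivity),
    ENNReal.ofReal_one, one_mul]

theorem lintegral_mollify_sq_le {ρ G : Pt d → ℝ} (hρ : Continuous ρ) (h0 : ∀ x, 0 ≤ ρ x)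
    (hi : Integrable ρ) (h1 : ∫ x, ρ x = 1) (hG : AEMeasurable G) (b : Pt d) {s : ℝ} (hs : 0 < s) :
    ∫⁻ x, ‖mollify ρ G (b + s • x)‖ₑ ^ 2 ≤
      ENNReal.ofReal ((s ^ d)⁻¹) * ∫⁻ x, ‖G x‖ₑ ^ 2 := by
  wlog hGm : Measurable G generalizing G
  · have h2 := this hG.measurable_mk.aemeasurable hG.measurable_mk
    have h3 : mollify ρ G = mollify ρ (hG.mk G) := by
      funext z
      refine integral_congr_ae (hG.ae_eq_mk.mono fun t ht => ?_)
      simp only [ht]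
    rw [h3]
    refine h2.trans_eq ?_
    congr 1
    exact lintegral_congr_ae (hG.ae_eq_mk.mono fun t ht => by simp only [ht])
  have hρm : Measurable fun y => ENNReal.ofReal (ρ y) := hρ.measurable.ennreal_ofReal
  set P : Measure (Pt d) := volume.withDensity fun y => ENNReal.ofReal (ρ y) with hP
  have hPp : IsProbabilityMeasure P := ⟨by
    rw [hP, withDensity_apply _ MeasurableSet.univ, Measure.restrict_univ,
      ← ofReal_integral_eq_lintegral_ofReal hi (ae_of_all _ h0), h1, ENNReal.ofReal_one]⟩
  have hpt : ∀ z, ‖mollify ρ G z‖ₑ ^ 2 ≤ ∫⁻ y, ‖G (z - y)‖ₑ ^ 2 ∂P := by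
    intro z
    have e1 : ‖mollify ρ G z‖ₑ ≤ ∫⁻ y, ‖G (z - y)‖ₑ ∂P := by
      refine (enorm_integral_le_lintegral_enorm _).trans_eq ?_
      have hGz : Measurable fun y => ‖G (z - y)‖ₑ := (hGm.comp (measurable_const_sub z)).enorm
      rw [hP, lintegral_withDensity_eq_lintegral_mul _ hρm hGz,
        ← lintegral_sub_left_eq_self _ z]
      refine lintegral_congr fun y => ?_
      simp only [Pi.mul_apply, sub_sub_cancel, enorm_mul]
      rw [mul_comm, Real.enorm_eq_ofReal (h0 _)]
    exact (pow_le_pow_left' e1 2).trans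
      (sq_lintegral_le (hGm.comp (measurable_const_sub z)).enorm.aemeasurable)
  have hm2 : Measurable fun p : Pt d × Pt d => ‖G (b + s • p.1 - p.2)‖ₑ ^ 2 :=
    ((hGm.comp (by fun_prop : Continuous fun p : Pt d × Pt d =>
      b + s • p.1 - p.2).measurable).enorm).pow_const 2
  calc ∫⁻ x, ‖mollify ρ G (b + s • x)‖ₑ ^ 2
      ≤ ∫⁻ x, ∫⁻ y, ‖G (b + s • x - y)‖ₑ ^ 2 ∂P := lintegral_mono fun x => hpt _
    _ = ∫⁻ y, ∫⁻ x, ‖G (b + s • x - y)‖ₑ ^ 2 ∂volume ∂P :=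
        lintegral_lintegral_swap hm2.aemeasurable
    _ = ∫⁻ _ : Pt d, (ENNReal.ofReal ((s ^ d)⁻¹) * ∫⁻ x, ‖G x‖ₑ ^ 2) ∂P := by
        refine lintegral_congr fun y => ?_
        rw [lintegral_comp_affine b hs (f := fun x => ‖G (x - y)‖ₑ ^ 2)
          ((hGm.comp (measurable_sub_const y)).enorm.pow_const 2)]
        rw [lintegral_sub_right_eq_self (fun x => ‖G x‖ₑ ^ 2) y]
    _ = _ := by simp

theorem eLpNorm_two_sq {α : Type*} [MeasurableSpace α] (f : α → ℝ) (μ : Measure α) :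
    eLpNorm f 2 μ ^ 2 = ∫⁻ x, ‖f x‖ₑ ^ 2 ∂μ := by
  have h := eLpNorm_nnreal_pow_eq_lintegral (f := f) (μ := μ) (p := 2) (by norm_num)
  simpa using h

theorem eLpNorm_mollify_le {ρ G : Pt d → ℝ} (hρ : Continuous ρ) (h0 : ∀ x, 0 ≤ ρ x)
    (hi : Integrable ρ) (h1 : ∫ x, ρ x = 1) (hG : AEMeasurable G) (b : Pt d) {s : ℝ}
    (hs : 1 / 2 ≤ s) (K : Set (Pt d)) :
    eLpNorm (fun x => mollify ρ G (b + s • x)) 2 (volume.restrict K) ≤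
      2 ^ d * eLpNorm G 2 volume := by
  have hs0 : 0 < s := by linarith
  refine (ENNReal.pow_le_pow_left_iff two_ne_zero).1 ?_
  rw [mul_pow, eLpNorm_two_sq, eLpNorm_two_sq]
  refine (setLIntegral_le_lintegral _ _).trans
    ((lintegral_mollify_sq_le hρ h0 hi h1 hG b hs0).trans ?_)
  gcongr
  have h2 : (s ^ d)⁻¹ ≤ (2 ^ d) ^ 2 := by
    rw [← inv_pow, ← pow_mul, mul_comm d 2, pow_mul]
    refine pow_le_pow_left₀ (by positivity) ?_ d
    rw [inv_le_comm₀ hs0 (by norm_num)]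
    linarith
  refine (ENNReal.ofReal_le_ofReal h2).trans_eq ?_
  rw [ENNReal.ofReal_pow (by positivity), ENNReal.ofReal_pow (by norm_num)]
  simp

end

end HDG

end

noncomputable section

namespace HDG

/-! ### Density of smooth functions on convex sets -/

section

variable {d : ℕ}

theorem tendsto_zero_of_le_mul_ofReal {f : ℕ → ℝ≥0∞} {M : ℝ≥0∞} (hM : M ≠ ⊤)
    (h : ∀ ε : ℝ, 0 < ε → ∀ᶠ n in atTop, f n ≤ M * ENNReal.ofReal ε) :
    Tendsto f atTop (𝓝 0) := by
  rw [ENNReal.tendsto_nhds_zero]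
  intro e he
  by_cases htop : e = ⊤
  · exact Eventually.of_forall fun n => htop ▸ le_top
  have hpos : 0 < e.toReal / (M.toReal + 1) :=
    div_pos (ENNReal.toReal_pos he.ne' htop) (by positivity)
  refine (h _ hpos).mono fun n hn => hn.trans ?_
  rw [← ENNReal.ofReal_toReal hM, ← ENNReal.ofReal_mul (by positivity)]
  refine (ENNReal.ofReal_le_ofReal ?_).trans_eq (ENNReal.ofReal_toReal htop)
  rw [ENNReal.toReal_ofReal (by positivity), ← mul_div_assoc, div_le_iff₀ (by positivity)]
  nlinarith [ENNReal.toReal_nonneg (a := e), ENNReal.toReal_nonneg (a := M)]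

theorem tendsto_eLpNorm_mollify_sub {G : Pt d → ℝ} (hG : MemLp G 2 volume) {K : Set (Pt d)}
    (hK : IsCompact K) (c : Pt d) {s : ℕ → ℝ} (hs : Tendsto s atTop (𝓝 1))
    (hs2 : ∀ n, 1 / 2 ≤ s n) (φ : ℕ → ContDiffBump (0 : Pt d))
    (hφ : Tendsto (fun n => (φ n).rOut) atTop (𝓝 0)) :
    Tendsto (fun n => eLpNorm (fun x => mollify ((φ n).normed volume) G
      ((c - s n • c) + s n • x) - G x) 2 (volume.restrict K)) atTop (𝓝 0) := by
  have hKm : volume K ≠ ⊤ := hK.measure_lt_top.ne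
  have hM : (2 ^ d + volume K ^ (1 / 2 : ℝ) * 2 + 1 : ℝ≥0∞) ≠ ⊤ := by
    have h1 : volume K ^ (1 / 2 : ℝ) ≠ ⊤ := ENNReal.rpow_ne_top_of_nonneg (by norm_num) hKm
    exact ENNReal.add_ne_top.2 ⟨ENNReal.add_ne_top.2 ⟨by simp, ENNReal.mul_ne_top h1 (by simp)⟩,
      by simp⟩
  obtain ⟨R, hR⟩ := hK.isBounded.exists_norm_le
  refine tendsto_zero_of_le_mul_ofReal hM fun ε hε => ?_
  obtain ⟨H, hHc, hGH, hHcont, hHL⟩ := hG.exists_hasCompactSupport_eLpNorm_sub_le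
    (by simp) (ENNReal.ofReal_pos.2 hε).ne'
  obtain ⟨δ, hδ, hu⟩ := Metric.uniformContinuous_iff.1
    (hHc.uniformContinuous_of_continuous hHcont) ε hε
  have ev1 : ∀ᶠ n in atTop, (φ n).rOut < δ := hφ.eventually (gt_mem_nhds hδ)
  have ht : Tendsto (fun n => |1 - s n| * (‖c‖ + R)) atTop (𝓝 0) := by
    have := ((hs.const_sub 1).abs).mul_const (‖c‖ + R)
    simpa using this
  have ev2 : ∀ᶠ n in atTop, |1 - s n| * (‖c‖ + R) < δ := ht.eventually (gt_mem_nhds hδ)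
  have hloc : LocallyIntegrable G := hG.locallyIntegrable (by norm_num)
  have hlocH : LocallyIntegrable H := hHcont.locallyIntegrable
  filter_upwards [ev1, ev2] with n h1 h2
  set ρ := (φ n).normed volume with hρ
  have hρc : Continuous ρ := (φ n).continuous_normed
  have hρs : HasCompactSupport ρ := (φ n).hasCompactSupport_normed
  set z : Pt d → Pt d := fun x => (c - s n • c) + s n • x with hz
  have hzc : Continuous z := by fun_prop
  have hAm : ∀ {F : Pt d → ℝ}, LocallyIntegrable F → Continuous fun x => mollify ρ F (z x) := by
    intro F hF
    exact (contDiff_mollify (φ n).contDiff_normed hρs hF).continuous.comp hzc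
  have e : (fun x => mollify ρ G (z x) - G x) =
      (fun x => mollify ρ (fun y => G y - H y) (z x)) +
        ((fun x => mollify ρ H (z x) - H x) + fun x => H x - G x) := by
    funext x
    simp only [Pi.add_apply, mollify_sub hρc hρs hloc hlocH]
    ring
  have b1 : eLpNorm (fun x => mollify ρ (fun y => G y - H y) (z x)) 2 (volume.restrict K) ≤
      2 ^ d * ENNReal.ofReal ε := by
    refine (eLpNorm_mollify_le hρc (φ n).nonneg_normed (φ n).integrable_normed
      (φ n).integral_normed (hG.sub hHL).1.aemeasurable _ (hs2 n) K).trans ?_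
    gcongr
  have b2 : eLpNorm (fun x => mollify ρ H (z x) - H x) 2 (volume.restrict K) ≤
      volume K ^ (1 / 2 : ℝ) * 2 * ENNReal.ofReal ε := by
    have hb : ∀ᵐ x ∂volume.restrict K, ‖mollify ρ H (z x) - H x‖ ≤ 2 * ε := by
      filter_upwards [ae_restrict_mem hK.measurableSet] with x hx
      have hzx : dist (z x) x < δ := by
        have : z x - x = (1 - s n) • (c - x) := by
          simp only [hz, sub_smul, smul_sub, one_smul]; abel
        rw [dist_eq_norm, this, norm_smul, Real.norm_eq_abs]
        refine lt_of_le_of_lt ?_ h2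
        gcongr
        exact (norm_sub_le _ _).trans (by linarith [hR x hx])
      have h3 : dist (mollify ρ H (z x)) (H (z x)) ≤ ε := by
        have h5 : mollify ρ H (z x) =
            convolution ρ H (ContinuousLinearMap.lsmul ℝ ℝ) volume (z x) := by
          rw [convolution_lsmul_swap, mollify]
          simp [mul_comm]
        rw [h5]
        refine (φ n).dist_normed_convolution_le hHcont.aestronglyMeasurable fun y hy => ?_
        exact (hu (lt_trans (Metric.mem_ball.1 hy) h1)).le
      have h4 := (hu hzx).le
      rw [← dist_eq_norm]
      exact (dist_triangle _ (H (z x)) _).trans (by linarith)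
    refine (eLpNorm_le_of_ae_bound hb).trans_eq ?_
    rw [Measure.restrict_apply_univ, ENNReal.ofReal_mul (by norm_num)]
    simp [mul_assoc]
  have b3 : eLpNorm (fun x => H x - G x) 2 (volume.restrict K) ≤ 1 * ENNReal.ofReal ε := by
    rw [one_mul]
    refine (eLpNorm_mono_measure _ Measure.restrict_le_self).trans ?_
    have := hGH
    rw [eLpNorm_sub_comm] at this
    exact this
  rw [e]
  refine (eLpNorm_add_le (hAm (hloc.sub hlocH)).aestronglyMeasurable
    (((hAm hlocH).sub hHcont).aestronglyMeasurable.add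
      ((hHL.sub hG).1.restrict)) (by norm_num)).trans ?_
  rw [add_mul, add_mul, add_assoc]
  refine add_le_add b1 ((eLpNorm_add_le ((hAm hlocH).sub hHcont).aestronglyMeasurable
      ((hHL.sub hG).1.restrict) (by norm_num)).trans (add_le_add b2 b3))

theorem volume_restrict_interior {K : Set (Pt d)} (hK : Convex ℝ K) :
    volume.restrict (interior K) = (volume.restrict K : Measure (Pt d)) := by
  refine Measure.restrict_congr_set ?_
  refine (interior_subset.eventuallyLE : interior K ≤ᵐ[volume] K).antisymm ?_
  have h0 : volume (frontier K) = 0 := hK.addHaar_frontier volume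
  refine (ae_le_set).2 (measure_mono_null ?_ h0)
  exact fun x hx => ⟨subset_closure hx.1, hx.2⟩

theorem eLpNorm_sub_le_of_eq_const_mul {μ : Measure (Pt d)} {q : ℝ} (hq0 : 0 ≤ q) (hq1 : q ≤ 1)
    {A G F g : Pt d → ℝ} (hA : AEStronglyMeasurable A μ) (hG : AEStronglyMeasurable G μ)
    (hF : F =ᵐ[μ] fun x => q * A x) (hg : G =ᵐ[μ] g) :
    eLpNorm (fun x => F x - g x) 2 μ ≤
      eLpNorm (fun x => A x - G x) 2 μ + ENNReal.ofReal |q - 1| * eLpNorm G 2 μ := by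
  have e1 : (fun x => F x - g x) =ᵐ[μ] (q • fun x => A x - G x) + (q - 1) • G := by
    filter_upwards [hF, hg] with x hx hxG
    rw [hx, ← hxG]
    simp only [Pi.add_apply, Pi.smul_apply, smul_eq_mul]
    ring
  rw [eLpNorm_congr_ae e1]
  refine (eLpNorm_add_le ((hA.sub hG).const_smul q) (hG.const_smul (q - 1))
    (by norm_num)).trans ?_
  rw [eLpNorm_const_smul, eLpNorm_const_smul, ← ofReal_norm_eq_enorm, ← ofReal_norm_eq_enorm,
    Real.norm_eq_abs, Real.norm_eq_abs, abs_of_nonneg hq0]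
  gcongr
  calc ENNReal.ofReal q * eLpNorm (fun x => A x - G x) 2 μ
      ≤ 1 * eLpNorm (fun x => A x - G x) 2 μ := by
        gcongr
        exact ENNReal.ofReal_le_one.2 hq1
    _ = _ := one_mul _

/-- Smooth functions are dense in the Sobolev spaces of a convex body. -/
theorem exists_smooth_approx {K : Set (Pt d)} (hK : IsCompact K) (hconv : Convex ℝ K)
    (hne : (interior K).Nonempty) (m : ℕ) {w : Pt d → ℝ} {g : (Fin d → ℕ) → Pt d → ℝ}
    (hw : ∀ α, ∑ i, α i ≤ m → HasWeakDeriv (interior K) α w (g α))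
    (hg : ∀ α, ∑ i, α i ≤ m → MemLp (g α) 2 (volume.restrict K))
    (hwL : MemLp w 2 (volume.restrict K)) :
    ∃ φ : ℕ → Pt d → ℝ, (∀ n, ContDiff ℝ ∞ (φ n)) ∧ ∀ α, ∑ i, α i ≤ m →
      Tendsto (fun n => eLpNorm (fun x => multiDeriv α (φ n) x - g α x) 2 (volume.restrict K))
        atTop (𝓝 0) := by
  obtain ⟨c, hc⟩ := hne
  obtain ⟨r, hr, hball⟩ := Metric.isOpen_iff.1 isOpen_interior c hc
  have hU : IsOpen (interior K) := isOpen_interior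
  have hUK := volume_restrict_interior hconv
  have hind : ∀ {v : Pt d → ℝ}, MemLp v 2 (volume.restrict K) →
      MemLp ((interior K).indicator v) 2 volume := by
    intro v hv
    rw [memLp_indicator_iff_restrict hU.measurableSet, hUK]
    exact hv
  obtain ⟨s, hsdef⟩ : ∃ s : ℕ → ℝ, ∀ n : ℕ, s n = 1 - 1 / ((n : ℝ) + 2) := ⟨_, fun _ => rfl⟩
  have hpos : ∀ n : ℕ, 0 < 1 / ((n : ℝ) + 2) := fun n => by positivity
  have hle : ∀ n : ℕ, 1 / ((n : ℝ) + 2) ≤ 1 / 2 := fun n =>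
    one_div_le_one_div_of_le (by norm_num) (by linarith [(Nat.cast_nonneg n : (0 : ℝ) ≤ n)])
  have ht0 : Tendsto (fun n : ℕ => 1 / ((n : ℝ) + 2)) atTop (𝓝 0) := by
    have := (tendsto_one_div_add_atTop_nhds_zero_nat (𝕜 := ℝ)).comp (tendsto_add_atTop_nat 1)
    refine this.congr fun n => ?_
    simp only [Function.comp_apply, Nat.cast_add, Nat.cast_one]
    ring
  have hs1 : Tendsto s atTop (𝓝 1) := by
    have := ht0.const_sub 1
    rw [sub_zero] at this
    exact this.congr fun n => (hsdef n).symm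
  have hs2 : ∀ n, 1 / 2 ≤ s n := fun n => by simp only [hsdef]; linarith [hle n]
  have hs0 : ∀ n, 0 < s n := fun n => by linarith [hs2 n]
  have hδ : ∀ n : ℕ, 0 < 1 / ((n : ℝ) + 2) * r / 2 := fun n => by have := hpos n; positivity
  obtain ⟨B, hB⟩ : ∃ B : ℕ → ContDiffBump (0 : Pt d),
      ∀ n : ℕ, (B n).rOut = 1 / ((n : ℝ) + 2) * r / 2 :=
    ⟨fun n => ⟨1 / ((n : ℝ) + 2) * r / 2 / 2, 1 / ((n : ℝ) + 2) * r / 2, half_pos (hδ n),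
      half_lt_self (hδ n)⟩, fun _ => rfl⟩
  have hBt : Tendsto (fun n => (B n).rOut) atTop (𝓝 0) := by
    have := (ht0.mul_const r).div_const 2
    rw [zero_mul, zero_div] at this
    exact this.congr fun n => (hB n).symm
  have hloc : ∀ {v : Pt d → ℝ}, MemLp v 2 (volume.restrict K) →
      LocallyIntegrable ((interior K).indicator v) := fun hv =>
    (hind hv).locallyIntegrable (by norm_num)
  have htest : ∀ n, IsTestFunction Set.univ ((B n).normed volume) := fun n =>
    ⟨(B n).contDiff_normed, (B n).hasCompactSupport_normed, Set.subset_univ _⟩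
  obtain ⟨F, hF⟩ : ∃ F : ℕ → Pt d → ℝ,
      ∀ n, F n = mollify ((B n).normed volume) ((interior K).indicator w) := ⟨_, fun _ => rfl⟩
  have hFs : ∀ n, ContDiff ℝ ∞ (F n) := fun n => by
    rw [hF]; exact contDiff_mollify (htest n).1 (htest n).2.1 (hloc hwL)
  have haff : ∀ n, ContDiff ℝ ∞ fun x : Pt d => (c - s n • c) + s n • x := fun n => by fun_prop
  refine ⟨fun n x => F n ((c - s n • c) + s n • x), fun n => (hFs n).comp (haff n), ?_⟩
  intro α hα
  obtain ⟨G, hGdef⟩ : ∃ G, G = (interior K).indicator (g α) := ⟨_, rfl⟩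
  have hder : ∀ n, ∀ x ∈ K, multiDeriv α (fun x => F n ((c - s n • c) + s n • x)) x =
      s n ^ (∑ i, α i) * mollify ((B n).normed volume) G ((c - s n • c) + s n • x) := by
    intro n x hx
    rw [multiDeriv_comp_affine (hFs n), hF]
    beta_reduce
    rw [multiDeriv_mollify (htest n) (hloc hwL), mollify_multiDeriv_eq hU (hw α hα) (htest n), ← hGdef]
    intro y hy
    rw [(B n).tsupport_normed_eq, hB] at hy
    have hy' : ‖y - ((c - s n • c) + s n • x)‖ ≤ 1 / ((n : ℝ) + 2) * r / 2 := by
      have := mem_closedBall_zero_iff.1 hy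
      rwa [norm_sub_rev] at this
    have ht := hpos n
    have hst := hsdef n
    generalize 1 / ((n : ℝ) + 2) = t at ht hst hy'
    obtain ⟨q, hq⟩ : ∃ q, q = c + t⁻¹ • (y - ((c - s n • c) + s n • x)) := ⟨_, rfl⟩
    have hqU : q ∈ interior K := by
      refine hball ?_
      rw [Metric.mem_ball, dist_eq_norm, hq, add_sub_cancel_left, norm_smul, norm_inv,
        Real.norm_eq_abs, abs_of_pos ht, inv_mul_lt_iff₀ ht]
      nlinarith [mul_pos ht hr]
    have hyq : y = t • q + (1 - t) • x := by
      rw [hq, smul_add, smul_smul, mul_inv_cancel₀ ht.ne', hst]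
      simp only [sub_smul, one_smul]
      abel
    rw [hyq]
    exact hconv.combo_interior_self_mem_interior hqU hx ht (by linarith [hs0 n, hst]) (by ring)
  have hGL : MemLp G 2 volume := hGdef ▸ hind (hg α hα)
  have hGae : G =ᵐ[volume.restrict K] g α := by
    rw [← hUK, hGdef]
    exact indicator_ae_eq_restrict hU.measurableSet
  have hconvG := tendsto_eLpNorm_mollify_sub hGL hK c hs1 hs2 B hBt
  have hfac : Tendsto (fun n => ENNReal.ofReal |s n ^ (∑ i, α i) - 1| *
      eLpNorm G 2 (volume.restrict K)) atTop (𝓝 0) := by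
    have h1 : Tendsto (fun n => ENNReal.ofReal |s n ^ (∑ i, α i) - 1|) atTop (𝓝 0) := by
      have := ((hs1.pow (∑ i, α i)).sub_const 1).abs
      simp only [one_pow, sub_self, abs_zero] at this
      simpa using ENNReal.tendsto_ofReal this
    have h2 := ENNReal.Tendsto.mul_const (b := eLpNorm G 2 (volume.restrict K)) h1
      (Or.inr (hGL.restrict K).2.ne)
    simpa using h2
  have hsum := hconvG.add hfac
  rw [add_zero] at hsum
  refine tendsto_of_tendsto_of_tendsto_of_le_of_le tendsto_const_nhds hsum
    (fun _ => zero_le) fun n => ?_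
  obtain ⟨A, hA⟩ : ∃ A : Pt d → ℝ,
      A = fun x => mollify ((B n).normed volume) G ((c - s n • c) + s n • x) := ⟨_, rfl⟩
  have hAc : Continuous A := by
    rw [hA]
    exact (contDiff_mollify (htest n).1 (htest n).2.1
      (hGL.locallyIntegrable (by norm_num))).continuous.comp (haff n).continuous
  have e2 : (fun x => mollify ((B n).normed volume) G ((c - s n • c) + s n • x) - G x) =
      fun x => A x - G x := by rw [hA]
  have e1 : multiDeriv α (fun x => F n ((c - s n • c) + s n • x))
      =ᵐ[volume.restrict K] fun x => s n ^ (∑ i, α i) * A x := by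
    filter_upwards [ae_restrict_mem hK.measurableSet] with x hx
    rw [hder n x hx, hA]
  have hs1' : s n ≤ 1 := by rw [hsdef]; linarith [hpos n]
  beta_reduce
  rw [e2]
  exact eLpNorm_sub_le_of_eq_const_mul (pow_nonneg (hs0 n).le _)
    (pow_le_one₀ (hs0 n).le hs1') hAc.aestronglyMeasurable hGL.1.restrict e1 hGae

end

end HDG

end

noncomputable section

namespace HDG

section

variable {α : Type*} [MeasurableSpace α] {μ : Measure α}

theorem memLp_ofReal_smul_iff {c : ℝ} (hc : 0 < c) {f : α → ℝ} :
    MemLp f 2 (ENNReal.ofReal c • μ) ↔ MemLp f 2 μ := by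
  refine ⟨fun h => ?_, fun h => h.smul_measure ENNReal.ofReal_ne_top⟩
  have h2 := h.smul_measure (c := ENNReal.ofReal c⁻¹) ENNReal.ofReal_ne_top
  rwa [smul_smul, ← ENNReal.ofReal_mul (by positivity), inv_mul_cancel₀ hc.ne',
    ENNReal.ofReal_one, one_smul] at h2

theorem ae_ofReal_smul_iff {c : ℝ} (hc : 0 < c) {p : α → Prop} :
    (∀ᵐ x ∂(ENNReal.ofReal c • μ), p x) ↔ ∀ᵐ x ∂μ, p x := by
  simp [MeasureTheory.ae_iff, hc.not_ge]

theorem tendsto_eLpNorm_ofReal_smul_iff {c : ℝ} (hc : 0 < c) {F : ℕ → α → ℝ} {f : α → ℝ}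
    (hF : ∀ n, MemLp (F n) 2 μ) (hf : MemLp f 2 μ) :
    Tendsto (fun n => eLpNorm (fun x => F n x - f x) 2 (ENNReal.ofReal c • μ)) atTop (𝓝 0) ↔
      Tendsto (fun n => l2Norm μ fun x => F n x - f x) atTop (𝓝 0) := by
  have hF' := fun n => (memLp_ofReal_smul_iff hc).2 (hF n)
  have hf' := (memLp_ofReal_smul_iff hc).2 hf
  refine ⟨fun h => ?_, fun h => ?_⟩
  · have h2 := (tendsto_l2Norm_sub hF' hf' h).const_mul (Real.sqrt c)⁻¹
    rw [mul_zero] at h2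
    refine h2.congr fun n => ?_
    rw [l2Norm_smul_measure c hc.le, inv_mul_cancel_left₀ (Real.sqrt_pos.2 hc).ne']
  · refine tendsto_eLpNorm_sub hF' hf' ?_
    have h2 := h.const_mul (Real.sqrt c)
    rw [mul_zero] at h2
    refine h2.congr fun n => ?_
    rw [l2Norm_smul_measure c hc.le]

theorem exists_l2_limit {F : ℕ → α → ℝ} (hF : ∀ n, MemLp (F n) 2 μ) {e : ℕ → ℝ}
    (he : Tendsto e atTop (𝓝 0))
    (h : ∀ n m, l2Norm μ (fun x => F n x - F m x) ≤ e n + e m) :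
    ∃ f, MemLp f 2 μ ∧ Tendsto (fun n => l2Norm μ fun x => F n x - f x) atTop (𝓝 0) := by
  have hd : ∀ {f g : α → ℝ} (hf : MemLp f 2 μ) (hg : MemLp g 2 μ),
      dist (hf.toLp f) (hg.toLp g) = l2Norm μ fun x => f x - g x := by
    intro f g hf hg
    rw [dist_eq_norm, ← MemLp.toLp_sub, Lp.norm_toLp]
    exact (l2Norm_eq_toReal (hf.sub hg)).symm
  have hc : CauchySeq fun n => (hF n).toLp (F n) := by
    rw [Metric.cauchySeq_iff]
    intro ε hε
    obtain ⟨N, hN⟩ := eventually_atTop.1 (he.eventually (gt_mem_nhds (half_pos hε)))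
    refine ⟨N, fun n hn m hm => ?_⟩
    rw [hd]
    linarith [h n m, hN n hn, hN m hm]
  obtain ⟨f, hf⟩ := cauchySeq_tendsto_of_complete hc
  refine ⟨f, Lp.memLp f, ?_⟩
  rw [tendsto_iff_dist_tendsto_zero] at hf
  refine hf.congr fun n => ?_
  rw [← hd (hF n) (Lp.memLp f), Lp.toLp_coeFn]

end

/-! ### Elements and their faces -/

section

variable {n m d : ℕ}

theorem simplexVol_congr {a a' : Fin (m + 1) → Pt d}
    (h : Set.range a = Set.range a') : simplexVol a = simplexVol a' := by
  have e := (simplexVol_eq a).trans ((by rw [h] : _ = _).trans (simplexVol_eq a').symm)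
  have h0 : ∀ a : Fin (m + 1) → Pt d, 0 ≤ simplexVol a := fun a =>
    mul_nonneg (LinearMap.normDet_nonneg _) ENNReal.toReal_nonneg
  exact (ENNReal.ofReal_eq_ofReal_iff (h0 a) (h0 a')).1 e

/-- The normalised measure of a simplex does not depend on the order of the vertices. -/
theorem simplexMeasure_congr {a a' : Fin (m + 1) → Pt d} (ha : AffineIndependent ℝ a)
    (h : Set.range a = Set.range a') : simplexMeasure a = simplexMeasure a' := by
  have e := (restrict_convexHull_eq a).symm.trans
    ((by rw [h] : _ = _).trans (restrict_convexHull_eq a'))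
  rw [← simplexVol_congr h] at e
  have h2 := congrArg (fun μ => ENNReal.ofReal (simplexVol a)⁻¹ • μ) e
  have hp := simplexVol_pos ha
  simpa only [smul_smul, ← ENNReal.ofReal_mul (inv_nonneg.2 hp.le), inv_mul_cancel₀ hp.ne',
    ENNReal.ofReal_one, one_smul] using h2

/-- `b` enumerates the vertices of the nondegenerate simplex `T`. -/
structure IsElement (b : Fin (n + 2) → Pt (n + 1)) (T : Finset (Pt (n + 1))) : Prop where
  indep : AffineIndependent ℝ b
  coe_eq : (T : Set (Pt (n + 1))) = Set.range b

/-- The vertices of the face opposite to the vertex `b i`. -/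
def faceVerts (b : Fin (n + 2) → Pt d) (i : Fin (n + 2)) : Fin (n + 1) → Pt d :=
  fun j => b (i.succAbove j)

theorem range_faceVerts_swap (b : Fin (n + 2) → Pt d) (i : Fin (n + 2)) :
    Set.range (faceVerts (b ∘ Equiv.swap 1 i) 1) = Set.range (faceVerts b i) := by
  have key : ∀ (c : Fin (n + 2) → Pt d) j, Set.range (faceVerts c j) = c '' {j}ᶜ := by
    intro c j
    rw [← Fin.range_succAbove j, ← Set.range_comp]; rfl
  rw [key, key, Set.image_comp]
  congr 1
  rw [Set.image_compl_eq (Equiv.swap 1 i).bijective]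
  simp

theorem affineIndependent_faceVerts {b : Fin (n + 2) → Pt d} (hb : AffineIndependent ℝ b)
    (i : Fin (n + 2)) : AffineIndependent ℝ (faceVerts b i) :=
  hb.comp_embedding i.succAboveEmb

/-- The trace inequality for smooth functions. -/
theorem l2Norm_faceVerts_le {b : Fin (n + 2) → Pt d} (hb : AffineIndependent ℝ b)
    (i : Fin (n + 2)) {φ : Pt d → ℝ} (hφ : ContDiff ℝ ∞ φ) :
    l2Norm (simplexMeasure (faceVerts b i)) φ ≤
      traceConst n * (l2Norm (simplexMeasure b) φ +
        Metric.diam (convexHull ℝ (Set.range b)) *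
          ∑ j, l2Norm (simplexMeasure b) (partialDeriv j φ)) := by
  have h := l2Norm_face_le (b ∘ Equiv.swap 1 i) hφ
  have hr : Set.range (b ∘ Equiv.swap 1 i) = Set.range b := (Equiv.swap 1 i).surjective.range_comp b
  have e1 : simplexMeasure (b ∘ Equiv.swap 1 i) = simplexMeasure b :=
    (simplexMeasure_congr hb hr.symm).symm
  have e2 : simplexMeasure (fun j => (b ∘ Equiv.swap 1 i) (Fin.succAbove 1 j)) =
      simplexMeasure (faceVerts b i) :=
    (simplexMeasure_congr (affineIndependent_faceVerts hb i)
      (range_faceVerts_swap b i).symm).symm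
  rwa [e1, e2, hr] at h

variable {b : Fin (n + 2) → Pt (n + 1)} {T F : Finset (Pt (n + 1))} {i : Fin (n + 2)}

theorem IsElement.hull_eq (H : IsElement b T) : hull T = convexHull ℝ (Set.range b) := by
  rw [hull, H.coe_eq]

theorem IsElement.elementDiam_eq (H : IsElement b T) :
    elementDiam T = Metric.diam (convexHull ℝ (Set.range b)) := by
  rw [elementDiam, H.hull_eq]

theorem IsElement.elementMeasure_eq (H : IsElement b T) :
    elementMeasure T = ENNReal.ofReal (simplexVol b) • simplexMeasure b := by
  rw [elementMeasure, H.hull_eq, ← restrict_convexHull_eq,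
    EuclideanSpace.euclideanHausdorffMeasure_eq_volume]

theorem faceMeasure_eq (hF : (F : Set (Pt (n + 1))) = Set.range (faceVerts b i)) :
    faceMeasure F =
      ENNReal.ofReal (simplexVol (faceVerts b i)) • simplexMeasure (faceVerts b i) := by
  rw [← restrict_convexHull_eq, ← hF]; rfl

theorem convex_hull (S : Finset (Pt d)) : Convex ℝ (hull S) := convex_convexHull ℝ _

theorem isCompact_hull (S : Finset (Pt d)) : IsCompact (hull S) :=
  S.finite_toSet.isCompact_convexHull (𝕜 := ℝ)

theorem elementMeasure_eq_interior (S : Finset (Pt d)) :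
    volume.restrict (interior (hull S)) = elementMeasure S :=
  volume_restrict_interior (convex_hull S)

theorem IsElement.nonempty_interior (H : IsElement b T) : (interior (hull T)).Nonempty := by
  have h : volume (hull T) ≠ 0 := by
    have h1 := congrArg (fun μ => μ Set.univ) H.elementMeasure_eq
    simp only [elementMeasure, Measure.restrict_apply_univ, Measure.smul_apply, measure_univ,
      smul_eq_mul, mul_one] at h1
    rw [h1]
    exact (ENNReal.ofReal_pos.2 (simplexVol_pos H.indep)).ne'
  by_contra hne
  rw [Set.not_nonempty_iff_eq_empty] at hne
  have h2 := volume_restrict_interior (convex_hull T)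
  rw [hne, Measure.restrict_empty] at h2
  exact h (Measure.restrict_eq_zero.1 h2.symm)

/-! ### Sobolev functions on an element -/

theorem MemSobolev.hasWeakDeriv {Ω : Set (Pt d)} {k : ℕ} {w : Pt d → ℝ} (hw : MemSobolev Ω k w)
    {α : Fin d → ℕ} (hα : ∑ i, α i ≤ k) : HasWeakDeriv Ω α w (weakDeriv Ω α w) :=
  (hw α hα).choose_spec.1.weakDeriv

theorem MemSobolev.memLp_weakDeriv {Ω : Set (Pt d)} (hΩ : IsOpen Ω) {k : ℕ} {w : Pt d → ℝ}
    (hw : MemSobolev Ω k w) {α : Fin d → ℕ} (hα : ∑ i, α i ≤ k) :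
    MemLp (weakDeriv Ω α w) 2 (volume.restrict Ω) := by
  obtain ⟨g, hg, hgL⟩ := hw α hα
  exact (memLp_congr_ae (hg.weakDeriv_ae_eq hΩ)).2 hgL

theorem weakDeriv_zero_ae_eq {Ω : Set (Pt d)} (hΩ : IsOpen Ω) {w : Pt d → ℝ}
    (hw : LocallyIntegrableOn w Ω) : weakDeriv Ω 0 w =ᵐ[volume.restrict Ω] w :=
  HasWeakDeriv.weakDeriv_ae_eq hΩ ⟨hw, hw, fun φ _ => by simp [multiDeriv_zero]⟩

theorem MemSobolev.memLp {Ω : Set (Pt d)} (hΩ : IsOpen Ω) {k : ℕ} {w : Pt d → ℝ}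
    (hw : MemSobolev Ω k w) : MemLp w 2 (volume.restrict Ω) :=
  (memLp_congr_ae (weakDeriv_zero_ae_eq hΩ (hw 0 (by simp)).choose_spec.1.1)).1
    (hw.memLp_weakDeriv hΩ (by simp))

theorem MemSobolev.mono {Ω U : Set (Pt d)} {k l : ℕ} {w : Pt d → ℝ}
    (hw : MemSobolev Ω k w) (hU : U ⊆ Ω) (hl : l ≤ k) : MemSobolev U l w := by
  intro α hα
  obtain ⟨g, hg, hgL⟩ := hw α (hα.trans hl)
  exact ⟨g, hg.mono hU, hgL.mono_measure (Measure.restrict_mono_set _ hU)⟩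

theorem MemSobolev.sub {Ω : Set (Pt d)} {k : ℕ} {w w' : Pt d → ℝ}
    (hw : MemSobolev Ω k w) (hw' : MemSobolev Ω k w') :
    MemSobolev Ω k fun x => w x - w' x := by
  intro α hα
  obtain ⟨g, hg, hgL⟩ := hw α hα
  obtain ⟨g', hg', hgL'⟩ := hw' α hα
  exact ⟨_, hg.sub hg', hgL.sub hgL'⟩

theorem MemSobolev.congr {Ω : Set (Pt d)} (hΩ : IsOpen Ω) {k : ℕ} {w w' : Pt d → ℝ}
    (hw : MemSobolev Ω k w) (h : w =ᵐ[volume.restrict Ω] w') : MemSobolev Ω k w' := by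
  intro α hα
  obtain ⟨g, hg, hgL⟩ := hw α hα
  exact ⟨g, hg.congr hΩ.measurableSet h (ae_eq_refl g), hgL⟩

theorem multiIndex_le_one {α : Fin d → ℕ} (hα : ∑ i, α i ≤ 1) :
    α = 0 ∨ ∃ j, α = Pi.single j 1 := by
  by_cases h : α = 0
  · exact Or.inl h
  right
  obtain ⟨β, j, hβ⟩ : ∃ (β : Fin d → ℕ) (j : Fin d), α = β + Pi.single j 1 := by
    obtain ⟨j, hj⟩ := Function.ne_iff.1 h
    refine ⟨α - Pi.single j 1, j, ?_⟩
    rw [tsub_add_cancel_of_le]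
    intro l
    rcases eq_or_ne l j with rfl | hl
    · simpa [Nat.one_le_iff_ne_zero] using hj
    · simp [hl]
  refine ⟨j, ?_⟩
  rw [hβ, sum_add_single] at hα
  have h0 : β = 0 := by
    funext l
    have := Finset.single_le_sum (f := β) (fun _ _ => Nat.zero_le _) (Finset.mem_univ l)
    simp only [Pi.zero_apply]; lia
  rw [hβ, h0, zero_add]

theorem memSobolev_one_of_contDiff (S : Finset (Pt d)) {φ : Pt d → ℝ} (hφ : ContDiff ℝ ∞ φ) :
    MemSobolev (interior (hull S)) 1 φ := by
  have hL : ∀ {f : Pt d → ℝ}, Continuous f →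
      MemLp f 2 (volume.restrict (interior (hull S))) := by
    intro f hf
    obtain ⟨C, hC⟩ := (isCompact_hull S).exists_bound_of_continuousOn hf.continuousOn
    have : IsFiniteMeasure (volume.restrict (interior (hull S)) : Measure (Pt d)) :=
      ⟨by
        rw [Measure.restrict_apply_univ]
        exact (measure_mono interior_subset).trans_lt (isCompact_hull S).measure_lt_top⟩
    exact MemLp.of_bound hf.aestronglyMeasurable C
      ((ae_restrict_mem isOpen_interior.measurableSet).mono fun x hx => hC x (interior_subset hx))
  intro α hα
  rcases multiIndex_le_one hα with rfl | ⟨j, rfl⟩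
  · have := hφ.continuous.locallyIntegrable (μ := volume).locallyIntegrableOn (interior (hull S))
    exact ⟨φ, ⟨this, this, fun ψ _ => by simp [multiDeriv_zero]⟩, hL hφ.continuous⟩
  · exact ⟨_, hasWeakDeriv_of_contDiff j hφ, hL (continuous_partialDeriv hφ j)⟩

/-- The first weak derivatives on the element `T`. -/
def elementDeriv (T : Finset (Pt d)) (j : Fin d) (w : Pt d → ℝ) : Pt d → ℝ :=
  weakDeriv (interior (hull T)) (Pi.single j 1) w

/-- The scaled `H¹(T)`-norm with respect to the normalised measure of `T`. -/
def h1Norm (b : Fin (n + 2) → Pt (n + 1)) (T : Finset (Pt (n + 1))) (w : Pt (n + 1) → ℝ) : ℝ :=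
  l2Norm (simplexMeasure b) w +
    elementDiam T * ∑ j, l2Norm (simplexMeasure b) (elementDeriv T j w)

theorem elementDiam_nonneg (T : Finset (Pt d)) : 0 ≤ elementDiam T := Metric.diam_nonneg

theorem h1Norm_nonneg (b : Fin (n + 2) → Pt (n + 1)) (T : Finset (Pt (n + 1)))
    (w : Pt (n + 1) → ℝ) : 0 ≤ h1Norm b T w :=
  add_nonneg (l2Norm_nonneg _ _) (mul_nonneg (elementDiam_nonneg T)
    (Finset.sum_nonneg fun _ _ => l2Norm_nonneg _ _))

theorem IsElement.restrict_interior_eq (H : IsElement b T) :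
    volume.restrict (interior (hull T)) = ENNReal.ofReal (simplexVol b) • simplexMeasure b := by
  rw [elementMeasure_eq_interior, H.elementMeasure_eq]

theorem IsElement.memLp_iff (H : IsElement b T) {f : Pt (n + 1) → ℝ} :
    MemLp f 2 (volume.restrict (interior (hull T))) ↔ MemLp f 2 (simplexMeasure b) := by
  rw [H.restrict_interior_eq, memLp_ofReal_smul_iff (simplexVol_pos H.indep)]

theorem IsElement.ae_iff (H : IsElement b T) {p : Pt (n + 1) → Prop} :
    (∀ᵐ x ∂volume.restrict (interior (hull T)), p x) ↔ ∀ᵐ x ∂simplexMeasure b, p x := by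
  rw [H.restrict_interior_eq, ae_ofReal_smul_iff (simplexVol_pos H.indep)]

theorem IsElement.memLp (H : IsElement b T) {k : ℕ} {w : Pt (n + 1) → ℝ}
    (hw : MemSobolev (interior (hull T)) k w) : MemLp w 2 (simplexMeasure b) :=
  H.memLp_iff.1 (hw.memLp isOpen_interior)

theorem IsElement.memLp_deriv (H : IsElement b T) {w : Pt (n + 1) → ℝ}
    (hw : MemSobolev (interior (hull T)) 1 w) (j : Fin (n + 1)) :
    MemLp (elementDeriv T j w) 2 (simplexMeasure b) :=
  H.memLp_iff.1 (hw.memLp_weakDeriv isOpen_interior (by simp))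

theorem IsElement.elementDeriv_sub (H : IsElement b T) {w w' : Pt (n + 1) → ℝ}
    (hw : MemSobolev (interior (hull T)) 1 w) (hw' : MemSobolev (interior (hull T)) 1 w')
    (j : Fin (n + 1)) :
    elementDeriv T j (fun x => w x - w' x) =ᵐ[simplexMeasure b]
      fun x => elementDeriv T j w x - elementDeriv T j w' x :=
  H.ae_iff.1 (((hw.hasWeakDeriv (by simp)).sub (hw'.hasWeakDeriv (by simp))).weakDeriv_ae_eq
    isOpen_interior)

theorem IsElement.elementDeriv_of_contDiff (H : IsElement b T) {φ : Pt (n + 1) → ℝ}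
    (hφ : ContDiff ℝ ∞ φ) (j : Fin (n + 1)) :
    elementDeriv T j φ =ᵐ[simplexMeasure b] partialDeriv j φ :=
  H.ae_iff.1 ((hasWeakDeriv_of_contDiff j hφ).weakDeriv_ae_eq isOpen_interior)

theorem IsElement.elementDeriv_congr (H : IsElement b T) {w w' : Pt (n + 1) → ℝ}
    (hw : MemSobolev (interior (hull T)) 1 w) (h : w =ᵐ[simplexMeasure b] w') (j : Fin (n + 1)) :
    elementDeriv T j w =ᵐ[simplexMeasure b] elementDeriv T j w' := by
  have h1 := hw.hasWeakDeriv (α := Pi.single j 1) (by simp)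
  have h2 := h1.congr isOpen_interior.measurableSet (H.ae_iff.2 h) (ae_eq_refl _)
  have h3 : elementDeriv T j w' =ᵐ[simplexMeasure b] elementDeriv T j w :=
    H.ae_iff.1 (h2.weakDeriv_ae_eq isOpen_interior)
  exact h3.symm

/-- Smooth functions are dense in `H^m(T)`. -/
theorem IsElement.exists_smooth_approx (H : IsElement b T) {m : ℕ} {w : Pt (n + 1) → ℝ}
    (hw : MemSobolev (interior (hull T)) m w) :
    ∃ φ : ℕ → Pt (n + 1) → ℝ, (∀ n, ContDiff ℝ ∞ (φ n)) ∧
      Tendsto (fun l => l2Norm (simplexMeasure b) fun x => φ l x - w x) atTop (𝓝 0) ∧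
      ∀ α, ∑ i, α i ≤ m → Tendsto (fun l => l2Norm (simplexMeasure b) fun x =>
        multiDeriv α (φ l) x - weakDeriv (interior (hull T)) α w x) atTop (𝓝 0) := by
  have e := elementMeasure_eq_interior T
  obtain ⟨φ, hφ, hlim⟩ := HDG.exists_smooth_approx (isCompact_hull T) (convex_hull T)
    H.nonempty_interior m (fun α hα => hw.hasWeakDeriv hα)
    (fun α hα => by
      have := hw.memLp_weakDeriv isOpen_interior hα
      rwa [e] at this)
    (by have := hw.memLp isOpen_interior; rwa [e] at this)
  have hlim' : ∀ α, ∑ i, α i ≤ m → Tendsto (fun l => l2Norm (simplexMeasure b) fun x =>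
      multiDeriv α (φ l) x - weakDeriv (interior (hull T)) α w x) atTop (𝓝 0) := by
    intro α hα
    have h := hlim α hα
    rw [show volume.restrict (hull T) = elementMeasure T from rfl, H.elementMeasure_eq] at h
    exact (tendsto_eLpNorm_ofReal_smul_iff (simplexVol_pos H.indep)
      (fun l => memLp_simplexMeasure b (contDiff_multiDeriv α (hφ l)).continuous 2)
      (H.memLp_iff.1 (hw.memLp_weakDeriv isOpen_interior hα))).1 h
  refine ⟨φ, hφ, ?_, hlim'⟩
  refine (hlim' 0 (by simp)).congr fun l => l2Norm_congr_ae ?_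
  have h0 := H.ae_iff.1 (weakDeriv_zero_ae_eq isOpen_interior
    (hw 0 (by simp)).choose_spec.1.1)
  filter_upwards [h0] with x hx
  rw [hx, multiDeriv_zero]

end

end HDG

end

noncomputable section

namespace HDG

/-! ### Traces on the faces of an element -/

section

variable {n : ℕ} {b : Fin (n + 2) → Pt (n + 1)} {T F : Finset (Pt (n + 1))} {i : Fin (n + 2)}
  {w w' g g' : Pt (n + 1) → ℝ}

theorem IsElement.trace_le (H : IsElement b T) (i : Fin (n + 2)) {φ : Pt (n + 1) → ℝ}
    (hφ : ContDiff ℝ ∞ φ) :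
    l2Norm (simplexMeasure (faceVerts b i)) φ ≤ traceConst n * (l2Norm (simplexMeasure b) φ +
      elementDiam T * ∑ j, l2Norm (simplexMeasure b) (partialDeriv j φ)) := by
  rw [H.elementDiam_eq]
  exact l2Norm_faceVerts_le H.indep i hφ

theorem IsElement.isFaceTrace_iff (H : IsElement b T)
    (hF : (F : Set (Pt (n + 1))) = Set.range (faceVerts b i))
    (hw : MemSobolev (interior (hull T)) 1 w) :
    IsFaceTrace T F w g ↔ MemLp g 2 (simplexMeasure (faceVerts b i)) ∧
      ∃ φ : ℕ → Pt (n + 1) → ℝ, (∀ l, ContDiff ℝ ∞ (φ l)) ∧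
        Tendsto (fun l => l2Norm (simplexMeasure b) fun x => φ l x - w x) atTop (𝓝 0) ∧
        (∀ j, Tendsto (fun l => l2Norm (simplexMeasure b) fun x =>
          partialDeriv j (φ l) x - elementDeriv T j w x) atTop (𝓝 0)) ∧
        Tendsto (fun l => l2Norm (simplexMeasure (faceVerts b i)) fun x => φ l x - g x)
          atTop (𝓝 0) := by
  have hv := simplexVol_pos H.indep
  have hvF := simplexVol_pos (affineIndependent_faceVerts H.indep i)
  rw [IsFaceTrace, faceMeasure_eq hF, H.elementMeasure_eq, memLp_ofReal_smul_iff hvF]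
  refine and_congr_right fun hg => exists_congr fun φ => and_congr_right fun hφ => ?_
  refine and_congr ?_ (and_congr ?_ ?_)
  · exact tendsto_eLpNorm_ofReal_smul_iff hv
      (fun l => memLp_simplexMeasure b (hφ l).continuous 2) (H.memLp hw)
  · exact forall_congr' fun j => tendsto_eLpNorm_ofReal_smul_iff hv
      (fun l => memLp_simplexMeasure b (continuous_partialDeriv (hφ l) j) 2) (H.memLp_deriv hw j)
  · exact tendsto_eLpNorm_ofReal_smul_iff hvF
      (fun l => memLp_simplexMeasure _ (hφ l).continuous 2) hg

theorem IsElement.trace_norm_le (H : IsElement b T)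
    (hF : (F : Set (Pt (n + 1))) = Set.range (faceVerts b i))
    (hw : MemSobolev (interior (hull T)) 1 w) (hg : IsFaceTrace T F w g) :
    l2Norm (simplexMeasure (faceVerts b i)) g ≤ traceConst n * h1Norm b T w := by
  obtain ⟨hgL, φ, hφ, h1, h2, h3⟩ := (H.isFaceTrace_iff hF hw).1 hg
  have t1 := tendsto_l2Norm (fun l => memLp_simplexMeasure b (hφ l).continuous 2) (H.memLp hw) h1
  have t2 := fun j => tendsto_l2Norm
    (fun l => memLp_simplexMeasure b (continuous_partialDeriv (hφ l) j) 2) (H.memLp_deriv hw j)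
    (h2 j)
  have t3 := tendsto_l2Norm (fun l => memLp_simplexMeasure _ (hφ l).continuous 2) hgL h3
  exact le_of_tendsto_of_tendsto' t3 ((t1.add ((tendsto_finsetSum _ fun j _ => t2 j).const_mul
    (elementDiam T))).const_mul (traceConst n)) fun l => H.trace_le i (hφ l)

theorem IsElement.exists_isFaceTrace (H : IsElement b T)
    (hF : (F : Set (Pt (n + 1))) = Set.range (faceVerts b i))
    (hw : MemSobolev (interior (hull T)) 1 w) : ∃ g, IsFaceTrace T F w g := by
  obtain ⟨φ, hφ, h1, h2⟩ := H.exists_smooth_approx hw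
  have h2' : ∀ j, Tendsto (fun l => l2Norm (simplexMeasure b) fun x =>
      partialDeriv j (φ l) x - elementDeriv T j w x) atTop (𝓝 0) := by
    intro j
    refine (h2 (Pi.single j 1) (by simp)).congr fun l => ?_
    rw [multiDeriv_single j (hφ l)]; rfl
  have he := (h1.add ((tendsto_finsetSum Finset.univ fun j _ => h2' j).const_mul
    (elementDiam T))).const_mul (traceConst n)
  simp only [Finset.sum_const_zero, mul_zero, add_zero] at he
  obtain ⟨g, hg, hlim⟩ := exists_l2_limit (μ := simplexMeasure (faceVerts b i))
    (fun l => memLp_simplexMeasure _ (hφ l).continuous 2) he fun p q => by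
    refine (H.trace_le i ((hφ p).sub (hφ q))).trans ?_
    rw [← mul_add]
    refine mul_le_mul_of_nonneg_left ?_ (Real.sqrt_nonneg _)
    have key : ∀ {A B C : Pt (n + 1) → ℝ}, MemLp A 2 (simplexMeasure b) →
        MemLp B 2 (simplexMeasure b) → MemLp C 2 (simplexMeasure b) →
        l2Norm (simplexMeasure b) (fun x => A x - B x) ≤
          l2Norm (simplexMeasure b) (fun x => A x - C x) +
            l2Norm (simplexMeasure b) (fun x => B x - C x) := by
      intro A B C hA hB hC
      have := l2Norm_sub_le (hA.sub hC) (hB.sub hC)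
      refine le_trans (le_of_eq ?_) this
      congr 1; funext x; simp
    have k1 := key (memLp_simplexMeasure b (hφ p).continuous 2)
      (memLp_simplexMeasure b (hφ q).continuous 2) (H.memLp hw)
    have k2 : ∑ j, l2Norm (simplexMeasure b) (partialDeriv j (fun x => φ p x - φ q x)) ≤
        ∑ j, l2Norm (simplexMeasure b) (fun x => partialDeriv j (φ p) x - elementDeriv T j w x) +
        ∑ j, l2Norm (simplexMeasure b)
          (fun x => partialDeriv j (φ q) x - elementDeriv T j w x) := by
      rw [← Finset.sum_add_distrib]
      refine Finset.sum_le_sum fun j _ => ?_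
      have e : partialDeriv j (fun x => φ p x - φ q x) =
          fun x => partialDeriv j (φ p) x - partialDeriv j (φ q) x :=
        partialDeriv_sub (hφ p) (hφ q) j
      rw [e]
      exact key (memLp_simplexMeasure b (continuous_partialDeriv (hφ p) j) 2)
        (memLp_simplexMeasure b (continuous_partialDeriv (hφ q) j) 2) (H.memLp_deriv hw j)
    have k3 := mul_le_mul_of_nonneg_left k2 (elementDiam_nonneg T)
    rw [mul_add] at k3
    linarith
  exact ⟨g, (H.isFaceTrace_iff hF hw).2 ⟨hg, φ, hφ, h1, h2', hlim⟩⟩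

theorem IsElement.isFaceTrace_sub (H : IsElement b T)
    (hF : (F : Set (Pt (n + 1))) = Set.range (faceVerts b i))
    (hw : MemSobolev (interior (hull T)) 1 w) (hw' : MemSobolev (interior (hull T)) 1 w')
    (hg : IsFaceTrace T F w g) (hg' : IsFaceTrace T F w' g') :
    IsFaceTrace T F (fun x => w x - w' x) (fun x => g x - g' x) := by
  obtain ⟨hgL, φ, hφ, h1, h2, h3⟩ := (H.isFaceTrace_iff hF hw).1 hg
  obtain ⟨hgL', φ', hφ', h1', h2', h3'⟩ := (H.isFaceTrace_iff hF hw').1 hg'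
  have key : ∀ {m : ℕ} {a : Fin (m + 1) → Pt (n + 1)} {A B : ℕ → Pt (n + 1) → ℝ}
      {C D : Pt (n + 1) → ℝ}, (∀ l, MemLp (A l) 2 (simplexMeasure a)) →
      (∀ l, MemLp (B l) 2 (simplexMeasure a)) → MemLp C 2 (simplexMeasure a) →
      MemLp D 2 (simplexMeasure a) →
      Tendsto (fun l => l2Norm (simplexMeasure a) fun x => A l x - C x) atTop (𝓝 0) →
      Tendsto (fun l => l2Norm (simplexMeasure a) fun x => B l x - D x) atTop (𝓝 0) →
      Tendsto (fun l => l2Norm (simplexMeasure a) fun x => (A l x - B l x) - (C x - D x))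
        atTop (𝓝 0) := by
    intro m a A B C D hA hB hC hD hAC hBD
    have hs := hAC.add hBD
    rw [add_zero] at hs
    refine squeeze_zero (fun _ => l2Norm_nonneg _ _) (fun l => ?_) hs
    have := l2Norm_sub_le ((hA l).sub hC) ((hB l).sub hD)
    refine le_trans (le_of_eq ?_) this
    congr 1; funext x; simp only [Pi.sub_apply]; ring
  refine (H.isFaceTrace_iff hF (hw.sub hw')).2 ⟨hgL.sub hgL', fun l x => φ l x - φ' l x,
    fun l => (hφ l).sub (hφ' l), ?_, fun j => ?_, ?_⟩
  · exact key (fun l => memLp_simplexMeasure b (hφ l).continuous 2)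
      (fun l => memLp_simplexMeasure b (hφ' l).continuous 2) (H.memLp hw) (H.memLp hw') h1 h1'
  · refine (key (fun l => memLp_simplexMeasure b (continuous_partialDeriv (hφ l) j) 2)
      (fun l => memLp_simplexMeasure b (continuous_partialDeriv (hφ' l) j) 2)
      (H.memLp_deriv hw j) (H.memLp_deriv hw' j) (h2 j) (h2' j)).congr fun l => ?_
    refine l2Norm_congr_ae ?_
    filter_upwards [H.elementDeriv_sub hw hw' j] with x hx
    have e : partialDeriv j (fun x => φ l x - φ' l x) =
        fun x => partialDeriv j (φ l) x - partialDeriv j (φ' l) x :=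
      partialDeriv_sub (hφ l) (hφ' l) j
    rw [hx, e]
  · exact key (fun l => memLp_simplexMeasure _ (hφ l).continuous 2)
      (fun l => memLp_simplexMeasure _ (hφ' l).continuous 2) hgL hgL' h3 h3'

theorem IsElement.isFaceTrace_of_contDiff (H : IsElement b T)
    (hF : (F : Set (Pt (n + 1))) = Set.range (faceVerts b i)) {φ : Pt (n + 1) → ℝ}
    (hφ : ContDiff ℝ ∞ φ) : IsFaceTrace T F φ φ := by
  refine (H.isFaceTrace_iff hF (memSobolev_one_of_contDiff T hφ)).2
    ⟨memLp_simplexMeasure _ hφ.continuous 2, fun _ => φ, fun _ => hφ, ?_, fun j => ?_, ?_⟩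
  · simp [l2Norm]
  · refine tendsto_const_nhds.congr fun l => ?_
    rw [l2Norm_congr_ae (g := fun _ => (0 : ℝ))]
    · simp [l2Norm]
    · filter_upwards [H.elementDeriv_of_contDiff hφ j] with x hx
      rw [hx, sub_self]
  · simp [l2Norm]

theorem IsElement.isFaceTrace_congr (H : IsElement b T)
    (hF : (F : Set (Pt (n + 1))) = Set.range (faceVerts b i))
    (hw : MemSobolev (interior (hull T)) 1 w) (h : w =ᵐ[simplexMeasure b] w')
    (hg : IsFaceTrace T F w g) : IsFaceTrace T F w' g := by
  obtain ⟨hgL, φ, hφ, h1, h2, h3⟩ := (H.isFaceTrace_iff hF hw).1 hg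
  have hw' := hw.congr isOpen_interior (H.ae_iff.2 h)
  refine (H.isFaceTrace_iff hF hw').2 ⟨hgL, φ, hφ, ?_, fun j => ?_, h3⟩
  · refine h1.congr fun l => l2Norm_congr_ae ?_
    filter_upwards [h] with x hx using by rw [hx]
  · refine (h2 j).congr fun l => l2Norm_congr_ae ?_
    filter_upwards [H.elementDeriv_congr hw h j] with x hx using by rw [hx]

theorem IsElement.isFaceTrace_unique (H : IsElement b T)
    (hF : (F : Set (Pt (n + 1))) = Set.range (faceVerts b i))
    (hw : MemSobolev (interior (hull T)) 1 w) (hg : IsFaceTrace T F w g)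
    (hg' : IsFaceTrace T F w g') : g =ᵐ[simplexMeasure (faceVerts b i)] g' := by
  have h0 : h1Norm b T (fun x => w x - w x) = 0 := by
    rw [h1Norm]
    have : ∀ j, l2Norm (simplexMeasure b) (elementDeriv T j fun x => w x - w x) = 0 := by
      intro j
      rw [l2Norm_congr_ae (H.elementDeriv_sub hw hw j)]
      simp [l2Norm]
    simp only [this, Finset.sum_const_zero, mul_zero, add_zero]
    simp [l2Norm]
  have h1 := H.trace_norm_le hF (hw.sub hw) (H.isFaceTrace_sub hF hw hw hg hg')
  rw [h0, mul_zero] at h1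
  have h2 := ae_eq_zero_of_l2Norm_eq_zero
    (((H.isFaceTrace_iff hF hw).1 hg).1.sub ((H.isFaceTrace_iff hF hw).1 hg').1)
    (le_antisymm h1 (l2Norm_nonneg _ _))
  filter_upwards [h2] with x hx
  exact sub_eq_zero.1 hx

theorem IsElement.isFaceTrace_faceTrace (H : IsElement b T)
    (hF : (F : Set (Pt (n + 1))) = Set.range (faceVerts b i))
    (hw : MemSobolev (interior (hull T)) 1 w) : IsFaceTrace T F w (faceTrace T F w) := by
  have h := H.exists_isFaceTrace hF hw
  rw [faceTrace, dif_pos h]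
  exact h.choose_spec

theorem IsElement.memLp_faceTrace (H : IsElement b T)
    (hF : (F : Set (Pt (n + 1))) = Set.range (faceVerts b i))
    (hw : MemSobolev (interior (hull T)) 1 w) :
    MemLp (faceTrace T F w) 2 (simplexMeasure (faceVerts b i)) :=
  ((H.isFaceTrace_iff hF hw).1 (H.isFaceTrace_faceTrace hF hw)).1

theorem IsElement.faceTrace_sub (H : IsElement b T)
    (hF : (F : Set (Pt (n + 1))) = Set.range (faceVerts b i))
    (hw : MemSobolev (interior (hull T)) 1 w) (hw' : MemSobolev (interior (hull T)) 1 w') :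
    faceTrace T F (fun x => w x - w' x) =ᵐ[simplexMeasure (faceVerts b i)]
      fun x => faceTrace T F w x - faceTrace T F w' x :=
  H.isFaceTrace_unique hF (hw.sub hw') (H.isFaceTrace_faceTrace hF (hw.sub hw'))
    (H.isFaceTrace_sub hF hw hw' (H.isFaceTrace_faceTrace hF hw) (H.isFaceTrace_faceTrace hF hw'))

theorem IsElement.faceTrace_of_contDiff (H : IsElement b T)
    (hF : (F : Set (Pt (n + 1))) = Set.range (faceVerts b i)) {φ : Pt (n + 1) → ℝ}
    (hφ : ContDiff ℝ ∞ φ) (h : w =ᵐ[simplexMeasure b] φ) :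
    faceTrace T F w =ᵐ[simplexMeasure (faceVerts b i)] φ := by
  have hs := memSobolev_one_of_contDiff T hφ
  have hw := hs.congr isOpen_interior (H.ae_iff.2 h.symm)
  exact H.isFaceTrace_unique hF hw (H.isFaceTrace_faceTrace hF hw)
    (H.isFaceTrace_congr hF hs h.symm (H.isFaceTrace_of_contDiff hF hφ))

theorem IsElement.l2Norm_faceTrace_le (H : IsElement b T)
    (hF : (F : Set (Pt (n + 1))) = Set.range (faceVerts b i))
    (hw : MemSobolev (interior (hull T)) 1 w) :
    l2Norm (simplexMeasure (faceVerts b i)) (faceTrace T F w) ≤ traceConst n * h1Norm b T w :=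
  H.trace_norm_le hF hw (H.isFaceTrace_faceTrace hF hw)

theorem l2Norm_triangle {μ : Measure (Pt (n + 1))} {f g h : Pt (n + 1) → ℝ} (hf : MemLp f 2 μ)
    (hg : MemLp g 2 μ) (hh : MemLp h 2 μ) :
    l2Norm μ (fun x => f x - h x) ≤
      l2Norm μ (fun x => f x - g x) + l2Norm μ (fun x => g x - h x) := by
  have := l2Norm_add_le (hf.sub hg) (hg.sub hh)
  refine le_trans (le_of_eq ?_) this
  congr 1; funext x; simp

/-- Approximation of Sobolev functions by polynomials. -/
theorem exists_polynomial_approx (n m : ℕ) : ∃ C ≥ (0 : ℝ),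
    ∀ (b : Fin (n + 2) → Pt (n + 1)) (T : Finset (Pt (n + 1))), IsElement b T →
    ∀ w, MemSobolev (interior (hull T)) (m + 1) w → ∀ ε > (0 : ℝ),
      ∃ p : MvPolynomial (Fin (n + 1)) ℝ, p.totalDegree ≤ m ∧
        h1Norm b T (fun x => w x - polyFun p x) ≤
          C * (elementDiam T ^ (m + 1) * ∑ α ∈ Finset.piAntidiag Finset.univ (m + 1),
            l2Norm (simplexMeasure b) (weakDeriv (interior (hull T)) α w)) + ε := by
  obtain ⟨C₀, hC₀, hBH⟩ := bramble_hilbert_smooth (n + 1) (n + 1) m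
  refine ⟨C₀ + ∑ _j : Fin (n + 1), C₀, by positivity, fun b T H w hw ε hε => ?_⟩
  set τ := simplexMeasure b with hτ
  set h := elementDiam T with hh
  have hw1 : MemSobolev (interior (hull T)) 1 w := hw.mono subset_rfl (by lia)
  obtain ⟨φ, hφ, h1, h2⟩ := H.exists_smooth_approx hw
  have h2' : ∀ j, Tendsto (fun l => l2Norm τ fun x =>
      partialDeriv j (φ l) x - elementDeriv T j w x) atTop (𝓝 0) := by
    intro j
    refine (h2 (Pi.single j 1) (by simp)).congr fun l => ?_
    rw [multiDeriv_single j (hφ l)]; rfl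
  have hsm : Tendsto (fun l => derivSum τ (m + 1) (φ l)) atTop
      (𝓝 (∑ α ∈ Finset.piAntidiag Finset.univ (m + 1),
        l2Norm τ (weakDeriv (interior (hull T)) α w))) := by
    refine tendsto_finsetSum _ fun α hα => ?_
    have hα' : ∑ i, α i ≤ m + 1 := (mem_multiIndices.1 hα).le
    exact tendsto_l2Norm
      (fun l => memLp_simplexMeasure b (contDiff_multiDeriv α (hφ l)).continuous 2)
      (H.memLp_iff.1 (hw.memLp_weakDeriv isOpen_interior hα')) (h2 α hα')
  set D := ∑ α ∈ Finset.piAntidiag Finset.univ (m + 1),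
        l2Norm τ (weakDeriv (interior (hull T)) α w) with hD
  set C := C₀ + ∑ _j : Fin (n + 1), C₀ with hC
  have hbig : Tendsto (fun l => (l2Norm τ (fun x => φ l x - w x) + h * ∑ j, l2Norm τ fun x =>
      partialDeriv j (φ l) x - elementDeriv T j w x) +
        C * (h ^ (m + 1) * derivSum τ (m + 1) (φ l))) atTop (𝓝 (0 + C * (h ^ (m + 1) * D))) := by
    refine Tendsto.add ?_ ((hsm.const_mul _).const_mul _)
    have := h1.add ((tendsto_finsetSum Finset.univ fun j _ => h2' j).const_mul h)
    simpa using this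
  obtain ⟨l, hl⟩ := (hbig.eventually (gt_mem_nhds (by linarith :
    0 + C * (h ^ (m + 1) * D) < C * (h ^ (m + 1) * D) + ε))).exists
  obtain ⟨p, hp, hpb⟩ := hBH b (φ l) (hφ l)
  rw [← H.elementDiam_eq, ← hh, ← hτ] at hpb
  refine ⟨p, hp, le_trans ?_ hl.le⟩
  have hps : ContDiff ℝ ∞ (polyFun p) := contDiff_polyFun p
  have hpS := memSobolev_one_of_contDiff T hps
  have hLφ := memLp_simplexMeasure b (hφ l).continuous 2
  have hLp := memLp_simplexMeasure b hps.continuous 2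
  have k0 : l2Norm τ (fun x => w x - polyFun p x) ≤ l2Norm τ (fun x => φ l x - w x) +
      C₀ * (h ^ (m + 1) * derivSum τ (m + 1) (φ l)) := by
    have a1 := l2Norm_triangle (H.memLp hw) hLφ hLp
    have a2 := hpb 0 (by simp)
    rw [multiDeriv_zero] at a2
    simp only [Pi.zero_apply, Finset.sum_const_zero, pow_zero, one_mul] at a2
    rw [l2Norm_sub_comm w (φ l)] at a1
    have a2' : l2Norm τ (fun x => φ l x - polyFun p x) ≤ _ := a2
    linarith
  have k1 : ∀ j, h * l2Norm τ (elementDeriv T j fun x => w x - polyFun p x) ≤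
      h * l2Norm τ (fun x => partialDeriv j (φ l) x - elementDeriv T j w x) +
      C₀ * (h ^ (m + 1) * derivSum τ (m + 1) (φ l)) := by
    intro j
    have e1 : elementDeriv T j (fun x => w x - polyFun p x) =ᵐ[τ]
        fun x => elementDeriv T j w x - partialDeriv j (polyFun p) x := by
      filter_upwards [H.elementDeriv_sub hw1 hpS j, H.elementDeriv_of_contDiff hps j] with x h1 h2
      rw [h1, h2]
    rw [l2Norm_congr_ae e1]
    have a1 := l2Norm_triangle (H.memLp_deriv hw1 j)
      (memLp_simplexMeasure b (continuous_partialDeriv (hφ l) j) 2)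
      (memLp_simplexMeasure b (continuous_partialDeriv hps j) 2)
    have a2 := hpb (Pi.single j 1) (by simp)
    rw [multiDeriv_single j ((hφ l).sub hps)] at a2
    simp only [Finset.sum_pi_single', Finset.mem_univ, if_true, pow_one] at a2
    have e2 : partialDeriv j (fun x => φ l x - polyFun p x) =
        fun x => partialDeriv j (φ l) x - partialDeriv j (polyFun p) x :=
      partialDeriv_sub (hφ l) hps j
    rw [e2] at a2
    rw [l2Norm_sub_comm (elementDeriv T j w) (partialDeriv j (φ l)), ← hτ] at a1
    have a3 := mul_le_mul_of_nonneg_left a1 (elementDiam_nonneg T)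
    rw [mul_add, ← hh] at a3
    linarith
  have k2 := Finset.sum_le_sum fun j (_ : j ∈ Finset.univ) => k1 j
  rw [Finset.sum_add_distrib, ← Finset.mul_sum, ← Finset.mul_sum, ← Finset.sum_mul] at k2
  rw [h1Norm, ← hτ, ← hh, hC, add_mul]
  linarith

end

end HDG

end

noncomputable section

namespace HDG

/-! ### Polynomials on simplices -/

section

variable {m d : ℕ}

theorem polyFun_bind₁ (q : Fin d → MvPolynomial (Fin m) ℝ) (p : MvPolynomial (Fin d) ℝ)
    (x : Pt m) :
    polyFun (MvPolynomial.bind₁ q p) x = polyFun p (WithLp.toLp 2 fun l => polyFun (q l) x) := by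
  simp only [polyFun]
  rw [MvPolynomial.eval, MvPolynomial.eval₂Hom_bind₁]
  rfl

theorem totalDegree_bind₁_le {q : Fin d → MvPolynomial (Fin m) ℝ}
    (hq : ∀ l, (q l).totalDegree ≤ 1) (p : MvPolynomial (Fin d) ℝ) :
    (MvPolynomial.bind₁ q p).totalDegree ≤ p.totalDegree := by
  rw [MvPolynomial.bind₁, MvPolynomial.aeval_def, MvPolynomial.eval₂_eq']
  refine (MvPolynomial.totalDegree_finset_sum _ _).trans (Finset.sup_le fun s hs => ?_)
  refine (MvPolynomial.totalDegree_mul _ _).trans ?_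
  rw [MvPolynomial.algebraMap_eq, MvPolynomial.totalDegree_C, zero_add]
  refine (MvPolynomial.totalDegree_finset_prod _ _).trans ?_
  have h1 := MvPolynomial.le_totalDegree hs
  rw [Finsupp.sum_fintype _ _ fun _ => rfl] at h1
  refine le_trans (Finset.sum_le_sum fun l _ => ?_) h1
  refine (MvPolynomial.totalDegree_pow _ _).trans ?_
  calc s l * (q l).totalDegree ≤ s l * 1 := Nat.mul_le_mul_left _ (hq l)
    _ = s l := mul_one _

/-- The affine polynomial `c + ∑ g_l x_l`. -/
def affinePoly (c : ℝ) (g : Fin m → ℝ) : MvPolynomial (Fin m) ℝ :=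
  MvPolynomial.C c + ∑ l, MvPolynomial.C (g l) * MvPolynomial.X l

theorem polyFun_affinePoly (c : ℝ) (g : Fin m → ℝ) (x : Pt m) :
    polyFun (affinePoly c g) x = c + ∑ l, g l * x l := by
  simp [affinePoly, polyFun_add, polyFun_sum, polyFun_mul]

theorem totalDegree_affinePoly_le (c : ℝ) (g : Fin m → ℝ) :
    (affinePoly c g).totalDegree ≤ 1 := by
  refine (MvPolynomial.totalDegree_add _ _).trans (max_le (by simp) ?_)
  refine (MvPolynomial.totalDegree_finset_sum _ _).trans (Finset.sup_le fun l _ => ?_)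
  refine (MvPolynomial.totalDegree_mul _ _).trans ?_
  simp

theorem exists_polynomial_comp_simplexMap (a : Fin (m + 1) → Pt d) (p : MvPolynomial (Fin d) ℝ) :
    ∃ q : MvPolynomial (Fin m) ℝ, q.totalDegree ≤ p.totalDegree ∧
      ∀ x, polyFun q x = polyFun p (simplexMap a x) := by
  refine ⟨MvPolynomial.bind₁ (fun l => affinePoly (a 0 l) fun i => a i.succ l - a 0 l) p,
    totalDegree_bind₁_le (fun l => totalDegree_affinePoly_le _ _) p, fun x => ?_⟩
  rw [polyFun_bind₁]
  congr 1
  ext l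
  simp [polyFun_affinePoly, simplexMap, mul_comm]

theorem continuous_polyFun (p : MvPolynomial (Fin d) ℝ) : Continuous (polyFun p) :=
  (contDiff_polyFun p).continuous

theorem eq_zero_of_polyFun_box {p : MvPolynomial (Fin m) ℝ}
    (h : ∀ x : Pt m, (∀ i, x i ∈ Set.Ioo (0 : ℝ) (1 / (m + 1))) → polyFun p x = 0) : p = 0 := by
  refine MvPolynomial.funext_set (fun _ => Set.Ioo (0 : ℝ) (1 / (m + 1)))
    (fun _ => Set.Ioo_infinite (by positivity)) fun x hx => ?_
  rw [map_zero]
  exact h (WithLp.toLp 2 x) fun i => hx i (Set.mem_univ i)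

theorem integrable_refMeasure {f : Pt m → ℝ} (hf : Continuous f) : Integrable f (refMeasure m) := by
  obtain ⟨C, hC⟩ := isCompact_refSimplex.exists_bound_of_continuousOn
    (hf.continuousOn (s := refSimplex m))
  exact Integrable.of_bound hf.aestronglyMeasurable C (ae_mem_refSimplex.mono hC)

theorem eq_zero_on_box_of_integral_eq_zero {f : Pt m → ℝ} (hf : Continuous f)
    (h0 : ∀ x ∈ refSimplex m, 0 ≤ f x) (h : ∫ x, f x ∂refMeasure m = 0) {x : Pt m}
    (hx : ∀ i, x i ∈ Set.Ioo (0 : ℝ) (1 / (m + 1))) : f x = 0 := by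
  have h1 := (integral_eq_zero_iff_of_nonneg_ae (ae_mem_refSimplex.mono h0)
    (integrable_refMeasure hf)).1 h
  have h2 : f =ᵐ[volume.restrict (refSimplex m)] 0 := by
    have hne : (volume (refSimplex m))⁻¹ ≠ 0 := ENNReal.inv_ne_zero.2 volume_refSimplex_ne_top
    rw [EventuallyEq, MeasureTheory.ae_iff, refMeasure, Measure.smul_apply, smul_eq_mul,
      mul_eq_zero] at h1
    exact h1.resolve_left hne
  have h3 := ae_restrict_of_ae_restrict_of_subset box_subset_refSimplex h2
  exact Measure.eqOn_open_of_ae_eq (μ := volume) h3 isOpen_box hf.continuousOn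
    continuous_const.continuousOn hx

/-- The polynomials of degree at most `k`. -/
abbrev PolyLE (d k : ℕ) : Type := MvPolynomial.restrictTotalDegree (Fin d) ℝ k

theorem PolyLE.degree_le {k : ℕ} (p : PolyLE d k) : (p : MvPolynomial (Fin d) ℝ).totalDegree ≤ k :=
  (MvPolynomial.mem_restrictTotalDegree _ _ _).1 p.2

/-- A polynomial is bounded by its weighted `L²`-norm on the reference simplex. -/
theorem exists_sup_bound_refSimplex (k : ℕ) {W : Pt m → ℝ} (hWc : Continuous W)
    (hW0 : ∀ x ∈ refSimplex m, 0 ≤ W x)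
    (hWpos : ∀ x : Pt m, (∀ i, x i ∈ Set.Ioo (0 : ℝ) (1 / (m + 1))) → 0 < W x) :
    ∃ C ≥ (0 : ℝ), ∀ p : MvPolynomial (Fin m) ℝ, p.totalDegree ≤ k → ∀ x ∈ refSimplex m,
      |polyFun p x| ≤ C * Real.sqrt (∫ y, W y * polyFun p y ^ 2 ∂refMeasure m) := by
  have hint : ∀ p q : MvPolynomial (Fin m) ℝ,
      Integrable (fun y => W y * (polyFun p y * polyFun q y)) (refMeasure m) := fun p q =>
    integrable_refMeasure (hWc.mul ((continuous_polyFun p).mul (continuous_polyFun q)))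
  let B : PolyLE m k →ₗ[ℝ] PolyLE m k →ₗ[ℝ] ℝ := LinearMap.mk₂ ℝ
    (fun p q => ∫ y, W y * (polyFun p.1 y * polyFun q.1 y) ∂refMeasure m)
    (fun p p' q => by
      rw [← integral_add (hint _ _) (hint _ _)]
      congr 1; funext y; simp only [Submodule.coe_add, polyFun_add]; ring)
    (fun c p q => by
      rw [smul_eq_mul, ← integral_const_mul]
      congr 1; funext y; simp only [Submodule.coe_smul, polyFun_smul]; ring)
    (fun p q q' => by
      rw [← integral_add (hint _ _) (hint _ _)]
      congr 1; funext y; simp only [Submodule.coe_add, polyFun_add]; ring)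
    (fun c p q => by
      rw [smul_eq_mul, ← integral_const_mul]
      congr 1; funext y; simp only [Submodule.coe_smul, polyFun_smul]; ring)
  have hB : ∀ p q, B p q = ∫ y, W y * (polyFun p.1 y * polyFun q.1 y) ∂refMeasure m :=
    fun p q => rfl
  have hnn : ∀ p, 0 ≤ B p p := fun p => by
    rw [hB]
    refine integral_nonneg_of_ae (ae_mem_refSimplex.mono fun y hy => ?_)
    exact mul_nonneg (hW0 y hy) (mul_self_nonneg _)
  have hpos : ∀ p, B p p = 0 → p = 0 := by
    intro p hp
    rw [hB] at hp
    refine Subtype.ext (eq_zero_of_polyFun_box fun x hx => ?_)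
    have h := eq_zero_on_box_of_integral_eq_zero
      (hWc.mul ((continuous_polyFun p.1).mul (continuous_polyFun p.1)))
      (fun y hy => mul_nonneg (hW0 y hy) (mul_self_nonneg _)) hp hx
    exact mul_self_eq_zero.1 ((mul_eq_zero.1 h).resolve_left (hWpos x hx).ne')
  let e := Module.finBasis ℝ (PolyLE m k)
  have hC : ∀ i, ∃ C : ℝ, 0 ≤ C ∧ ∀ v, |e.coord i v| ≤ C * Real.sqrt (B v v) := fun i =>
    exists_bound_of_posDef B
      (fun v w => by rw [hB, hB]; congr 1; funext y; ring) hnn (e.coord i)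
      fun v hv => by rw [hpos v hv, map_zero]
  choose C hC0 hC using hC
  have hM : ∀ i, ∃ M : ℝ, ∀ x ∈ refSimplex m, ‖polyFun (e i).1 x‖ ≤ M := fun i =>
    isCompact_refSimplex.exists_bound_of_continuousOn (continuous_polyFun (e i).1).continuousOn
  choose M hM using hM
  refine ⟨∑ i, C i * |M i|,
    Finset.sum_nonneg fun i _ => mul_nonneg (hC0 i) (abs_nonneg _), fun p hp x hx => ?_⟩
  set v : PolyLE m k := ⟨p, (MvPolynomial.mem_restrictTotalDegree _ _ _).2 hp⟩ with hv
  have hsum : polyFun p x = ∑ i, e.coord i v * polyFun (e i).1 x := by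
    have h1 : p = ∑ i, e.coord i v • (e i).1 := by
      have := congrArg Subtype.val (e.sum_repr v)
      rw [Submodule.coe_sum] at this
      exact this.symm
    conv_lhs => rw [h1]
    rw [polyFun_sum]
    exact Finset.sum_congr rfl fun i _ => polyFun_smul _ _ _
  have hBv : B v v = ∫ y, W y * polyFun p y ^ 2 ∂refMeasure m := by
    rw [hB]; congr 1; funext y; rw [sq]
  rw [hsum, ← hBv, Finset.sum_mul]
  refine (Finset.abs_sum_le_sum_abs _ _).trans (Finset.sum_le_sum fun i _ => ?_)
  rw [abs_mul]
  calc |e.coord i v| * |polyFun (e i).1 x| ≤ (C i * Real.sqrt (B v v)) * |M i| :=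
        mul_le_mul (hC i v) ((hM i x hx).trans (le_abs_self _)) (abs_nonneg _)
          (mul_nonneg (hC0 i) (Real.sqrt_nonneg _))
    _ = _ := by ring

theorem exists_weighted_sup_bound (k : ℕ) {W : Pt m → ℝ} (hWc : Continuous W)
    (hW0 : ∀ x ∈ refSimplex m, 0 ≤ W x)
    (hWpos : ∀ x : Pt m, (∀ i, x i ∈ Set.Ioo (0 : ℝ) (1 / (m + 1))) → 0 < W x) :
    ∃ C ≥ (0 : ℝ), ∀ (d : ℕ) (a : Fin (m + 1) → Pt d) (p : MvPolynomial (Fin d) ℝ),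
      p.totalDegree ≤ k → ∀ x ∈ convexHull ℝ (Set.range a), |polyFun p x| ≤
        C * Real.sqrt (∫ y, W y * polyFun p (simplexMap a y) ^ 2 ∂refMeasure m) := by
  obtain ⟨C, hC, h⟩ := exists_sup_bound_refSimplex k hWc hW0 hWpos
  refine ⟨C, hC, fun d a p hp x hx => ?_⟩
  rw [← simplexMap_image] at hx
  obtain ⟨y, hy, rfl⟩ := hx
  obtain ⟨q, hq, hqp⟩ := exists_polynomial_comp_simplexMap a p
  have := h q (hq.trans hp) y hy
  simpa only [hqp] using this

theorem integral_simplexMeasure (a : Fin (m + 1) → Pt d) {f : Pt d → ℝ} (hf : Continuous f) :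
    ∫ x, f x ∂simplexMeasure a = ∫ y, f (simplexMap a y) ∂refMeasure m :=
  integral_map (continuous_simplexMap a).aemeasurable hf.aestronglyMeasurable

theorem exists_sup_bound (m k : ℕ) :
    ∃ C ≥ (0 : ℝ), ∀ (d : ℕ) (a : Fin (m + 1) → Pt d) (p : MvPolynomial (Fin d) ℝ),
      p.totalDegree ≤ k → ∀ x ∈ convexHull ℝ (Set.range a),
        |polyFun p x| ≤ C * l2Norm (simplexMeasure a) (polyFun p) := by
  obtain ⟨C, hC, h⟩ := exists_weighted_sup_bound (m := m) k (W := fun _ => 1) continuous_const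
    (fun _ _ => zero_le_one) fun _ _ => zero_lt_one
  refine ⟨C, hC, fun d a p hp x hx => (h d a p hp x hx).trans_eq ?_⟩
  rw [l2Norm, integral_simplexMeasure a (f := fun x => polyFun p x ^ 2)
    ((continuous_polyFun p).pow 2)]
  simp

/-- The barycentric coordinates on the reference simplex. -/
def refBary (i : Fin (m + 1)) (x : Pt m) : ℝ := Fin.cases (1 - ∑ l, x l) (fun l => x l) i

theorem continuous_refBary (i : Fin (m + 1)) : Continuous (refBary (m := m) i) := by
  refine Fin.cases ?_ (fun l => ?_) i
  · show Continuous fun x : Pt m => 1 - ∑ l, x l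
    fun_prop
  · show Continuous fun x : Pt m => x l
    fun_prop

theorem refBary_nonneg (i : Fin (m + 1)) {x : Pt m} (hx : x ∈ refSimplex m) : 0 ≤ refBary i x := by
  refine Fin.cases ?_ (fun l => ?_) i
  · exact sub_nonneg.2 hx.2
  · exact hx.1 l

theorem refBary_pos (i : Fin (m + 1)) {x : Pt m}
    (hx : ∀ i, x i ∈ Set.Ioo (0 : ℝ) (1 / (m + 1))) : 0 < refBary i x := by
  refine Fin.cases ?_ (fun l => (hx l).1) i
  refine sub_pos.2 ?_
  calc ∑ i, x i ≤ ∑ _i : Fin m, (1 / ((m : ℝ) + 1)) := Finset.sum_le_sum fun i _ => (hx i).2.le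
    _ = m / (m + 1) := by simp; ring
    _ < 1 := by rw [div_lt_one (by positivity)]; linarith

theorem exists_bary_sup_bound (m k : ℕ) :
    ∃ C ≥ (0 : ℝ), ∀ (i j : Fin (m + 1)) (d : ℕ) (a : Fin (m + 1) → Pt d)
      (p : MvPolynomial (Fin d) ℝ), p.totalDegree ≤ k → ∀ x ∈ convexHull ℝ (Set.range a),
        |polyFun p x| ≤ C * Real.sqrt (∫ y, refBary i y * refBary j y *
          polyFun p (simplexMap a y) ^ 2 ∂refMeasure m) := by
  have h := fun i j : Fin (m + 1) => exists_weighted_sup_bound (m := m) k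
    (W := fun y => refBary i y * refBary j y)
    ((continuous_refBary i).mul (continuous_refBary j))
    (fun x hx => mul_nonneg (refBary_nonneg i hx) (refBary_nonneg j hx))
    (fun x hx => mul_pos (refBary_pos i hx) (refBary_pos j hx))
  choose C hC h using h
  refine ⟨∑ i, ∑ j, C i j, Finset.sum_nonneg fun i _ => Finset.sum_nonneg fun j _ => hC i j,
    fun i j d a p hp x hx => (h i j d a p hp x hx).trans ?_⟩
  refine mul_le_mul_of_nonneg_right ?_ (Real.sqrt_nonneg _)
  exact (Finset.single_le_sum (f := fun j => C i j) (fun j _ => hC i j) (Finset.mem_univ j)).trans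
    (Finset.single_le_sum (f := fun i => ∑ j, C i j)
      (fun i _ => Finset.sum_nonneg fun j _ => hC i j) (Finset.mem_univ i))

end

end HDG

end

noncomputable section

namespace HDG

/-! ### Barycentric coordinates -/

section

variable {n : ℕ} {B : AffineBasis (Fin (n + 2)) ℝ (Pt (n + 1))}
  {b : Fin (n + 2) → Pt (n + 1)} {T F : Finset (Pt (n + 1))} {i : Fin (n + 2)}

/-- The vertices of an element form an affine basis. -/
theorem IsElement.exists_basis (H : IsElement b T) :
    ∃ B : AffineBasis (Fin (n + 2)) ℝ (Pt (n + 1)), ⇑B = b := by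
  have hspan : affineSpan ℝ (Set.range b) = ⊤ := by
    rw [H.indep.affineSpan_eq_top_iff_card_eq_finrank_add_one]
    simp
  exact ⟨⟨b, H.indep, hspan⟩, rfl⟩

/-- The gradient of the barycentric coordinate `λ_i`. -/
def baryGrad (B : AffineBasis (Fin (n + 2)) ℝ (Pt (n + 1))) (i : Fin (n + 2)) :
    Fin (n + 1) → ℝ :=
  fun l => (B.coord i).linear (EuclideanSpace.single l 1)

theorem coord_linear_apply (i : Fin (n + 2)) (v : Pt (n + 1)) :
    (B.coord i).linear v = ∑ l, baryGrad B i l * v l := by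
  have hv : v = ∑ l, v l • EuclideanSpace.single l (1 : ℝ) := by
    ext l; simp [Finset.sum_apply, Pi.single_apply]
  conv_lhs => rw [hv]
  rw [map_sum]
  refine Finset.sum_congr rfl fun l _ => ?_
  rw [map_smul, smul_eq_mul, mul_comm]; rfl

theorem coord_sub_coord (i : Fin (n + 2)) (x y : Pt (n + 1)) :
    B.coord i x - B.coord i y = ∑ l, baryGrad B i l * (x l - y l) := by
  have h := (B.coord i).linearMap_vsub x y
  rw [vsub_eq_sub, vsub_eq_sub, coord_linear_apply] at h
  simpa using h.symm

theorem coord_eq (i : Fin (n + 2)) (x : Pt (n + 1)) :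
    B.coord i x = B.coord i 0 + ∑ l, baryGrad B i l * x l := by
  have := coord_sub_coord (B := B) i x 0
  simp only [PiLp.zero_apply, sub_zero] at this
  linarith

/-- The barycentric coordinate `λ_i` as a polynomial. -/
def baryPoly (B : AffineBasis (Fin (n + 2)) ℝ (Pt (n + 1))) (i : Fin (n + 2)) :
    MvPolynomial (Fin (n + 1)) ℝ :=
  affinePoly (B.coord i 0) (baryGrad B i)

theorem polyFun_baryPoly (i : Fin (n + 2)) (x : Pt (n + 1)) :
    polyFun (baryPoly B i) x = B.coord i x := by
  rw [baryPoly, polyFun_affinePoly, ← coord_eq]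

theorem sum_baryGrad (l : Fin (n + 1)) : ∑ i, baryGrad B i l = 0 := by
  have h1 := B.sum_coord_apply_eq_one (EuclideanSpace.single l 1)
  have h0 := B.sum_coord_apply_eq_one 0
  have h2 : ∀ i, B.coord i (EuclideanSpace.single l 1) = B.coord i 0 + baryGrad B i l := by
    intro i
    rw [coord_eq]
    simp [Pi.single_apply]
  simp only [h2, Finset.sum_add_distrib, h0] at h1
  linarith

theorem sum_baryGrad_smul (v : Pt (n + 1)) (m : Fin (n + 1)) :
    ∑ i, (∑ l, baryGrad B i l * v l) * B i m = v m := by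
  have h1 := B.linear_combination_coord_eq_self v
  have h0 := B.linear_combination_coord_eq_self 0
  have h2 := congrArg (fun z : Pt (n + 1) => z m) h1
  have h3 := congrArg (fun z : Pt (n + 1) => z m) h0
  simp only [WithLp.ofLp_sum, Finset.sum_apply, PiLp.smul_apply, smul_eq_mul, PiLp.zero_apply] at h2 h3
  simp only [coord_eq (B := B) _ v, add_mul, Finset.sum_add_distrib, h3] at h2
  linarith

theorem coord_simplexMap (i : Fin (n + 2)) (y : Pt (n + 1)) :
    B.coord i (simplexMap B y) = refBary i y := by
  have h0 : ∀ j, B.coord i (B j) - B.coord i (B 0) = ∑ l, baryGrad B i l * (B j l - B 0 l) :=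
    fun j => coord_sub_coord i _ _
  have h1 := coord_sub_coord (B := B) i (simplexMap B y) (B 0)
  have h2 : ∑ l, baryGrad B i l * (simplexMap B y l - B 0 l) =
      ∑ j : Fin (n + 1), y j * (B.coord i (B j.succ) - B.coord i (B 0)) := by
    simp only [h0, Finset.mul_sum]
    rw [Finset.sum_comm]
    refine Finset.sum_congr rfl fun l _ => ?_
    simp only [simplexMap, PiLp.add_apply, add_sub_cancel_left, WithLp.ofLp_sum,
      Finset.sum_apply, PiLp.smul_apply,
      PiLp.sub_apply, smul_eq_mul, Finset.mul_sum]
    exact Finset.sum_congr rfl fun j _ => by ring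
  rw [h2] at h1
  cases i using Fin.cases with
  | zero =>
    simp only [AffineBasis.coord_apply_eq, Fin.succ_ne_zero, ne_eq, not_false_eq_true,
      B.coord_apply_ne (Fin.succ_ne_zero _).symm, zero_sub, mul_neg, mul_one,
      Finset.sum_neg_distrib] at h1
    show _ = 1 - ∑ l, y l
    linarith
  | succ l =>
    simp only [B.coord_apply_ne (Fin.succ_ne_zero l), sub_zero, AffineBasis.coord_apply,
      Fin.succ_inj, mul_ite, mul_one, mul_zero, Finset.sum_ite_eq, Finset.mem_univ, if_true] at h1
    exact h1

theorem coord_nonneg {x : Pt (n + 1)} (hx : x ∈ convexHull ℝ (Set.range B)) (i : Fin (n + 2)) :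
    0 ≤ B.coord i x := by
  rw [B.convexHull_eq_nonneg_coord] at hx
  exact hx i

theorem coord_le_one {x : Pt (n + 1)} (hx : x ∈ convexHull ℝ (Set.range B)) (i : Fin (n + 2)) :
    B.coord i x ≤ 1 := by
  rw [← B.sum_coord_apply_eq_one x]
  exact Finset.single_le_sum (f := fun i => B.coord i x) (fun j _ => coord_nonneg hx j)
    (Finset.mem_univ i)

theorem coord_faceVerts (i : Fin (n + 2)) {x : Pt (n + 1)}
    (hx : x ∈ convexHull ℝ (Set.range (faceVerts B i))) : B.coord i x = 0 := by
  have hsub : convexHull ℝ (Set.range (faceVerts B i)) ⊆ {x | B.coord i x = 0} := by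
    refine convexHull_min ?_ ?_
    · rintro _ ⟨j, rfl⟩
      simp [faceVerts, AffineBasis.coord_apply, (Fin.succAbove_ne i j).symm]
    · exact (convex_singleton (0 : ℝ)).affine_preimage (B.coord i)
  exact hsub hx

/-- The affine projection along an edge onto the face opposite to the vertex `i`. -/
theorem sub_coord_smul_mem_face {i j : Fin (n + 2)} (hij : j ≠ i) {x : Pt (n + 1)}
    (hx : x ∈ convexHull ℝ (Set.range B)) :
    x - B.coord i x • (B i - B j) ∈ convexHull ℝ (Set.range (faceVerts B i)) := by
  have hw := B.linear_combination_coord_eq_self x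
  set w : Fin (n + 2) → ℝ := fun m => if m = i then 0 else
    B.coord m x + if m = j then B.coord i x else 0 with hwdef
  have e1 : ∀ f : Fin (n + 2) → Pt (n + 1), ∑ m, w m • f m =
      ∑ m, B.coord m x • f m - B.coord i x • (f i - f j) := by
    intro f
    have e2 : ∀ m, w m • f m = B.coord m x • f m - (if m = i then B.coord i x • f i else 0) +
        if m = j then B.coord i x • f j else 0 := by
      intro m
      simp only [hwdef]
      by_cases hm : m = i
      · subst hm; simp [hij.symm]
      · by_cases hm' : m = j
        · subst hm'; simp [hij, add_smul]
        · simp [hm, hm']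
    simp only [e2, Finset.sum_add_distrib, Finset.sum_sub_distrib]
    simp [smul_sub]; abel
  have hw0 : ∀ m, 0 ≤ w m := by
    intro m
    simp only [hwdef]
    split_ifs
    · exact le_rfl
    · exact add_nonneg (coord_nonneg hx m) (coord_nonneg hx i)
    · simpa using coord_nonneg hx m
  have hw1 : ∑ m, w m = 1 := by
    have e2 : ∀ m, w m = B.coord m x - (if m = i then B.coord i x else 0) +
        if m = j then B.coord i x else 0 := by
      intro m
      simp only [hwdef]
      by_cases hm : m = i
      · subst hm; simp [hij.symm]
      · simp [hm]
    simp only [e2, Finset.sum_add_distrib, Finset.sum_sub_distrib, B.sum_coord_apply_eq_one]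
    simp
  have hwi : w i = 0 := by simp [hwdef]
  have e3 := e1 B
  rw [hw] at e3
  rw [← e3, Fin.sum_univ_succAbove _ i, hwi, zero_smul, zero_add]
  rw [Fin.sum_univ_succAbove _ i, hwi, zero_add] at hw1
  exact (convex_convexHull ℝ _).sum_mem (fun m _ => hw0 _) hw1
    fun m _ => subset_convexHull ℝ _ ⟨m, rfl⟩

theorem abs_baryGrad_le {c : Pt (n + 1)} {δ : ℝ} (hδ : 0 < δ)
    (hball : Metric.closedBall c (δ / 2) ⊆ convexHull ℝ (Set.range B)) (i : Fin (n + 2))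
    (l : Fin (n + 1)) : |baryGrad B i l| ≤ 1 / δ := by
  have hmem : ∀ s : ℝ, |s| ≤ δ / 2 →
      c + s • EuclideanSpace.single l (1 : ℝ) ∈ convexHull ℝ (Set.range B) := by
    intro s hs
    refine hball ?_
    rw [Metric.mem_closedBall, dist_eq_norm, add_sub_cancel_left, norm_smul]
    simpa using hs
  have h1 := hmem (δ / 2) (abs_of_pos (half_pos hδ)).le
  have h2 := hmem (-(δ / 2)) (by rw [abs_neg, abs_of_pos (half_pos hδ)])
  have h3 := coord_sub_coord (B := B) i (c + (δ / 2) • EuclideanSpace.single l (1 : ℝ))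
    (c + (-(δ / 2)) • EuclideanSpace.single l (1 : ℝ))
  have h4 : ∑ m, baryGrad B i m * ((c + (δ / 2) • EuclideanSpace.single l (1 : ℝ)) m -
      (c + (-(δ / 2)) • EuclideanSpace.single l (1 : ℝ)) m) = baryGrad B i l * δ := by
    rw [Finset.sum_eq_single l]
    · simp
    · intro m _ hm; simp [hm]
    · simp
  rw [h4] at h3
  rw [le_div_iff₀ hδ, ← abs_of_pos hδ, ← abs_mul, ← h3, abs_le]
  constructor <;> linarith [coord_nonneg h1 i, coord_nonneg h2 i, coord_le_one h1 i,
    coord_le_one h2 i]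

theorem IsElement.elementDiam_pos (H : IsElement b T) : 0 < elementDiam T := by
  rw [H.elementDiam_eq]
  have h : b 0 ≠ b 1 := fun h => by
    have := H.indep.injective h
    simp at this
  refine lt_of_lt_of_le (norm_pos_iff.2 (sub_ne_zero.2 h)) (dist_le_diam_convexHull b ?_ ?_)
  · exact subset_convexHull ℝ _ ⟨0, rfl⟩
  · exact subset_convexHull ℝ _ ⟨1, rfl⟩

theorem IsElement.exists_ball (H : IsElement b T) {σ : ℝ}
    (hσ : elementDiam T ≤ σ * inscribedDiam T) :
    0 < σ ∧ ∃ (c : Pt (n + 1)) (δ : ℝ), 0 < δ ∧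
      Metric.closedBall c (δ / 2) ⊆ convexHull ℝ (Set.range b) ∧ elementDiam T ≤ 2 * σ * δ := by
  have hpos := H.elementDiam_pos
  have h0 : 0 ≤ inscribedDiam T := Real.sSup_nonneg fun δ hδ => hδ.1
  have hρ : 0 < inscribedDiam T := by
    refine lt_of_le_of_ne h0 fun h => ?_
    rw [← h, mul_zero] at hσ
    linarith
  have hσ0 : 0 < σ := by
    by_contra hcon
    push Not at hcon
    nlinarith
  refine ⟨hσ0, ?_⟩
  have hne : {δ : ℝ | 0 ≤ δ ∧ ∃ c : Pt (n + 1), Metric.closedBall c (δ / 2) ⊆ hull T}.Nonempty := by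
    by_contra hcon
    rw [Set.not_nonempty_iff_eq_empty] at hcon
    rw [inscribedDiam, hcon, Real.sSup_empty] at hρ
    exact lt_irrefl _ hρ
  obtain ⟨δ, ⟨-, c, hc⟩, hlt⟩ := exists_lt_of_lt_csSup hne (half_lt_self hρ)
  rw [H.hull_eq] at hc
  have hρδ : inscribedDiam T / 2 < δ := hlt
  refine ⟨c, δ, by linarith, hc, hσ.trans ?_⟩
  nlinarith

end

end HDG

end

noncomputable section

namespace HDG

/-! ### Normals, volumes and faces -/

section

variable {n : ℕ} {B : AffineBasis (Fin (n + 2)) ℝ (Pt (n + 1))}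
  {b : Fin (n + 2) → Pt (n + 1)} {T F : Finset (Pt (n + 1))} {i : Fin (n + 2)}

theorem abs_outwardNormal_le (T F : Finset (Pt (n + 1))) (l : Fin (n + 1)) :
    |outwardNormal T F l| ≤ 1 := by
  refine (PiLp.norm_apply_le (outwardNormal T F) l).trans ?_
  simp only [outwardNormal]
  rw [norm_smul, norm_inv, norm_norm]
  exact inv_mul_le_one

theorem coord_centroid (S : Finset (Pt (n + 1))) (hS : S.Nonempty) (i : Fin (n + 2)) :
    B.coord i (S.centroid ℝ id) = (S.card : ℝ)⁻¹ * ∑ x ∈ S, B.coord i x := by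
  have hw : ∑ x ∈ S, S.centroidWeights ℝ x = 1 := S.sum_centroidWeights_eq_one_of_nonempty ℝ hS
  rw [Finset.centroid_def, Finset.map_affineCombination _ _ _ hw,
    Finset.affineCombination_eq_linear_combination _ _ _ hw, Finset.mul_sum]
  simp

theorem exists_outwardNormal_eq (hB : IsElement B T)
    (hF : (F : Set (Pt (n + 1))) = Set.range (faceVerts B i)) :
    ∃ γ : ℝ, γ ≠ 0 ∧ ∀ l, outwardNormal T F l = γ * baryGrad B i l := by
  set K := vectorSpan ℝ (F : Set (Pt (n + 1))) with hK
  set c := F.centroid ℝ id - T.centroid ℝ id with hc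
  set w : Pt (n + 1) := Kᗮ.starProjection c with hw
  have hin : ∀ x y : Pt (n + 1), inner ℝ x y = ∑ l, x l * y l := fun x y => by
    simp [PiLp.inner_apply, mul_comm]
  set g : Pt (n + 1) := WithLp.toLp 2 (baryGrad B i) with hg
  have hgin : ∀ x y, inner ℝ (x - y) g = B.coord i x - B.coord i y := by
    intro x y
    rw [hin, coord_sub_coord]
    exact Finset.sum_congr rfl fun l _ => by simp [hg, mul_comm]
  have hFmem : ∀ x ∈ F, B.coord i x = 0 := fun x hx => coord_faceVerts i
    (subset_convexHull ℝ _ (hF ▸ Finset.mem_coe.2 hx))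
  have hgK : g ∈ Kᗮ := by
    rw [Submodule.mem_orthogonal]
    intro u hu
    rw [hK, vectorSpan_def] at hu
    induction hu using Submodule.span_induction with
    | mem u hu =>
      obtain ⟨x, hx, y, hy, rfl⟩ := hu
      show inner ℝ (x - y) g = 0
      rw [hgin, hFmem x hx, hFmem y hy, sub_zero]
    | zero => simp
    | add u v _ _ hu hv => rw [inner_add_left, hu, hv, add_zero]
    | smul a u _ hu => rw [inner_smul_left, hu, mul_zero]
  have hwK : w ∈ Kᗮ := Submodule.starProjection_apply_mem _ _
  have hTne : T.Nonempty := by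
    rw [← Finset.coe_nonempty, hB.coe_eq]; exact Set.range_nonempty _
  have hFne : F.Nonempty := by
    rw [← Finset.coe_nonempty, hF]; exact Set.range_nonempty _
  have hcg : inner ℝ c g ≠ 0 := by
    rw [hc, hgin, coord_centroid F hFne, Finset.sum_eq_zero hFmem, mul_zero, zero_sub, neg_ne_zero,
      coord_centroid T hTne]
    refine mul_ne_zero (inv_ne_zero (Nat.cast_ne_zero.2 (Finset.card_ne_zero.2 hTne))) ?_
    have hTc : ∀ x ∈ T, 0 ≤ B.coord i x := fun x hx => coord_nonneg
      (subset_convexHull ℝ _ (hB.coe_eq ▸ Finset.mem_coe.2 hx)) i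
    have hi : B i ∈ T := by
      rw [← Finset.mem_coe, hB.coe_eq]; exact ⟨i, rfl⟩
    refine (lt_of_lt_of_le ?_ (Finset.single_le_sum hTc hi)).ne'
    simp
  have hwg : inner ℝ w g = inner ℝ c g := by
    have h1 : inner ℝ (c - w) g = 0 := by
      have := Submodule.starProjection_inner_eq_zero (K := Kᗮ) c g hgK
      exact this
    rw [inner_sub_left] at h1
    linarith
  have hw0 : w ≠ 0 := fun h => hcg (by rw [← hwg, h, inner_zero_left])
  obtain ⟨j, hj⟩ := exists_ne i
  have hwB : ∀ m, m ≠ i → inner ℝ w (B m) = inner ℝ w (B j) := by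
    intro m hm
    have hmem : ∀ m, m ≠ i → B m ∈ (F : Set (Pt (n + 1))) := fun m hm => by
      obtain ⟨l, rfl⟩ := Fin.exists_succAbove_eq hm
      rw [hF]; exact ⟨l, rfl⟩
    have := (Submodule.mem_orthogonal _ _).1 hwK _
      (vsub_mem_vectorSpan ℝ (hmem m hm) (hmem j hj))
    rw [vsub_eq_sub, inner_sub_left, real_inner_comm, real_inner_comm w] at this
    linarith
  have hwl : ∀ l, w l = (inner ℝ w (B i) - inner ℝ w (B j)) * baryGrad B i l := by
    intro l
    have h1 : w l = ∑ m, baryGrad B m l * inner ℝ w (B m) := by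
      have h2 := fun q => sum_baryGrad_smul (B := B) (EuclideanSpace.single l 1) q
      have h3 : w l = ∑ q, w q * (EuclideanSpace.single l (1 : ℝ) : Pt (n + 1)) q := by
        simp [Pi.single_apply]
      have h5 : ∀ m, ∑ r, baryGrad B m r * (EuclideanSpace.single l (1 : ℝ) : Pt (n + 1)) r =
          baryGrad B m l := fun m => by simp [Pi.single_apply]
      simp only [h5] at h2
      rw [h3, Finset.sum_congr rfl fun q _ => by rw [← h2 q, Finset.mul_sum]]
      rw [Finset.sum_comm]
      refine Finset.sum_congr rfl fun m _ => ?_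
      rw [hin, Finset.mul_sum]
      exact Finset.sum_congr rfl fun q _ => by ring
    have h4 : ∀ m, baryGrad B m l * inner ℝ w (B m) = baryGrad B m l * inner ℝ w (B j) +
        if m = i then (inner ℝ w (B i) - inner ℝ w (B j)) * baryGrad B i l else 0 := by
      intro m
      by_cases hm : m = i
      · subst hm; simp; ring
      · rw [hwB m hm]; simp [hm]
    rw [h1]
    simp only [h4, Finset.sum_add_distrib, ← Finset.sum_mul, sum_baryGrad, zero_mul, zero_add]
    simp
  refine ⟨‖w‖⁻¹ * (inner ℝ w (B i) - inner ℝ w (B j)), ?_, fun l => ?_⟩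
  · refine mul_ne_zero (inv_ne_zero (norm_ne_zero_iff.2 hw0)) fun h => hw0 ?_
    ext l
    rw [hwl l, h, zero_mul]; rfl
  · show (‖w‖⁻¹ • w) l = _
    rw [PiLp.smul_apply, smul_eq_mul, hwl l, mul_assoc]

/-- Faces are small: `|F| h_T ≤ C |T|`. -/
theorem exists_faceVol_le (n : ℕ) (σ : ℝ) : ∃ C ≥ (0 : ℝ),
    ∀ (b : Fin (n + 2) → Pt (n + 1)) (T : Finset (Pt (n + 1))), IsElement b T →
      elementDiam T ≤ σ * inscribedDiam T →
      ∀ i, simplexVol (faceVerts b i) * elementDiam T ≤ C * simplexVol b := by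
  set κ := (volume (Metric.ball (0 : Pt (n + 1)) 1)).toReal with hκ
  have hκ0 : 0 < κ := ENNReal.toReal_pos (Metric.measure_ball_pos volume _ one_pos).ne'
    measure_ball_lt_top.ne
  set V := (volume (refSimplex n)).toReal with hV
  refine ⟨(n : ℝ) ^ n * V * (4 * |σ|) ^ (n + 1) / κ, by positivity, fun b T H hσ i => ?_⟩
  obtain ⟨hσ0, c, δ, hδ, hball, hh⟩ := H.exists_ball hσ
  have hpos := H.elementDiam_pos
  rw [abs_of_pos hσ0]
  have h1 : κ * (δ / 2) ^ (n + 1) ≤ simplexVol b := by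
    have h2 := simplexVol_eq b
    rw [EuclideanSpace.euclideanHausdorffMeasure_eq_volume] at h2
    have h3 := measure_mono (μ := volume) hball
    rw [← h2, Measure.addHaar_closedBall volume c (half_pos hδ).le, finrank_euclideanSpace_fin]
      at h3
    have h4 := ENNReal.toReal_mono ENNReal.ofReal_ne_top h3
    rw [ENNReal.toReal_mul, ENNReal.toReal_ofReal (by positivity),
      ENNReal.toReal_ofReal (simplexVol_pos H.indep).le, mul_comm] at h4
    exact h4
  have h2 := simplexVol_le (faceVerts b i)
  have h3 : Metric.diam (convexHull ℝ (Set.range (faceVerts b i))) ≤ elementDiam T := by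
    rw [H.elementDiam_eq]
    refine Metric.diam_mono (convexHull_mono ?_) (isCompact_convexHull_range b).isBounded
    rintro _ ⟨j, rfl⟩
    exact ⟨_, rfl⟩
  set h := elementDiam T with hdef
  calc simplexVol (faceVerts b i) * h ≤ (n * h) ^ n * V * h := by
        refine mul_le_mul_of_nonneg_right (h2.trans ?_) hpos.le
        have : 0 ≤ Metric.diam (convexHull ℝ (Set.range (faceVerts b i))) := Metric.diam_nonneg
        gcongr
    _ = (n : ℝ) ^ n * V * h ^ (n + 1) := by rw [mul_pow]; ring
    _ ≤ (n : ℝ) ^ n * V * (2 * σ * δ) ^ (n + 1) := by gcongr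
    _ = (n : ℝ) ^ n * V * (4 * σ) ^ (n + 1) / κ * (κ * (δ / 2) ^ (n + 1)) := by
        rw [div_mul_eq_mul_div, eq_div_iff hκ0.ne']
        have : (2 * σ * δ) ^ (n + 1) = (4 * σ) ^ (n + 1) * (δ / 2) ^ (n + 1) := by
          rw [← mul_pow]; congr 1; ring
        rw [this]; ring
    _ ≤ _ := by gcongr

theorem exists_isElement {T : Finset (Pt (n + 1))} (hT : AffineIndependent ℝ ((↑) : T → Pt (n + 1)))
    (hc : T.card = n + 1 + 1) : ∃ b, IsElement b T := by
  let e : Fin (n + 2) ≃ T := (Fintype.equivFinOfCardEq (by simpa using hc)).symm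
  refine ⟨fun i => (e i : Pt (n + 1)), hT.comp_embedding e.toEmbedding, ?_⟩
  ext x
  constructor
  · intro hx
    exact ⟨e.symm ⟨x, hx⟩, by simp⟩
  · rintro ⟨i, rfl⟩
    exact (e i).2

theorem IsElement.exists_face (H : IsElement b T) (hF : F ∈ T.powersetCard (n + 1)) :
    ∃ i, (F : Set (Pt (n + 1))) = Set.range (faceVerts b i) := by
  classical
  rw [Finset.mem_powersetCard] at hF
  have hTi : T = Finset.univ.image b := by
    rw [← Finset.coe_inj, H.coe_eq]; simp
  have hcT : T.card = n + 2 := by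
    rw [hTi, Finset.card_image_of_injective _ H.indep.injective]; simp
  have hne : (T \ F).card = 1 := by
    rw [Finset.card_sdiff_of_subset hF.1, hcT, hF.2]; lia
  obtain ⟨e, he⟩ := Finset.card_eq_one.1 hne
  have heT : e ∈ T \ F := he ▸ Finset.mem_singleton_self e
  rw [Finset.mem_sdiff] at heT
  obtain ⟨i, hi⟩ : e ∈ Set.range b := H.coe_eq ▸ Finset.mem_coe.2 heT.1
  refine ⟨i, ?_⟩
  have h1 : Set.range (faceVerts b i) = b '' {i}ᶜ := by
    rw [← Fin.range_succAbove i, ← Set.range_comp]; rfl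
  rw [h1]
  ext x
  constructor
  · intro hx
    obtain ⟨j, hj⟩ : x ∈ Set.range b := H.coe_eq ▸ Finset.mem_coe.2 (hF.1 hx)
    refine ⟨j, fun hji => heT.2 ?_, hj⟩
    rw [Set.mem_singleton_iff] at hji
    rw [← hi, ← hji, hj]; exact hx
  · rintro ⟨j, hj, rfl⟩
    by_contra hcon
    have : b j ∈ T \ F := Finset.mem_sdiff.2
      ⟨by rw [← Finset.mem_coe, H.coe_eq]; exact ⟨j, rfl⟩, hcon⟩
    rw [he, Finset.mem_singleton, ← hi] at this
    exact hj (H.indep.injective this)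

theorem IsElement.face_mem (H : IsElement b T)
    (hF : (F : Set (Pt (n + 1))) = Set.range (faceVerts b i)) : F ∈ T.powersetCard (n + 1) := by
  classical
  rw [Finset.mem_powersetCard]
  constructor
  · rw [← Finset.coe_subset, hF, H.coe_eq]
    rintro _ ⟨j, rfl⟩
    exact ⟨_, rfl⟩
  · have : F = Finset.univ.image (faceVerts b i) := by
      rw [← Finset.coe_inj, hF]; simp
    rw [this, Finset.card_image_of_injective _
      (affineIndependent_faceVerts H.indep i).injective]
    simp

theorem exists_finset_face (b : Fin (n + 2) → Pt (n + 1)) (i : Fin (n + 2)) :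
    ∃ F : Finset (Pt (n + 1)), (F : Set (Pt (n + 1))) = Set.range (faceVerts b i) := by
  classical
  exact ⟨Finset.univ.image (faceVerts b i), by simp⟩

end

/-! ### `L²`-projections onto polynomials -/

section

variable {m d k : ℕ} {μ : Measure (Pt d)} {a : Fin (m + 1) → Pt d} {w : Pt d → ℝ}
  {p q : MvPolynomial (Fin d) ℝ}

theorem isL2Proj_smul_iff {c : ℝ} (hc : 0 < c) :
    IsL2Proj (ENNReal.ofReal c • μ) k w p ↔ IsL2Proj μ k w p := by
  refine and_congr_right fun _ => forall_congr' fun q => imp_congr_right fun _ => ?_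
  rw [integral_smul_measure, integral_smul_measure, ENNReal.toReal_ofReal hc.le]
  simp [hc.ne']

theorem memLp_polyFun (a : Fin (m + 1) → Pt d) (p : MvPolynomial (Fin d) ℝ) :
    MemLp (polyFun p) 2 (simplexMeasure a) :=
  memLp_simplexMeasure a (continuous_polyFun p) 2

theorem exists_isL2Proj (k : ℕ) (hw : MemLp w 2 (simplexMeasure a)) :
    ∃ p, IsL2Proj (simplexMeasure a) k w p := by
  have hint : ∀ {f : Pt d → ℝ} (q : MvPolynomial (Fin d) ℝ), MemLp f 2 (simplexMeasure a) →
      Integrable (fun y => f y * polyFun q y) (simplexMeasure a) := fun q hf =>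
    hf.integrable_mul (memLp_polyFun a q)
  let B : PolyLE d k →ₗ[ℝ] PolyLE d k →ₗ[ℝ] ℝ := LinearMap.mk₂ ℝ
    (fun p q => ∫ y, polyFun p.1 y * polyFun q.1 y ∂simplexMeasure a)
    (fun p p' q => by
      rw [← integral_add (hint _ (memLp_polyFun a _)) (hint _ (memLp_polyFun a _))]
      congr 1; funext y; simp only [Submodule.coe_add, polyFun_add]; ring)
    (fun c p q => by
      rw [smul_eq_mul, ← integral_const_mul]
      congr 1; funext y; simp only [Submodule.coe_smul, polyFun_smul]; ring)
    (fun p q q' => by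
      rw [← integral_add (hint _ (memLp_polyFun a _)) (hint _ (memLp_polyFun a _))]
      congr 1; funext y; simp only [Submodule.coe_add, polyFun_add]; ring)
    (fun c p q => by
      rw [smul_eq_mul, ← integral_const_mul]
      congr 1; funext y; simp only [Submodule.coe_smul, polyFun_smul]; ring)
  let ℓ : PolyLE d k →ₗ[ℝ] ℝ :=
    { toFun := fun q => ∫ y, w y * polyFun q.1 y ∂simplexMeasure a
      map_add' := fun q q' => by
        rw [← integral_add (hint _ hw) (hint _ hw)]
        congr 1; funext y; simp only [Submodule.coe_add, polyFun_add]; ring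
      map_smul' := fun c q => by
        rw [smul_eq_mul, RingHom.id_apply, ← integral_const_mul]
        congr 1; funext y; simp only [Submodule.coe_smul, polyFun_smul]; ring }
  obtain ⟨p, hp⟩ := exists_riesz B ℓ fun v hv => by
    have h1 : l2Norm (simplexMeasure a) (polyFun v.1) = 0 := by
      have : ∫ y, polyFun v.1 y * polyFun v.1 y ∂simplexMeasure a = 0 := hv
      rw [l2Norm]
      simp only [sq, this, Real.sqrt_zero]
    have h2 := ae_eq_zero_of_l2Norm_eq_zero (memLp_polyFun a v.1) h1
    show ∫ y, w y * polyFun v.1 y ∂simplexMeasure a = 0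
    rw [integral_congr_ae (g := fun _ => (0 : ℝ)), integral_zero]
    filter_upwards [h2] with y hy
    simp [hy]
  exact ⟨p.1, p.degree_le, fun q hq =>
    hp ⟨q, (MvPolynomial.mem_restrictTotalDegree _ _ _).2 hq⟩⟩

theorem IsL2Proj.sub (hw : MemLp w 2 (simplexMeasure a))
    (hp : IsL2Proj (simplexMeasure a) k w p) (hq : q.totalDegree ≤ k) :
    IsL2Proj (simplexMeasure a) k (fun x => w x - polyFun q x) (p - q) := by
  refine ⟨(MvPolynomial.totalDegree_sub _ _).trans (max_le hp.1 hq), fun r hr => ?_⟩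
  have h := hp.2 r hr
  simp only [polyFun_sub, sub_mul]
  have i1 : Integrable (fun x => polyFun p x * polyFun r x) (simplexMeasure a) :=
    (memLp_polyFun a p).integrable_mul (memLp_polyFun a r)
  have i2 : Integrable (fun x => polyFun q x * polyFun r x) (simplexMeasure a) :=
    (memLp_polyFun a q).integrable_mul (memLp_polyFun a r)
  have i3 : Integrable (fun x => w x * polyFun r x) (simplexMeasure a) :=
    hw.integrable_mul (memLp_polyFun a r)
  rw [integral_sub i1 i2, integral_sub i3 i2, h]

theorem IsL2Proj.l2Norm_le (hw : MemLp w 2 (simplexMeasure a))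
    (hp : IsL2Proj (simplexMeasure a) k w p) :
    l2Norm (simplexMeasure a) (polyFun p) ≤ l2Norm (simplexMeasure a) w := by
  have h := hp.2 p hp.1
  have h1 : l2Norm (simplexMeasure a) (polyFun p) ^ 2 ≤
      l2Norm (simplexMeasure a) w * l2Norm (simplexMeasure a) (polyFun p) := by
    rw [l2Norm_sq]
    simp only [sq]
    rw [h]
    exact (le_abs_self _).trans (abs_integral_mul_le hw (memLp_polyFun a p))
  rcases (l2Norm_nonneg (simplexMeasure a) (polyFun p)).eq_or_lt with h0 | h0
  · rw [← h0]; exact l2Norm_nonneg _ _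
  · rw [sq] at h1
    exact le_of_mul_le_mul_right h1 h0

/-- The `L²`-projection is the best approximation. -/
theorem IsL2Proj.l2Norm_sub_le (hw : MemLp w 2 (simplexMeasure a))
    (hp : IsL2Proj (simplexMeasure a) k w p) (hq : q.totalDegree ≤ k) :
    l2Norm (simplexMeasure a) (fun x => w x - polyFun p x) ≤
      2 * l2Norm (simplexMeasure a) (fun x => w x - polyFun q x) := by
  have h1 := (hp.sub hw hq).l2Norm_le (hw.sub (memLp_polyFun a q))
  have h2 := HDG.l2Norm_sub_le (hw.sub (memLp_polyFun a q)) (memLp_polyFun a (p - q))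
  refine (le_of_eq ?_).trans (h2.trans ?_)
  · congr 1; funext x; simp [polyFun_sub]
  · have : l2Norm (simplexMeasure a) (w - polyFun q) =
        l2Norm (simplexMeasure a) (fun x => w x - polyFun q x) := rfl
    linarith

theorem isL2Proj_l2Proj {c : ℝ} (hc : 0 < c) (hμ : μ = ENNReal.ofReal c • simplexMeasure a)
    (k : ℕ) (hw : MemLp w 2 (simplexMeasure a)) :
    ∃ p, IsL2Proj (simplexMeasure a) k w p ∧ l2Proj μ k w = polyFun p := by
  subst hμ
  have h : ∃ p, IsL2Proj (ENNReal.ofReal c • simplexMeasure a) k w p := by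
    obtain ⟨p, hp⟩ := exists_isL2Proj k hw
    exact ⟨p, (isL2Proj_smul_iff hc).2 hp⟩
  exact ⟨h.choose, (isL2Proj_smul_iff hc).1 h.choose_spec, by rw [l2Proj, dif_pos h]⟩

end

end HDG

end

noncomputable section

namespace HDG

/-! ### The Raviart–Thomas projection: existence -/

section

variable {n k : ℕ} {B : AffineBasis (Fin (n + 2)) ℝ (Pt (n + 1))}

/-- The defining conditions of the Raviart–Thomas projection in barycentric form: `w` is the field
in the element and `W i` is its trace on the face opposite to the vertex `i`. -/
def IsRTSol (B : AffineBasis (Fin (n + 2)) ℝ (Pt (n + 1))) (k : ℕ) (w : VectorField (n + 1))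
    (W : Fin (n + 2) → VectorField (n + 1)) (q : Fin (n + 1) → MvPolynomial (Fin (n + 1)) ℝ) :
    Prop :=
  IsRT k q ∧
    (∀ i, ∀ m : MvPolynomial (Fin (n + 1)) ℝ, m.totalDegree ≤ k →
      ∫ x, (∑ l, polyFun (q l) x * baryGrad B i l) * polyFun m x ∂simplexMeasure (faceVerts B i) =
        ∫ x, (∑ l, W i l x * baryGrad B i l) * polyFun m x ∂simplexMeasure (faceVerts B i)) ∧
    (∀ m : Fin (n + 1) → MvPolynomial (Fin (n + 1)) ℝ, (∀ l, (m l).totalDegree < k) →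
      ∫ x, ∑ l, polyFun (q l) x * polyFun (m l) x ∂simplexMeasure B =
        ∫ x, ∑ l, w l x * polyFun (m l) x ∂simplexMeasure B)

theorem sum_sub_mul_baryGrad (i j : Fin (n + 2)) (x : Pt (n + 1)) :
    ∑ l, (x l - B j l) * baryGrad B i l = B.coord i x - if i = j then 1 else 0 := by
  have h := coord_sub_coord (B := B) i x (B j)
  rw [AffineBasis.coord_apply] at h
  rw [h]
  exact Finset.sum_congr rfl fun l _ => mul_comm _ _

theorem sum_baryGrad_mul_vertex (l q : Fin (n + 1)) :
    ∑ i, baryGrad B i l * B i q = if l = q then 1 else 0 := by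
  have h := sum_baryGrad_smul (B := B) (EuclideanSpace.single l 1) q
  have h5 : ∀ m, ∑ r, baryGrad B m r * (EuclideanSpace.single l (1 : ℝ) : Pt (n + 1)) r =
      baryGrad B m l := fun m => by simp [Pi.single_apply]
  simp only [h5] at h
  rw [h]
  simp [Pi.single_apply, eq_comm]

theorem continuous_coord (i : Fin (n + 2)) : Continuous fun x => B.coord i x := by
  have : (fun x => B.coord i x) = polyFun (baryPoly B i) := funext fun x =>
    (polyFun_baryPoly i x).symm
  rw [this]
  exact continuous_polyFun _

theorem mul_sq_sub_le_variance {ι : Type*} [Fintype ι] [DecidableEq ι] {c t : ι → ℝ}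
    (hc : ∀ i, 0 ≤ c i) (hsum : ∑ i, c i = 1) (i j : ι) :
    c i * c j * (t i - t j) ^ 2 ≤ ∑ m, c m * (t m * t m) - (∑ m, c m * t m) * ∑ m, c m * t m := by
  have key : ∑ a, ∑ e, c a * c e * (t a - t e) ^ 2 =
      2 * (∑ m, c m * (t m * t m) - (∑ m, c m * t m) * ∑ m, c m * t m) := by
    have e1 : ∀ a e, c a * c e * (t a - t e) ^ 2 =
        (c a * (t a * t a)) * c e + c a * (c e * (t e * t e)) -
          2 * ((c a * t a) * (c e * t e)) := fun a e => by ring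
    simp only [e1, Finset.sum_add_distrib, Finset.sum_sub_distrib, ← Finset.mul_sum,
      ← Finset.sum_mul, hsum]
    ring
  have hnn : ∀ a e, 0 ≤ c a * c e * (t a - t e) ^ 2 := fun a e =>
    mul_nonneg (mul_nonneg (hc a) (hc e)) (sq_nonneg _)
  rcases eq_or_ne i j with rfl | hij
  · have h0 : 0 ≤ ∑ a, ∑ e, c a * c e * (t a - t e) ^ 2 :=
      Finset.sum_nonneg fun a _ => Finset.sum_nonneg fun e _ => hnn a e
    rw [key] at h0
    simp only [sub_self]
    nlinarith
  · have h1 : ∑ a ∈ {i, j}, ∑ e, c a * c e * (t a - t e) ^ 2 ≤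
        ∑ a, ∑ e, c a * c e * (t a - t e) ^ 2 :=
      Finset.sum_le_sum_of_subset_of_nonneg (Finset.subset_univ _)
        fun a _ _ => Finset.sum_nonneg fun e _ => hnn a e
    rw [Finset.sum_pair hij, key] at h1
    have h2 := Finset.single_le_sum (f := fun e => c i * c e * (t i - t e) ^ 2)
      (fun e _ => hnn i e) (Finset.mem_univ j)
    have h3 := Finset.single_le_sum (f := fun e => c j * c e * (t j - t e) ^ 2)
      (fun e _ => hnn j e) (Finset.mem_univ i)
    have h4 : c j * c i * (t j - t i) ^ 2 = c i * c j * (t i - t j) ^ 2 := by ring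
    linarith

/-- The variance form of a family of functions with respect to the barycentric weights. -/
def baryForm (B : AffineBasis (Fin (n + 2)) ℝ (Pt (n + 1)))
    (t s : Fin (n + 2) → MvPolynomial (Fin (n + 1)) ℝ) : ℝ :=
  ∫ x, ∑ i, (B.coord i x * (polyFun (t i) x - ∑ j, B.coord j x * polyFun (t j) x)) *
    polyFun (s i) x ∂simplexMeasure B

theorem continuous_baryForm_integrand (t s : Fin (n + 2) → MvPolynomial (Fin (n + 1)) ℝ) :
    Continuous fun x => ∑ i, (B.coord i x * (polyFun (t i) x -
      ∑ j, B.coord j x * polyFun (t j) x)) * polyFun (s i) x := by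
  refine continuous_finsetSum _ fun i _ => ((continuous_coord i).mul
    ((continuous_polyFun _).sub (continuous_finsetSum _ fun j _ =>
      (continuous_coord j).mul (continuous_polyFun _)))).mul (continuous_polyFun _)

/-- The differences of the functions are controlled by their variance. -/
theorem exists_abs_sub_le_baryForm (n k : ℕ) : ∃ C ≥ (0 : ℝ),
    ∀ (B : AffineBasis (Fin (n + 2)) ℝ (Pt (n + 1)))
      (t : Fin (n + 2) → MvPolynomial (Fin (n + 1)) ℝ), (∀ i, (t i).totalDegree ≤ k) →
      ∀ i j, ∀ x ∈ convexHull ℝ (Set.range B),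
        |polyFun (t i) x - polyFun (t j) x| ≤ C * Real.sqrt (baryForm B t t) := by
  obtain ⟨C, hC, h⟩ := exists_bary_sup_bound (n + 1) k
  refine ⟨C, hC, fun B t ht i j x hx => ?_⟩
  have h1 := h i j (n + 1) B (t i - t j)
    ((MvPolynomial.totalDegree_sub _ _).trans (max_le (ht i) (ht j))) x hx
  rw [polyFun_sub] at h1
  refine h1.trans (mul_le_mul_of_nonneg_left (Real.sqrt_le_sqrt ?_) hC)
  rw [baryForm, integral_simplexMeasure B (continuous_baryForm_integrand t t)]
  refine integral_mono_ae (integrable_refMeasure ?_) (integrable_refMeasure ?_) ?_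
  · exact ((continuous_refBary i).mul (continuous_refBary j)).mul
      (((continuous_polyFun _).comp (continuous_simplexMap B)).pow 2)
  · exact (continuous_baryForm_integrand t t).comp (continuous_simplexMap B)
  · filter_upwards [ae_mem_refSimplex] with y hy
    have hmem : simplexMap B y ∈ convexHull ℝ (Set.range B) := by
      rw [← simplexMap_image]; exact ⟨y, hy, rfl⟩
    have h2 := mul_sq_sub_le_variance (c := fun m => B.coord m (simplexMap B y))
      (t := fun m => polyFun (t m) (simplexMap B y)) (fun m => coord_nonneg hmem m)
      (B.sum_coord_apply_eq_one _) i j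
    rw [polyFun_sub, ← coord_simplexMap (B := B), ← coord_simplexMap (B := B)]
    refine h2.trans_eq ?_
    have e1 : ∀ m, (B.coord m (simplexMap B y) * (polyFun (t m) (simplexMap B y) -
        ∑ j, B.coord j (simplexMap B y) * polyFun (t j) (simplexMap B y))) *
          polyFun (t m) (simplexMap B y) =
        B.coord m (simplexMap B y) *
          (polyFun (t m) (simplexMap B y) * polyFun (t m) (simplexMap B y)) -
        (∑ j, B.coord j (simplexMap B y) * polyFun (t j) (simplexMap B y)) *
          (B.coord m (simplexMap B y) * polyFun (t m) (simplexMap B y)) := fun m => by ring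
    simp only [e1, Finset.sum_sub_distrib, ← Finset.mul_sum]

theorem totalDegree_baryPoly_mul_le {t : MvPolynomial (Fin (n + 1)) ℝ} (hk : 1 ≤ k)
    (ht : t.totalDegree ≤ k - 1) (i : Fin (n + 2)) : (baryPoly B i * t).totalDegree ≤ k := by
  refine (MvPolynomial.totalDegree_mul _ _).trans ?_
  have := totalDegree_affinePoly_le (B.coord i 0) (baryGrad B i)
  have h2 : (baryPoly B i).totalDegree ≤ 1 := this
  lia

theorem totalDegree_sum_le {ι : Type*} (s : Finset ι) {d : ℕ} {f : ι → MvPolynomial (Fin d) ℝ}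
    (h : ∀ i ∈ s, (f i).totalDegree ≤ k) : (∑ i ∈ s, f i).totalDegree ≤ k :=
  (MvPolynomial.totalDegree_finset_sum _ _).trans (Finset.sup_le h)

theorem totalDegree_C_mul_le {d : ℕ} (c : ℝ) {f : MvPolynomial (Fin d) ℝ}
    (h : f.totalDegree ≤ k) : (MvPolynomial.C c * f).totalDegree ≤ k := by
  refine (MvPolynomial.totalDegree_mul _ _).trans ?_
  simpa using h

theorem IsRT.add {q q' : Fin (n + 1) → MvPolynomial (Fin (n + 1)) ℝ} (h : IsRT k q)
    (h' : IsRT k q') : IsRT k fun l => q l + q' l := by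
  obtain ⟨p, r, hp, hr, hq⟩ := h
  obtain ⟨p', r', hp', hr', hq'⟩ := h'
  refine ⟨fun l => p l + p' l, r + r', fun l =>
    (MvPolynomial.totalDegree_add _ _).trans (max_le (hp l) (hp' l)),
    (MvPolynomial.totalDegree_add _ _).trans (max_le hr hr'), fun l => ?_⟩
  simp only [hq, hq']; ring

/-- `∑_i f_i (a_i - x)` is a Raviart–Thomas field if the `f_i` have degree at most `k`. -/
theorem isRT_sum_vertex {f : Fin (n + 2) → MvPolynomial (Fin (n + 1)) ℝ}
    (hf : ∀ i, (f i).totalDegree ≤ k) :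
    IsRT k fun l => ∑ i, f i * (MvPolynomial.C (B i l) - MvPolynomial.X l) := by
  refine ⟨fun l => ∑ i, MvPolynomial.C (B i l) * f i, -∑ i, f i, fun l =>
    totalDegree_sum_le _ fun i _ => totalDegree_C_mul_le _ (hf i), ?_, fun l => ?_⟩
  · rw [MvPolynomial.totalDegree_neg]
    exact totalDegree_sum_le _ fun i _ => hf i
  · rw [mul_neg, Finset.mul_sum, ← sub_eq_add_neg, ← Finset.sum_sub_distrib]
    exact Finset.sum_congr rfl fun i _ => by ring

theorem polyFun_sum_vertex (f : Fin (n + 2) → MvPolynomial (Fin (n + 1)) ℝ) (l : Fin (n + 1))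
    (x : Pt (n + 1)) :
    polyFun (∑ i, f i * (MvPolynomial.C (B i l) - MvPolynomial.X l)) x =
      ∑ i, polyFun (f i) x * (B i l - x l) := by
  simp [polyFun_sum, polyFun_mul, polyFun_sub]

theorem sum_vertex_mul_baryGrad (f : Fin (n + 2) → ℝ) (i : Fin (n + 2)) (x : Pt (n + 1)) :
    ∑ l, (∑ j, f j * (B j l - x l)) * baryGrad B i l = f i - B.coord i x * ∑ j, f j := by
  have e1 : ∀ j, ∑ l, f j * (B j l - x l) * baryGrad B i l =
      f j * ((if i = j then 1 else 0) - B.coord i x) := by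
    intro j
    have h := sum_sub_mul_baryGrad (B := B) i j x
    have e2 : ∀ l, f j * (B j l - x l) * baryGrad B i l =
        -(f j * ((x l - B j l) * baryGrad B i l)) := fun l => by ring
    simp only [e2, Finset.sum_neg_distrib, ← Finset.mul_sum, h]
    ring
  simp only [Finset.sum_mul]
  rw [Finset.sum_comm, Finset.sum_congr rfl fun j _ => e1 j]
  simp only [mul_sub, Finset.sum_sub_distrib, mul_ite, mul_one, mul_zero, Finset.sum_ite_eq,
    Finset.mem_univ, if_true, ← Finset.sum_mul]
  ring

theorem exists_isRTSol (hk : 1 ≤ k) {w : VectorField (n + 1)}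
    {W : Fin (n + 2) → VectorField (n + 1)} (hw : ∀ l, MemLp (w l) 2 (simplexMeasure B))
    (hW : ∀ i l, MemLp (W i l) 2 (simplexMeasure (faceVerts B i))) :
    ∃ q, IsRTSol B k w W q := by
  have hWg : ∀ i, MemLp (fun x => ∑ l, W i l x * baryGrad B i l) 2
      (simplexMeasure (faceVerts B i)) := fun i =>
    memLp_finset_sum _ fun l _ => (hW i l).mul_const _
  choose f hf using fun i => exists_isL2Proj k (hWg i)
  set q1 : Fin (n + 1) → MvPolynomial (Fin (n + 1)) ℝ := fun l =>
    ∑ i, f i * (MvPolynomial.C (B i l) - MvPolynomial.X l) with hq1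
  have hv : ∀ l, MemLp (fun x => w l x - polyFun (q1 l) x) 2 (simplexMeasure B) := fun l =>
    (hw l).sub (memLp_polyFun B _)
  obtain ⟨C, -, hgap⟩ := exists_abs_sub_le_baryForm n (k - 1)
  have hint : ∀ t s : Fin (n + 2) → MvPolynomial (Fin (n + 1)) ℝ, Integrable (fun x => ∑ i, (B.coord i x * (polyFun (t i) x -
      ∑ j, B.coord j x * polyFun (t j) x)) * polyFun (s i) x) (simplexMeasure B) := fun t s =>
    integrable_simplexMeasure B (continuous_baryForm_integrand t s)
  have hintl : ∀ s : Fin (n + 2) → MvPolynomial (Fin (n + 1)) ℝ,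
      Integrable (fun x => ∑ l, (w l x - polyFun (q1 l) x) *
        ∑ i, polyFun (s i) x * baryGrad B i l) (simplexMeasure B) := by
    intro s
    refine integrable_finsetSum _ fun l _ => ?_
    have : MemLp (fun x => ∑ i, polyFun (s i) x * baryGrad B i l) 2 (simplexMeasure B) :=
      memLp_finset_sum _ fun i _ => (memLp_polyFun B (s i)).mul_const _
    exact (hv l).integrable_mul this
  let Bf : (Fin (n + 2) → PolyLE (n + 1) (k - 1)) →ₗ[ℝ]
      (Fin (n + 2) → PolyLE (n + 1) (k - 1)) →ₗ[ℝ] ℝ := LinearMap.mk₂ ℝ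
    (fun t s => baryForm B (fun i => (t i).1) fun i => (s i).1)
    (fun t t' s => by
      simp only [baryForm]
      rw [← integral_add (hint _ _) (hint _ _)]
      congr 1; funext x
      simp only [Pi.add_apply, Submodule.coe_add, polyFun_add, mul_add, Finset.sum_add_distrib]
      conv_rhs => rw [← Finset.sum_add_distrib]
      exact Finset.sum_congr rfl fun i _ => by ring)
    (fun c t s => by
      simp only [baryForm]
      rw [smul_eq_mul, ← integral_const_mul]
      congr 1; funext x
      simp only [Pi.smul_apply, Submodule.coe_smul, polyFun_smul, Finset.mul_sum]
      refine Finset.sum_congr rfl fun i _ => ?_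
      simp only [mul_left_comm _ c, ← Finset.mul_sum]
      ring)
    (fun t s s' => by
      simp only [baryForm]
      rw [← integral_add (hint _ _) (hint _ _)]
      congr 1; funext x
      simp only [Pi.add_apply, Submodule.coe_add, polyFun_add, mul_add, Finset.sum_add_distrib])
    (fun c t s => by
      simp only [baryForm]
      rw [smul_eq_mul, ← integral_const_mul]
      congr 1; funext x
      simp only [Pi.smul_apply, Submodule.coe_smul, polyFun_smul]
      rw [Finset.mul_sum]
      exact Finset.sum_congr rfl fun i _ => by ring)
  let ℓ : (Fin (n + 2) → PolyLE (n + 1) (k - 1)) →ₗ[ℝ] ℝ :=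
    { toFun := fun s => ∫ x, ∑ l, (w l x - polyFun (q1 l) x) *
        ∑ i, polyFun (s i).1 x * baryGrad B i l ∂simplexMeasure B
      map_add' := fun s s' => by
        rw [← integral_add (hintl _) (hintl _)]
        congr 1; funext x
        simp only [Pi.add_apply, Submodule.coe_add, polyFun_add, add_mul, mul_add,
          Finset.sum_add_distrib]
      map_smul' := fun c s => by
        rw [smul_eq_mul, RingHom.id_apply, ← integral_const_mul]
        congr 1; funext x
        simp only [Pi.smul_apply, Submodule.coe_smul, polyFun_smul, Finset.mul_sum]
        exact Finset.sum_congr rfl fun l _ => Finset.sum_congr rfl fun i _ => by ring }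
  obtain ⟨t, ht⟩ := exists_riesz Bf ℓ fun s hs => by
    have h0 : baryForm B (fun i => (s i).1) (fun i => (s i).1) = 0 := hs
    show ∫ x, ∑ l, (w l x - polyFun (q1 l) x) *
        ∑ i, polyFun (s i).1 x * baryGrad B i l ∂simplexMeasure B = 0
    rw [integral_congr_ae (g := fun _ => (0 : ℝ)), integral_zero]
    filter_upwards [ae_mem_convexHull B] with x hx
    refine Finset.sum_eq_zero fun l _ => ?_
    have h1 : ∀ i, polyFun (s i).1 x = polyFun (s 0).1 x := by
      intro i
      have h2 := hgap B (fun i => (s i).1) (fun i => (s i).degree_le) i 0 x hx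
      rw [h0, Real.sqrt_zero, mul_zero] at h2
      exact sub_eq_zero.1 (abs_eq_zero.1 (le_antisymm h2 (abs_nonneg _)))
    simp only [h1, ← Finset.mul_sum, sum_baryGrad, mul_zero]
  have htd : ∀ i, (baryPoly B i * (t i).1).totalDegree ≤ k := fun i =>
    totalDegree_baryPoly_mul_le hk (t i).degree_le i
  set q2 : Fin (n + 1) → MvPolynomial (Fin (n + 1)) ℝ := fun l =>
    ∑ i, (baryPoly B i * (t i).1) * (MvPolynomial.C (B i l) - MvPolynomial.X l) with hq2
  refine ⟨fun l => q1 l + q2 l, (isRT_sum_vertex fun i => (hf i).1).add (isRT_sum_vertex htd),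
    fun i m hm => ?_, fun m hm => ?_⟩
  · rw [← (hf i).2 m hm]
    refine integral_congr_ae ?_
    filter_upwards [ae_mem_convexHull (faceVerts B i)] with x hx
    have h0 := coord_faceVerts i hx
    congr 1
    simp only [polyFun_add, add_mul, Finset.sum_add_distrib, hq1, hq2, polyFun_sum_vertex,
      sum_vertex_mul_baryGrad, polyFun_mul, polyFun_baryPoly, h0]
    ring
  · obtain ⟨s, hs⟩ : ∃ s : Fin (n + 2) → PolyLE (n + 1) (k - 1),
        ∀ i x, polyFun (s i).1 x = ∑ q, B i q * polyFun (m q) x := by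
      refine ⟨fun i => ⟨∑ q, MvPolynomial.C (B i q) * m q,
        (MvPolynomial.mem_restrictTotalDegree _ _ _).2 (totalDegree_sum_le _ fun q _ =>
          totalDegree_C_mul_le _ (Nat.le_sub_one_of_lt (hm q)))⟩, fun i x => ?_⟩
      simp [polyFun_sum, polyFun_mul]
    have hms : ∀ l x, polyFun (m l) x = ∑ i, polyFun (s i).1 x * baryGrad B i l := by
      intro l x
      simp only [hs, Finset.sum_mul]
      rw [Finset.sum_comm]
      have e1 : ∀ q, ∑ i, B i q * polyFun (m q) x * baryGrad B i l =
          polyFun (m q) x * if l = q then 1 else 0 := by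
        intro q
        rw [← sum_baryGrad_mul_vertex (B := B), Finset.mul_sum]
        exact Finset.sum_congr rfl fun i _ => by ring
      simp [e1]
    have e2 : ∫ x, ∑ l, polyFun (q2 l) x * polyFun (m l) x ∂simplexMeasure B =
        ∫ x, ∑ l, (w l x - polyFun (q1 l) x) * polyFun (m l) x ∂simplexMeasure B := by
      have h1 : baryForm B (fun i => (t i).1) (fun i => (s i).1) = ∫ x, ∑ l,
          (w l x - polyFun (q1 l) x) * ∑ i, polyFun (s i).1 x * baryGrad B i l ∂simplexMeasure B :=
        ht s
      simp only [hms]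
      rw [← h1, baryForm]
      congr 1; funext x
      have e3 : ∀ l, polyFun (q2 l) x * ∑ i, polyFun (s i).1 x * baryGrad B i l =
          ∑ i, (polyFun (q2 l) x * baryGrad B i l) * polyFun (s i).1 x := by
        intro l
        rw [Finset.mul_sum]
        exact Finset.sum_congr rfl fun i _ => by ring
      simp only [e3]
      rw [Finset.sum_comm]
      refine Finset.sum_congr rfl fun i _ => ?_
      rw [← Finset.sum_mul]
      congr 1
      simp only [hq2, polyFun_sum_vertex, sum_vertex_mul_baryGrad, polyFun_mul, polyFun_baryPoly]
      ring
    have i1 : ∀ {v : VectorField (n + 1)}, (∀ l, MemLp (v l) 2 (simplexMeasure B)) →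
        Integrable (fun x => ∑ l, v l x * polyFun (m l) x) (simplexMeasure B) := fun hv =>
      integrable_finsetSum _ fun l _ => (hv l).integrable_mul (memLp_polyFun B (m l))
    have e4 : ∫ x, ∑ l, (w l x - polyFun (q1 l) x) * polyFun (m l) x ∂simplexMeasure B =
        ∫ x, ∑ l, w l x * polyFun (m l) x ∂simplexMeasure B -
          ∫ x, ∑ l, polyFun (q1 l) x * polyFun (m l) x ∂simplexMeasure B := by
      rw [← integral_sub (i1 hw) (i1 fun l => memLp_polyFun B (q1 l))]
      simp only [sub_mul, Finset.sum_sub_distrib]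
    simp only [polyFun_add, add_mul, Finset.sum_add_distrib]
    rw [integral_add (i1 fun l => memLp_polyFun B (q1 l)) (i1 fun l => memLp_polyFun B (q2 l)),
      e2, e4]
    ring

end

end HDG

end

noncomputable section

namespace HDG

/-! ### The Raviart–Thomas projection: stability -/

section

variable {n k : ℕ} {B : AffineBasis (Fin (n + 2)) ℝ (Pt (n + 1))}

theorem dvd_sub_bind₁ {d : ℕ} (Λ : MvPolynomial (Fin d) ℝ) (c : Fin d → ℝ)
    (f : MvPolynomial (Fin d) ℝ) :
    Λ ∣ f - MvPolynomial.bind₁ (fun l => MvPolynomial.X l - Λ * MvPolynomial.C (c l)) f := by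
  induction f using MvPolynomial.induction_on with
  | C a => simp
  | add p q hp hq =>
    rw [map_add, add_sub_add_comm]
    exact dvd_add hp hq
  | mul_X p l hp =>
    rw [map_mul, MvPolynomial.bind₁_X_right]
    set P := MvPolynomial.bind₁ (fun l => MvPolynomial.X l - Λ * MvPolynomial.C (c l)) p
    have e : p * MvPolynomial.X l - P * (MvPolynomial.X l - Λ * MvPolynomial.C (c l)) =
        (p - P) * MvPolynomial.X l + Λ * (P * MvPolynomial.C (c l)) := by ring
    rw [e]
    exact dvd_add (hp.mul_right _) (dvd_mul_right _ _)

theorem one_le_totalDegree_baryPoly (i : Fin (n + 2)) : 1 ≤ (baryPoly B i).totalDegree := by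
  by_contra h
  have h0 : (baryPoly B i).totalDegree = 0 := by lia
  rw [MvPolynomial.totalDegree_eq_zero_iff_eq_C] at h0
  obtain ⟨j, hj⟩ := exists_ne i
  have h1 : ∀ x, B.coord i x = (baryPoly B i).coeff 0 := fun x => by
    rw [← polyFun_baryPoly, h0]; simp
  have h2 := (h1 (B i)).trans (h1 (B j)).symm
  rw [B.coord_apply_eq, B.coord_apply_ne hj.symm] at h2
  exact one_ne_zero h2

/-- Extension of a polynomial from a face to the element. -/
theorem exists_face_extension (i : Fin (n + 2)) {f : MvPolynomial (Fin (n + 1)) ℝ}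
    (hf : f.totalDegree ≤ k) :
    ∃ E t : MvPolynomial (Fin (n + 1)) ℝ, t.totalDegree ≤ k - 1 ∧ f = E + baryPoly B i * t ∧
      ∀ x ∈ convexHull ℝ (Set.range B), ∃ y ∈ convexHull ℝ (Set.range (faceVerts B i)),
        polyFun E x = polyFun f y := by
  obtain ⟨j, hj⟩ := exists_ne i
  set E := MvPolynomial.bind₁ (fun l => MvPolynomial.X l -
    baryPoly B i * MvPolynomial.C (B i l - B j l)) f with hE
  have hEdeg : E.totalDegree ≤ k := by
    refine (totalDegree_bind₁_le (fun l => ?_) f).trans hf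
    refine (MvPolynomial.totalDegree_sub _ _).trans (max_le (by simp) ?_)
    rw [mul_comm]
    exact totalDegree_C_mul_le _ (totalDegree_affinePoly_le _ _)
  obtain ⟨t, ht⟩ := dvd_sub_bind₁ (baryPoly B i) (fun l => B i l - B j l) f
  refine ⟨E, t, ?_, ?_, fun x hx => ⟨_, sub_coord_smul_mem_face hj hx, ?_⟩⟩
  · by_cases h0 : t = 0
    · simp [h0]
    · have hΛ : baryPoly B i ≠ 0 := fun h => by
        have := one_le_totalDegree_baryPoly (B := B) i
        rw [h] at this
        simp at this
      have h1 : (baryPoly B i * t).totalDegree ≤ k := by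
        rw [← ht]
        exact (MvPolynomial.totalDegree_sub _ _).trans (max_le hf hEdeg)
      rw [MvPolynomial.totalDegree_mul_of_isDomain hΛ h0] at h1
      have := one_le_totalDegree_baryPoly (B := B) i
      lia
  · rw [← ht]; ring
  · rw [hE, polyFun_bind₁]
    congr 1
    ext l
    simp [polyFun_sub, polyFun_mul, polyFun_baryPoly]

theorem isL2Proj_face_of_isRTSol {w : VectorField (n + 1)}
    {W : Fin (n + 2) → VectorField (n + 1)} {q p : Fin (n + 1) → MvPolynomial (Fin (n + 1)) ℝ}
    {r : MvPolynomial (Fin (n + 1)) ℝ} (hq : IsRTSol B k w W q)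
    (hp : ∀ l, (p l).totalDegree ≤ k) (hr : r.totalDegree ≤ k)
    (hqp : ∀ l, q l = p l + MvPolynomial.X l * r) (i : Fin (n + 2)) :
    ∃ f : MvPolynomial (Fin (n + 1)) ℝ,
      (∀ x, ∑ l, polyFun (q l) x * baryGrad B i l = polyFun f x + B.coord i x * polyFun r x) ∧
      IsL2Proj (simplexMeasure (faceVerts B i)) k (fun x => ∑ l, W i l x * baryGrad B i l) f := by
  set f := ∑ l, MvPolynomial.C (baryGrad B i l) * p l - MvPolynomial.C (B.coord i 0) * r with hfdef
  have hdot : ∀ x, ∑ l, polyFun (q l) x * baryGrad B i l =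
      polyFun f x + B.coord i x * polyFun r x := by
    intro x
    have e1 : ∀ l, polyFun (q l) x * baryGrad B i l =
        baryGrad B i l * polyFun (p l) x + (baryGrad B i l * x l) * polyFun r x := by
      intro l
      rw [hqp l, polyFun_add, polyFun_mul, polyFun_X]; ring
    simp only [e1, Finset.sum_add_distrib, ← Finset.sum_mul]
    rw [coord_eq i x, hfdef, polyFun_sub, polyFun_mul, polyFun_C, polyFun_sum]
    simp only [polyFun_mul, polyFun_C]
    ring
  refine ⟨f, hdot, ?_, fun m hm => ?_⟩
  · refine (MvPolynomial.totalDegree_sub _ _).trans (max_le ?_ (totalDegree_C_mul_le _ hr))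
    exact totalDegree_sum_le _ fun l _ => totalDegree_C_mul_le _ (hp l)
  · rw [← hq.2.1 i m hm]
    refine integral_congr_ae ?_
    filter_upwards [ae_mem_convexHull (faceVerts B i)] with x hx
    rw [hdot, coord_faceVerts i hx, zero_mul, add_zero]

theorem abs_coord_sub_le_diam (j : Fin (n + 2)) {x : Pt (n + 1)}
    (hx : x ∈ convexHull ℝ (Set.range B)) (l : Fin (n + 1)) :
    |B j l - x l| ≤ Metric.diam (convexHull ℝ (Set.range B)) := by
  have h := PiLp.norm_apply_le (B j - x) l
  exact h.trans (dist_le_diam_convexHull B (subset_convexHull ℝ _ ⟨j, rfl⟩) hx)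

/-- The Raviart–Thomas projection is stable on shape-regular elements. -/
theorem exists_isRTSol_bound (n k : ℕ) (hk : 1 ≤ k) {M : ℝ} (hM : 0 ≤ M) : ∃ K ≥ (0 : ℝ),
    ∀ (B : AffineBasis (Fin (n + 2)) ℝ (Pt (n + 1))) (w : VectorField (n + 1))
      (W : Fin (n + 2) → VectorField (n + 1)) (q : Fin (n + 1) → MvPolynomial (Fin (n + 1)) ℝ)
      (G : ℝ), 0 ≤ G → (∀ i l, |baryGrad B i l| ≤ G) →
      Metric.diam (convexHull ℝ (Set.range B)) * G ≤ M →
      (∀ l, MemLp (w l) 2 (simplexMeasure B)) →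
      (∀ i l, MemLp (W i l) 2 (simplexMeasure (faceVerts B i))) → IsRTSol B k w W q →
      ∀ l, ∀ x ∈ convexHull ℝ (Set.range B), |polyFun (q l) x| ≤
        K * (∑ l, l2Norm (simplexMeasure B) (w l) +
          ∑ i, ∑ l, l2Norm (simplexMeasure (faceVerts B i)) (W i l)) := by
  obtain ⟨C₁, hC₁, hsup⟩ := exists_sup_bound n k
  obtain ⟨C₂, hC₂, hgap⟩ := exists_abs_sub_le_baryForm n (k - 1)
  refine ⟨(n + 2) * C₂ ^ 2 * M * (1 + (n + 1) * C₁ * M) + C₁ * M, by positivity,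
    fun B w W q G hG hgG hhG hw hW hq => ?_⟩
  set h := Metric.diam (convexHull ℝ (Set.range B)) with hh
  have hh0 : 0 ≤ h := Metric.diam_nonneg
  set W₀ := ∑ l, l2Norm (simplexMeasure B) (w l) with hW₀
  set ζ : Fin (n + 2) → ℝ := fun i =>
    ∑ l, l2Norm (simplexMeasure (faceVerts B i)) (W i l) with hζ
  have hω0 : ∀ i, 0 ≤ ζ i := fun i => Finset.sum_nonneg fun _ _ => l2Norm_nonneg _ _
  have hW₀0 : 0 ≤ W₀ := Finset.sum_nonneg fun _ _ => l2Norm_nonneg _ _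
  set Ω := ∑ i, ζ i with hΩ
  have hΩ0 : 0 ≤ Ω := Finset.sum_nonneg fun i _ => hω0 i
  obtain ⟨p, r, hp, hr, hqp⟩ := hq.1
  choose f hdot hfp using fun i => isL2Proj_face_of_isRTSol hq hp hr hqp i
  choose E t htdeg hfE hEval using fun i => exists_face_extension (B := B) i (hfp i).1
  have hEb : ∀ i, ∀ x ∈ convexHull ℝ (Set.range B), |polyFun (E i) x| ≤ C₁ * (G * ζ i) := by
    intro i x hx
    obtain ⟨y, hy, hxy⟩ := hEval i x hx
    rw [hxy]
    have hWg : ∀ l, MemLp (fun x => W i l x * baryGrad B i l) 2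
      (simplexMeasure (faceVerts B i)) := fun l => (hW i l).mul_const _
    refine (hsup (n + 1) (faceVerts B i) (f i) (hfp i).1 y hy).trans
      (mul_le_mul_of_nonneg_left ?_ hC₁)
    refine ((hfp i).l2Norm_le (memLp_finset_sum _ fun l _ => hWg l)).trans
      ((l2Norm_sum_le _ fun l _ => hWg l).trans ?_)
    rw [hζ, Finset.mul_sum]
    refine Finset.sum_le_sum fun l _ => ?_
    have e1 : (fun x => W i l x * baryGrad B i l) = fun x => baryGrad B i l * W i l x :=
      funext fun x => mul_comm _ _
    rw [e1, l2Norm_const_mul]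
    exact mul_le_mul_of_nonneg_right (hgG i l) (l2Norm_nonneg _ _)
  obtain ⟨z, hz⟩ : ∃ z : Fin (n + 1) → Pt (n + 1) → ℝ,
      ∀ l x, z l x = ∑ i, polyFun (E i) x * (B i l - x l) := ⟨_, fun _ _ => rfl⟩
  have hzb : ∀ l, ∀ x ∈ convexHull ℝ (Set.range B), |z l x| ≤ C₁ * (h * G) * Ω := by
    intro l x hx
    rw [hz, hΩ, Finset.mul_sum]
    refine (Finset.abs_sum_le_sum_abs _ _).trans (Finset.sum_le_sum fun i _ => ?_)
    rw [abs_mul]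
    calc _ ≤ C₁ * (G * ζ i) * h := mul_le_mul (hEb i x hx) (abs_coord_sub_le_diam i hx l)
          (abs_nonneg _) (mul_nonneg hC₁ (mul_nonneg hG (hω0 i)))
      _ = _ := by ring
  have hzc : ∀ l, Continuous (z l) := by
    intro l
    have : z l = fun x => ∑ i, polyFun (E i) x * (B i l - x l) := funext (hz l)
    rw [this]
    exact continuous_finsetSum _ fun i _ => (continuous_polyFun _).mul (by fun_prop)
  obtain ⟨S, hS⟩ : ∃ S : Pt (n + 1) → ℝ, ∀ x, S x = ∑ j, B.coord j x * polyFun (t j) x :=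
    ⟨_, fun _ => rfl⟩
  have hdot2 : ∀ i x, ∑ l, (polyFun (q l) x - z l x) * baryGrad B i l =
      B.coord i x * (polyFun (t i) x - S x) := by
    have hd : ∀ i x, ∑ l, (polyFun (q l) x - z l x) * baryGrad B i l =
        B.coord i x * polyFun (t i) x +
          B.coord i x * (polyFun r x + ∑ j, polyFun (E j) x) := by
      intro i x
      simp only [sub_mul, Finset.sum_sub_distrib, hdot i x, hz, sum_vertex_mul_baryGrad]
      have := congrArg (fun P => polyFun P x) (hfE i)
      simp only [polyFun_add, polyFun_mul, polyFun_baryPoly] at this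
      rw [this]; ring
    intro i x
    have h1 : ∑ i, ∑ l, (polyFun (q l) x - z l x) * baryGrad B i l = 0 := by
      rw [Finset.sum_comm]
      simp only [← Finset.mul_sum, sum_baryGrad, mul_zero, Finset.sum_const_zero]
    simp only [hd, Finset.sum_add_distrib, ← Finset.sum_mul, B.sum_coord_apply_eq_one, one_mul,
      ← hS] at h1
    rw [hd i x, mul_sub]
    have : polyFun r x + ∑ j, polyFun (E j) x = -S x := by linarith
    rw [this]; ring
  have hSsum : ∀ x, ∑ i, B.coord i x * (polyFun (t i) x - S x) = 0 := by
    intro x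
    simp only [mul_sub, Finset.sum_sub_distrib, ← Finset.sum_mul, B.sum_coord_apply_eq_one, ← hS]
    ring
  set β := Real.sqrt (baryForm B t t) with hβ
  have hβ0 : 0 ≤ β := Real.sqrt_nonneg _
  have hD := fun i j x hx => hgap B t htdeg i j x hx
  have htS : ∀ i, ∀ x ∈ convexHull ℝ (Set.range B), |polyFun (t i) x - S x| ≤ C₂ * β := by
    intro i x hx
    have e1 : polyFun (t i) x - S x = ∑ j, B.coord j x * (polyFun (t i) x - polyFun (t j) x) := by
      simp only [mul_sub, Finset.sum_sub_distrib, ← Finset.sum_mul, B.sum_coord_apply_eq_one,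
        one_mul, ← hS]
    rw [e1]
    refine (Finset.abs_sum_le_sum_abs _ _).trans ?_
    calc ∑ j, |B.coord j x * (polyFun (t i) x - polyFun (t j) x)|
        ≤ ∑ j, B.coord j x * (C₂ * β) := Finset.sum_le_sum fun j _ => by
          rw [abs_mul, abs_of_nonneg (coord_nonneg hx j)]
          exact mul_le_mul_of_nonneg_left (hD i j x hx) (coord_nonneg hx j)
      _ = C₂ * β := by rw [← Finset.sum_mul, B.sum_coord_apply_eq_one, one_mul]
  have hqz : ∀ l, ∀ x ∈ convexHull ℝ (Set.range B), |polyFun (q l) x - z l x| ≤ C₂ * β * h := by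
    intro l x hx
    have e1 : polyFun (q l) x - z l x =
        ∑ i, B.coord i x * (polyFun (t i) x - S x) * (B i l - x l) := by
      have h1 := sum_baryGrad_smul (B := B) (WithLp.toLp 2 fun l => polyFun (q l) x - z l x) l
      have h2 : ∀ i, ∑ l, baryGrad B i l * (polyFun (q l) x - z l x) =
          B.coord i x * (polyFun (t i) x - S x) := fun i => by
        rw [← hdot2 i x]
        exact Finset.sum_congr rfl fun l _ => mul_comm _ _
      simp only [h2] at h1
      rw [← h1]
      simp only [mul_sub (_ * _) _ (x l), Finset.sum_sub_distrib]
      rw [← Finset.sum_mul, hSsum, zero_mul, sub_zero]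
    rw [e1]
    refine (Finset.abs_sum_le_sum_abs _ _).trans ?_
    calc ∑ i, |B.coord i x * (polyFun (t i) x - S x) * (B i l - x l)|
        ≤ ∑ i, B.coord i x * (C₂ * β * h) := Finset.sum_le_sum fun i _ => by
          rw [abs_mul, abs_mul, abs_of_nonneg (coord_nonneg hx i), mul_assoc]
          exact mul_le_mul_of_nonneg_left (mul_le_mul (htS i x hx) (abs_coord_sub_le_diam i hx l)
            (abs_nonneg _) (mul_nonneg hC₂ hβ0)) (coord_nonneg hx i)
      _ = C₂ * β * h := by rw [← Finset.sum_mul, B.sum_coord_apply_eq_one, one_mul]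
  set m : Fin (n + 1) → MvPolynomial (Fin (n + 1)) ℝ := fun l =>
    ∑ i, MvPolynomial.C (baryGrad B i l) * t i with hm
  have hmdeg : ∀ l, (m l).totalDegree < k := fun l =>
    lt_of_le_of_lt (totalDegree_sum_le _ fun i _ => totalDegree_C_mul_le _ (htdeg i))
      (Nat.sub_lt hk one_pos)
  have hmval : ∀ l x, polyFun (m l) x = ∑ i, baryGrad B i l * polyFun (t i) x := fun l x => by
    simp [hm, polyFun_sum, polyFun_mul]
  have hmb : ∀ l, ∀ x ∈ convexHull ℝ (Set.range B), |polyFun (m l) x| ≤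
      (n + 2) * (G * (C₂ * β)) := by
    intro l x hx
    have e1 : polyFun (m l) x = ∑ i, baryGrad B i l * (polyFun (t i) x - polyFun (t 0) x) := by
      simp only [mul_sub, Finset.sum_sub_distrib, ← Finset.sum_mul, sum_baryGrad, zero_mul,
        sub_zero, hmval]
    rw [e1]
    refine (Finset.abs_sum_le_sum_abs _ _).trans ?_
    calc ∑ i, |baryGrad B i l * (polyFun (t i) x - polyFun (t 0) x)|
        ≤ ∑ _i : Fin (n + 2), G * (C₂ * β) := Finset.sum_le_sum fun i _ => by
          rw [abs_mul]
          exact mul_le_mul (hgG i l) (hD i 0 x hx) (abs_nonneg _) hG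
      _ = _ := by simp
  have hmL : ∀ l, l2Norm (simplexMeasure B) (polyFun (m l)) ≤ (n + 2) * (G * (C₂ * β)) := fun l =>
    l2Norm_le_of_bound (by positivity) ((ae_mem_convexHull B).mono fun x hx => hmb l x hx)
  have hform : baryForm B t t = ∫ x, ∑ l, w l x * polyFun (m l) x ∂simplexMeasure B -
      ∫ x, ∑ l, z l x * polyFun (m l) x ∂simplexMeasure B := by
    rw [← hq.2.2 m hmdeg, ← integral_sub, baryForm]
    · congr 1; funext x
      simp only [← hS, ← hdot2]
      rw [← Finset.sum_sub_distrib]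
      simp only [← sub_mul, hmval, Finset.mul_sum, Finset.sum_mul]
      rw [Finset.sum_comm]
      refine Finset.sum_congr rfl fun l _ => ?_
      rw [← Finset.sum_sub_distrib]
      exact Finset.sum_congr rfl fun i _ => by ring
    · exact integrable_finsetSum _ fun l _ =>
        (memLp_polyFun B (q l)).integrable_mul (memLp_polyFun B (m l))
    · exact integrable_simplexMeasure B (continuous_finsetSum _ fun l _ =>
        (hzc l).mul (continuous_polyFun _))
  have hI : ∀ {v : VectorField (n + 1)}, (∀ l, MemLp (v l) 2 (simplexMeasure B)) →
      |∫ x, ∑ l, v l x * polyFun (m l) x ∂simplexMeasure B| ≤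
        (∑ l, l2Norm (simplexMeasure B) (v l)) * ((n + 2) * (G * (C₂ * β))) := by
    intro v hv
    have i1 : ∀ l, Integrable (fun x => v l x * polyFun (m l) x) (simplexMeasure B) := fun l =>
      (hv l).integrable_mul (memLp_polyFun B (m l))
    rw [integral_finsetSum _ fun l _ => i1 l, Finset.sum_mul]
    refine (Finset.abs_sum_le_sum_abs _ _).trans (Finset.sum_le_sum fun l _ => ?_)
    exact (abs_integral_mul_le (hv l) (memLp_polyFun B (m l))).trans
      (mul_le_mul_of_nonneg_left (hmL l) (l2Norm_nonneg _ _))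
  have hzL : ∑ l, l2Norm (simplexMeasure B) (z l) ≤ (n + 1) * (C₁ * M * Ω) := by
    calc ∑ l, l2Norm (simplexMeasure B) (z l) ≤ ∑ _l : Fin (n + 1), C₁ * M * Ω :=
          Finset.sum_le_sum fun l _ => l2Norm_le_of_bound (by positivity)
            ((ae_mem_convexHull B).mono fun x hx => (hzb l x hx).trans (by gcongr))
      _ = _ := by simp
  have hβb : β ≤ (n + 2) * C₂ * G * (W₀ + (n + 1) * (C₁ * M * Ω)) := by
    rcases hβ0.eq_or_lt with h0 | h0
    · rw [← h0]; positivity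
    have h1 : β * β = baryForm B t t := Real.mul_self_sqrt (Real.sqrt_pos.1 h0).le
    have h2 : β * β ≤ ((n + 2) * C₂ * G * (W₀ + (n + 1) * (C₁ * M * Ω))) * β := by
      rw [h1, hform]
      have a1 := (abs_le.1 (hI hw)).2
      have a2 := (abs_le.1 (hI fun l => memLp_simplexMeasure B (hzc l) 2)).1
      have a3 : (∑ l, l2Norm (simplexMeasure B) (z l)) * ((n + 2) * (G * (C₂ * β))) ≤
          (n + 1) * (C₁ * M * Ω) * ((n + 2) * (G * (C₂ * β))) :=
        mul_le_mul_of_nonneg_right hzL (by positivity)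
      have a4 : ((n + 2) * C₂ * G * (W₀ + (n + 1) * (C₁ * M * Ω))) * β =
          W₀ * ((n + 2) * (G * (C₂ * β))) + (n + 1) * (C₁ * M * Ω) * ((n + 2) * (G * (C₂ * β))) := by
        ring
      rw [a4]
      linarith
    exact le_of_mul_le_mul_right h2 h0
  intro l x hx
  have b1 : |polyFun (q l) x| ≤ |polyFun (q l) x - z l x| + |z l x| := by
    have := abs_add_le (polyFun (q l) x - z l x) (z l x)
    simpa using this
  have b2 : C₂ * β * h ≤ (n + 2) * C₂ ^ 2 * M * (W₀ + (n + 1) * (C₁ * M * Ω)) := by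
    calc C₂ * β * h ≤ C₂ * ((n + 2) * C₂ * G * (W₀ + (n + 1) * (C₁ * M * Ω))) * h := by gcongr
      _ = (n + 2) * C₂ ^ 2 * (h * G) * (W₀ + (n + 1) * (C₁ * M * Ω)) := by ring
      _ ≤ _ := by gcongr
  have b3 : |z l x| ≤ C₁ * M * Ω := (hzb l x hx).trans (by gcongr)
  have b4 : W₀ + (n + 1) * (C₁ * M * Ω) ≤ (1 + (n + 1) * C₁ * M) * (W₀ + Ω) := by
    have : 0 ≤ (n + 1) * C₁ * M * W₀ := by positivity
    nlinarith
  have b5 : (n + 2) * C₂ ^ 2 * M * (W₀ + (n + 1) * (C₁ * M * Ω)) ≤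
      (n + 2) * C₂ ^ 2 * M * ((1 + (n + 1) * C₁ * M) * (W₀ + Ω)) :=
    mul_le_mul_of_nonneg_left b4 (by positivity)
  have b6 : C₁ * M * Ω ≤ C₁ * M * (W₀ + Ω) := by gcongr; linarith
  calc |polyFun (q l) x| ≤ _ := b1
    _ ≤ (n + 2) * C₂ ^ 2 * M * ((1 + (n + 1) * C₁ * M) * (W₀ + Ω)) + C₁ * M * (W₀ + Ω) :=
        add_le_add ((hqz l x hx).trans (b2.trans b5)) (b3.trans b6)
    _ = _ := by ring

end

end HDG

end

noncomputable section

namespace HDG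

/-! ### Projection errors on the faces of an element -/

section

variable {n k : ℕ} {B : AffineBasis (Fin (n + 2)) ℝ (Pt (n + 1))} {T F : Finset (Pt (n + 1))}
  {i : Fin (n + 2)} {w : VectorField (n + 1)} {W : Fin (n + 2) → VectorField (n + 1)}
  {q p : Fin (n + 1) → MvPolynomial (Fin (n + 1)) ℝ}

theorem IsRTSol.sub (hw : ∀ l, MemLp (w l) 2 (simplexMeasure B))
    (hW : ∀ i l, MemLp (W i l) 2 (simplexMeasure (faceVerts B i))) (hq : IsRTSol B k w W q)
    (hp : ∀ l, (p l).totalDegree ≤ k) :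
    IsRTSol B k (fun l x => w l x - polyFun (p l) x) (fun i l x => W i l x - polyFun (p l) x)
      (fun l => q l - p l) := by
  refine ⟨?_, fun i m hm => ?_, fun m hm => ?_⟩
  · obtain ⟨p', r, hp', hr, hq'⟩ := hq.1
    refine ⟨fun l => p' l - p l, r, fun l =>
      (MvPolynomial.totalDegree_sub _ _).trans (max_le (hp' l) (hp l)), hr, fun l => ?_⟩
    simp only [hq']; ring
  · have i1 : ∀ {v : VectorField (n + 1)},
        (∀ l, MemLp (v l) 2 (simplexMeasure (faceVerts B i))) → Integrable
        (fun x => (∑ l, v l x * baryGrad B i l) * polyFun m x) (simplexMeasure (faceVerts B i)) := by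
      intro v hv
      have : MemLp (fun x => ∑ l, v l x * baryGrad B i l) 2 (simplexMeasure (faceVerts B i)) :=
        memLp_finset_sum _ fun l _ => (hv l).mul_const _
      exact this.integrable_mul (memLp_polyFun _ m)
    simp only [polyFun_sub, sub_mul, Finset.sum_sub_distrib]
    rw [integral_sub (i1 fun l => memLp_polyFun _ (q l)) (i1 fun l => memLp_polyFun _ (p l)),
      integral_sub (i1 (hW i)) (i1 fun l => memLp_polyFun _ (p l)), hq.2.1 i m hm]
  · have i1 : ∀ {v : VectorField (n + 1)}, (∀ l, MemLp (v l) 2 (simplexMeasure B)) →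
        Integrable (fun x => ∑ l, v l x * polyFun (m l) x) (simplexMeasure B) := fun hv =>
      integrable_finsetSum _ fun l _ => (hv l).integrable_mul (memLp_polyFun B (m l))
    simp only [polyFun_sub, sub_mul, Finset.sum_sub_distrib]
    rw [integral_sub (i1 fun l => memLp_polyFun _ (q l)) (i1 fun l => memLp_polyFun _ (p l)),
      integral_sub (i1 hw) (i1 fun l => memLp_polyFun _ (p l)), hq.2.2 m hm]

theorem exists_face_moment_eq (H : IsElement B T)
    (hF : (F : Set (Pt (n + 1))) = Set.range (faceVerts B i)) :
    ∃ c : ℝ, c ≠ 0 ∧ ∀ (v : VectorField (n + 1)) (m : Pt (n + 1) → ℝ),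
      ∫ x, (∑ l, v l x * outwardNormal T F l) * m x ∂faceMeasure F =
        c * ∫ x, (∑ l, v l x * baryGrad B i l) * m x ∂simplexMeasure (faceVerts B i) := by
  obtain ⟨γ, hγ, hn⟩ := exists_outwardNormal_eq H hF
  have hv := simplexVol_pos (affineIndependent_faceVerts H.indep i)
  refine ⟨simplexVol (faceVerts B i) * γ, mul_ne_zero hv.ne' hγ, fun v m => ?_⟩
  rw [faceMeasure_eq hF, integral_smul_measure, ENNReal.toReal_ofReal hv.le, smul_eq_mul, mul_assoc,
    ← integral_const_mul γ]
  congr 2; funext x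
  rw [← mul_assoc, Finset.mul_sum]
  congr 1
  exact Finset.sum_congr rfl fun l _ => by rw [hn l]; ring

theorem IsElement.isRTProj_iff (H : IsElement B T) {Fc : Fin (n + 2) → Finset (Pt (n + 1))}
    (hFc : ∀ i, (Fc i : Set (Pt (n + 1))) = Set.range (faceVerts B i)) :
    IsRTProj k T w q ↔ IsRTSol B k w (fun i l => faceTrace T (Fc i) (w l)) q := by
  refine and_congr_right fun _ => and_congr ?_ ?_
  · constructor
    · intro h i m hm
      obtain ⟨c, hc, hcm⟩ := exists_face_moment_eq H (hFc i)
      have := h (Fc i) (H.face_mem (hFc i)) m hm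
      rw [hcm (fun l x => polyFun (q l) x), hcm (fun l => faceTrace T (Fc i) (w l))] at this
      exact mul_left_cancel₀ hc this
    · intro h F hF m hm
      obtain ⟨i, hi⟩ := H.exists_face hF
      obtain rfl : F = Fc i := by rw [← Finset.coe_inj, hi, hFc i]
      obtain ⟨c, hc, hcm⟩ := exists_face_moment_eq H (hFc i)
      rw [hcm (fun l x => polyFun (q l) x), hcm (fun l => faceTrace T (Fc i) (w l)), h i m hm]
  · refine forall_congr' fun m => imp_congr_right fun _ => ?_
    rw [H.elementMeasure_eq, integral_smul_measure, integral_smul_measure,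
      ENNReal.toReal_ofReal (simplexVol_pos H.indep).le]
    simp [(simplexVol_pos H.indep).ne']

theorem IsElement.exists_rtProj (H : IsElement B T) (hk : 1 ≤ k)
    {Fc : Fin (n + 2) → Finset (Pt (n + 1))}
    (hFc : ∀ i, (Fc i : Set (Pt (n + 1))) = Set.range (faceVerts B i))
    (hw : ∀ l, MemSobolev (interior (hull T)) 1 (w l)) :
    ∃ q, IsRTSol B k w (fun i l => faceTrace T (Fc i) (w l)) q ∧
      rtProj k T w = fun l => polyFun (q l) := by
  have h : ∃ q, IsRTProj k T w q := by
    obtain ⟨q, hq⟩ := exists_isRTSol (B := B) hk (fun l => H.memLp (hw l))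
      (fun i l => H.memLp_faceTrace (hFc i) (hw l))
    exact ⟨q, (H.isRTProj_iff hFc).2 hq⟩
  exact ⟨h.choose, (H.isRTProj_iff hFc).1 h.choose_spec, by rw [rtProj, dif_pos h]⟩

theorem faceTrace_sub_polyFun (H : IsElement B T)
    (hF : (F : Set (Pt (n + 1))) = Set.range (faceVerts B i)) {f : Pt (n + 1) → ℝ}
    (hf : MemSobolev (interior (hull T)) 1 f) (P : MvPolynomial (Fin (n + 1)) ℝ) :
    faceTrace T F (fun x => f x - polyFun P x) =ᵐ[simplexMeasure (faceVerts B i)]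
      fun x => faceTrace T F f x - polyFun P x := by
  have hs := memSobolev_one_of_contDiff T (contDiff_polyFun P)
  filter_upwards [H.faceTrace_sub hF hf hs,
    H.faceTrace_of_contDiff hF (contDiff_polyFun P) (ae_eq_refl _)] with x h1 h2
  rw [h1, h2]

/-- The trace of `P - f` for a polynomial `P`, compared with another polynomial. -/
theorem l2Norm_faceTrace_polyFun_sub_le (H : IsElement B T)
    (hF : (F : Set (Pt (n + 1))) = Set.range (faceVerts B i)) {f : Pt (n + 1) → ℝ}
    (hf : MemSobolev (interior (hull T)) 1 f) (P Q : MvPolynomial (Fin (n + 1)) ℝ) {R : ℝ}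
    (hR : 0 ≤ R) (hPQ : ∀ x ∈ convexHull ℝ (Set.range B), |polyFun (P - Q) x| ≤ R) :
    l2Norm (simplexMeasure (faceVerts B i)) (faceTrace T F fun x => polyFun P x - f x) ≤
      R + traceConst n * h1Norm B T fun x => f x - polyFun Q x := by
  have hs := fun P => memSobolev_one_of_contDiff T (contDiff_polyFun (d := n + 1) P)
  have e1 : (faceTrace T F fun x => polyFun P x - f x) =ᵐ[simplexMeasure (faceVerts B i)]
      fun x => polyFun (P - Q) x - faceTrace T F (fun x => f x - polyFun Q x) x := by
    filter_upwards [H.faceTrace_sub hF (hs P) hf, faceTrace_sub_polyFun H hF hf Q,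
      H.faceTrace_of_contDiff hF (contDiff_polyFun P) (ae_eq_refl _)] with x h1 h2 h3
    rw [h1, h2, h3, polyFun_sub]; ring
  rw [l2Norm_congr_ae e1]
  refine (l2Norm_sub_le (memLp_polyFun _ _)
    (H.memLp_faceTrace hF (hf.sub (hs Q)))).trans (add_le_add ?_ ?_)
  · refine l2Norm_le_of_bound hR ((ae_mem_convexHull _).mono fun x hx => hPQ x ?_)
    refine convexHull_mono ?_ hx
    rintro _ ⟨j, rfl⟩
    exact ⟨_, rfl⟩
  · exact H.l2Norm_faceTrace_le hF (hf.sub (hs Q))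

theorem l2Norm_le_h1Norm (b : Fin (n + 2) → Pt (n + 1)) (T : Finset (Pt (n + 1)))
    (f : Pt (n + 1) → ℝ) : l2Norm (simplexMeasure b) f ≤ h1Norm b T f :=
  le_add_of_nonneg_right (mul_nonneg (elementDiam_nonneg T)
    (Finset.sum_nonneg fun _ _ => l2Norm_nonneg _ _))

theorem exists_elementProj_error (n k : ℕ) : ∃ C ≥ (0 : ℝ),
    ∀ (B : AffineBasis (Fin (n + 2)) ℝ (Pt (n + 1))) (T F : Finset (Pt (n + 1)))
      (i : Fin (n + 2)), IsElement B T → (F : Set (Pt (n + 1))) = Set.range (faceVerts B i) →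
      ∀ f, MemSobolev (interior (hull T)) 1 f →
      ∀ Q : MvPolynomial (Fin (n + 1)) ℝ, Q.totalDegree ≤ k →
        l2Norm (simplexMeasure (faceVerts B i))
          (faceTrace T F fun x => elementProj k T f x - f x) ≤
            C * h1Norm B T fun x => f x - polyFun Q x := by
  obtain ⟨C, hC, hsup⟩ := exists_sup_bound (n + 1) k
  refine ⟨C + traceConst n, add_nonneg hC (Real.sqrt_nonneg _), fun B T F i H hF f hf Q hQ => ?_⟩
  obtain ⟨P, hP, hPe⟩ := isL2Proj_l2Proj (simplexVol_pos H.indep) H.elementMeasure_eq k (H.memLp hf)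
  have hP' := hP.sub (H.memLp hf) hQ
  have hb := hP'.l2Norm_le ((H.memLp hf).sub (memLp_polyFun B Q))
  have h := l2Norm_faceTrace_polyFun_sub_le H hF hf P Q
    (R := C * h1Norm B T fun x => f x - polyFun Q x)
    (mul_nonneg hC (h1Norm_nonneg _ _ _)) fun x hx =>
      (hsup (n + 1) B (P - Q) hP'.1 x hx).trans
        (mul_le_mul_of_nonneg_left (hb.trans (l2Norm_le_h1Norm _ _ _)) hC)
  rw [elementProj, hPe, add_mul]
  exact h

theorem exists_rtProj_error (n k : ℕ) (hk : 1 ≤ k) (σ : ℝ) : ∃ C ≥ (0 : ℝ),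
    ∀ (B : AffineBasis (Fin (n + 2)) ℝ (Pt (n + 1))) (T F : Finset (Pt (n + 1)))
      (i : Fin (n + 2)), IsElement B T → elementDiam T ≤ σ * inscribedDiam T →
      (F : Set (Pt (n + 1))) = Set.range (faceVerts B i) →
      ∀ w : VectorField (n + 1), (∀ l, MemSobolev (interior (hull T)) 1 (w l)) →
      ∀ Q : Fin (n + 1) → MvPolynomial (Fin (n + 1)) ℝ, (∀ l, (Q l).totalDegree ≤ k) → ∀ l,
        l2Norm (simplexMeasure (faceVerts B i))
          (faceTrace T F fun x => rtProj k T w l x - w l x) ≤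
            C * ∑ l, h1Norm B T fun x => w l x - polyFun (Q l) x := by
  obtain ⟨K, hK, hstab⟩ := exists_isRTSol_bound n k hk (M := 2 * |σ|) (by positivity)
  have htc : 0 ≤ traceConst n := Real.sqrt_nonneg _
  refine ⟨K * (1 + (n + 2) * traceConst n) + traceConst n, by positivity,
    fun B T F i H hσ hF w hw Q hQ l => ?_⟩
  choose Fc hFc using exists_finset_face (B : Fin (n + 2) → Pt (n + 1))
  obtain ⟨q, hq, hqe⟩ := H.exists_rtProj hk hFc hw
  have hs := fun P => memSobolev_one_of_contDiff T (contDiff_polyFun (d := n + 1) P)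
  have hL := fun l => H.memLp (hw l)
  have hLF := fun i l => H.memLp_faceTrace (hFc i) (hw l)
  obtain ⟨hσ0, c, δ, hδ, hball, hh⟩ := H.exists_ball hσ
  set N := ∑ l, h1Norm B T fun x => w l x - polyFun (Q l) x with hN
  have hN0 : 0 ≤ N := Finset.sum_nonneg fun _ _ => h1Norm_nonneg _ _ _
  have hNl : ∀ l, (h1Norm B T fun x => w l x - polyFun (Q l) x) ≤ N := fun l =>
    Finset.single_le_sum (f := fun l => h1Norm B T fun x => w l x - polyFun (Q l) x)
      (fun _ _ => h1Norm_nonneg _ _ _) (Finset.mem_univ l)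
  have hb : ∀ x ∈ convexHull ℝ (Set.range B),
      |polyFun (q l - Q l) x| ≤ K * ((1 + (n + 2) * traceConst n) * N) := by
    intro x hx
    refine (hstab B _ _ _ (1 / δ) (by positivity) (fun i l => abs_baryGrad_le hδ hball i l) ?_
      (fun l => (hL l).sub (memLp_polyFun B (Q l)))
      (fun i l => (hLF i l).sub (memLp_polyFun _ (Q l))) (hq.sub hL hLF hQ) l x hx).trans
      (mul_le_mul_of_nonneg_left ?_ hK)
    · rw [← H.elementDiam_eq, mul_one_div, div_le_iff₀ hδ, abs_of_pos hσ0]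
      exact hh
    · have h1 : ∑ l, l2Norm (simplexMeasure B) (w l - polyFun (Q l)) ≤ N :=
        Finset.sum_le_sum fun l _ => l2Norm_le_h1Norm B T _
      have h2 : ∑ i, ∑ l, l2Norm (simplexMeasure (faceVerts B i))
          (fun x => faceTrace T (Fc i) (w l) x - polyFun (Q l) x) ≤
          (n + 2) * (traceConst n * N) := by
        calc _ ≤ ∑ _i : Fin (n + 2), traceConst n * N := by
              refine Finset.sum_le_sum fun i _ => ?_
              rw [hN, Finset.mul_sum]
              refine Finset.sum_le_sum fun l _ => ?_
              rw [← l2Norm_congr_ae (faceTrace_sub_polyFun H (hFc i) (hw l) (Q l))]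
              exact H.l2Norm_faceTrace_le (hFc i) ((hw l).sub (hs (Q l)))
          _ = _ := by simp
      have e : (1 + (n + 2) * traceConst n) * N = N + (n + 2) * (traceConst n * N) := by ring
      rw [e]
      exact add_le_add h1 h2
  have h := l2Norm_faceTrace_polyFun_sub_le H hF (hw l) (q l) (Q l)
    (mul_nonneg hK (mul_nonneg (by positivity) hN0)) hb
  rw [hqe]
  refine h.trans ?_
  have := mul_le_mul_of_nonneg_left (hNl l) htc
  nlinarith

/-- The error of the `L²`-projection on the faces. -/
theorem exists_elementProj_error_bound (n k : ℕ) (hk : 1 ≤ k) : ∃ C ≥ (0 : ℝ),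
    ∀ (B : AffineBasis (Fin (n + 2)) ℝ (Pt (n + 1))) (T F : Finset (Pt (n + 1)))
      (i : Fin (n + 2)), IsElement B T → (F : Set (Pt (n + 1))) = Set.range (faceVerts B i) →
      ∀ f, MemSobolev (interior (hull T)) k f →
        l2Norm (simplexMeasure (faceVerts B i))
          (faceTrace T F fun x => elementProj k T f x - f x) ≤
            C * (elementDiam T ^ k * ∑ α ∈ Finset.piAntidiag Finset.univ k,
              l2Norm (simplexMeasure B) (weakDeriv (interior (hull T)) α f)) := by
  obtain ⟨C₁, hC₁, h1⟩ := exists_elementProj_error n k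
  obtain ⟨C₂, hC₂, h2⟩ := exists_polynomial_approx n (k - 1)
  rw [Nat.sub_add_cancel hk] at h2
  refine ⟨C₁ * C₂, by positivity, fun B T F i H hF f hf => ?_⟩
  refine le_of_forall_pos_le_add fun ε hε => ?_
  obtain ⟨Q, hQ, hb⟩ := h2 B T H f hf (ε / (C₁ + 1)) (by positivity)
  refine (h1 B T F i H hF f (hf.mono subset_rfl hk) Q (hQ.trans (Nat.sub_le _ _))).trans ?_
  refine (mul_le_mul_of_nonneg_left hb hC₁).trans ?_
  rw [mul_add, ← mul_assoc]
  gcongr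
  rw [← mul_div_assoc, div_le_iff₀ (by positivity)]
  nlinarith

/-- The error of the Raviart–Thomas projection on the faces. -/
theorem exists_rtProj_error_bound (n k : ℕ) (hk : 1 ≤ k) (σ : ℝ) : ∃ C ≥ (0 : ℝ),
    ∀ (B : AffineBasis (Fin (n + 2)) ℝ (Pt (n + 1))) (T F : Finset (Pt (n + 1)))
      (i : Fin (n + 2)), IsElement B T → elementDiam T ≤ σ * inscribedDiam T →
      (F : Set (Pt (n + 1))) = Set.range (faceVerts B i) →
      ∀ w : VectorField (n + 1), (∀ l, MemSobolev (interior (hull T)) (k + 1) (w l)) → ∀ l,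
        l2Norm (simplexMeasure (faceVerts B i))
          (faceTrace T F fun x => rtProj k T w l x - w l x) ≤
            C * (elementDiam T ^ (k + 1) * ∑ l, ∑ α ∈ Finset.piAntidiag Finset.univ (k + 1),
              l2Norm (simplexMeasure B) (weakDeriv (interior (hull T)) α (w l))) := by
  obtain ⟨C₁, hC₁, h1⟩ := exists_rtProj_error n k hk σ
  obtain ⟨C₂, hC₂, h2⟩ := exists_polynomial_approx n k
  refine ⟨C₁ * C₂, by positivity, fun B T F i H hσ hF w hw l => ?_⟩
  refine le_of_forall_pos_le_add fun ε hε => ?_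
  choose Q hQ hb using fun l => h2 B T H (w l) (hw l) (ε / (C₁ * (n + 1) + 1)) (by positivity)
  refine (h1 B T F i H hσ hF w (fun l => (hw l).mono subset_rfl (by lia)) Q hQ l).trans ?_
  refine (mul_le_mul_of_nonneg_left (Finset.sum_le_sum fun l _ => hb l) hC₁).trans ?_
  rw [Finset.sum_add_distrib, ← Finset.mul_sum, ← Finset.mul_sum, mul_add, ← mul_assoc]
  gcongr
  simp only [Finset.sum_const, Finset.card_univ, Fintype.card_fin, nsmul_eq_mul]
  rw [← mul_div_assoc, ← mul_div_assoc, div_le_iff₀ (by positivity)]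
  push_cast
  nlinarith

end

end HDG

end

noncomputable section

namespace HDG

/-! ### Bounds on one face -/

section

variable {n k : ℕ} {B : AffineBasis (Fin (n + 2)) ℝ (Pt (n + 1))} {T F : Finset (Pt (n + 1))}
  {i : Fin (n + 2)} {Ω : Set (Pt (n + 1))}

theorem exists_faceProj_sub_le (n k : ℕ) : ∃ C ≥ (0 : ℝ),
    ∀ (B : AffineBasis (Fin (n + 2)) ℝ (Pt (n + 1))) (T F : Finset (Pt (n + 1)))
      (i : Fin (n + 2)), IsElement B T → (F : Set (Pt (n + 1))) = Set.range (faceVerts B i) →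
      ∀ (v : Pt (n + 1) → ℝ) (q : MvPolynomial (Fin (n + 1)) ℝ),
        v =ᵐ[simplexMeasure B] polyFun q →
        l2Norm (simplexMeasure (faceVerts B i))
          (fun x => faceProj k F (faceTrace T F v) x - faceTrace T F v x) ≤
            C * (elementDiam T * ∑ j, l2Norm (simplexMeasure B) (elementDeriv T j v)) := by
  have htc : 0 ≤ traceConst n := Real.sqrt_nonneg _
  have hpc : 0 ≤ poincareConst (n + 1) := Real.sqrt_nonneg _
  refine ⟨2 * (traceConst n * (poincareConst (n + 1) + 1)), by positivity,
    fun B T F i H hF v q hv => ?_⟩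
  have hqs := contDiff_polyFun q
  have htr := H.faceTrace_of_contDiff hF hqs hv
  have hvL : MemLp (faceTrace T F v) 2 (simplexMeasure (faceVerts B i)) :=
    (memLp_congr_ae htr).2 (memLp_polyFun _ q)
  obtain ⟨P, hP, hPe⟩ := isL2Proj_l2Proj
    (simplexVol_pos (affineIndependent_faceVerts H.indep i)) (faceMeasure_eq hF) k hvL
  rw [faceProj, hPe, l2Norm_sub_comm]
  set c := ∫ y, polyFun q y ∂simplexMeasure B with hc
  refine (hP.l2Norm_sub_le hvL (q := MvPolynomial.C c) (by simp)).trans ?_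
  have e1 : l2Norm (simplexMeasure (faceVerts B i))
      (fun x => faceTrace T F v x - polyFun (MvPolynomial.C c) x) =
      l2Norm (simplexMeasure (faceVerts B i)) (fun x => polyFun q x - c) := by
    refine l2Norm_congr_ae ?_
    filter_upwards [htr] with x hx
    rw [hx, polyFun_C]
  have hqc : ContDiff ℝ ∞ fun x => polyFun q x - c := hqs.sub contDiff_const
  have e2 : ∀ j, partialDeriv j (fun x => polyFun q x - c) = partialDeriv j (polyFun q) := by
    intro j; funext x; simp only [partialDeriv, fderiv_sub_const]
  have h1 := H.trace_le i hqc
  have h2 := l2Norm_sub_mean_le B hqs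
  rw [← H.elementDiam_eq] at h2
  simp only [e2] at h1
  have hvS : MemSobolev (interior (hull T)) 1 v :=
    (memSobolev_one_of_contDiff T hqs).congr isOpen_interior (H.ae_iff.2 hv.symm)
  have e3 : ∑ j, l2Norm (simplexMeasure B) (elementDeriv T j v) =
      ∑ j, l2Norm (simplexMeasure B) (partialDeriv j (polyFun q)) :=
    Finset.sum_congr rfl fun j _ => l2Norm_congr_ae
      ((H.elementDeriv_congr hvS hv j).trans (H.elementDeriv_of_contDiff hqs j))
  rw [e1, e3]
  set D := elementDiam T * ∑ j, l2Norm (simplexMeasure B) (partialDeriv j (polyFun q)) with hD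
  have h3 := mul_le_mul_of_nonneg_left (add_le_add_left h2 D) htc
  calc _ ≤ 2 * (traceConst n * (poincareConst (n + 1) * D + D)) := by
        refine mul_le_mul_of_nonneg_left (h1.trans h3) (by norm_num)
    _ = _ := by ring

theorem l2Norm_faceMeasure (H : IsElement B T)
    (hF : (F : Set (Pt (n + 1))) = Set.range (faceVerts B i)) (f : Pt (n + 1) → ℝ) :
    l2Norm (faceMeasure F) f =
      Real.sqrt (simplexVol (faceVerts B i)) * l2Norm (simplexMeasure (faceVerts B i)) f := by
  rw [faceMeasure_eq hF, l2Norm_smul_measure _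
    (simplexVol_pos (affineIndependent_faceVerts H.indep i)).le]

theorem l2Norm_elementMeasure (H : IsElement B T) (f : Pt (n + 1) → ℝ) :
    l2Norm (elementMeasure T) f = Real.sqrt (simplexVol B) * l2Norm (simplexMeasure B) f := by
  rw [H.elementMeasure_eq, l2Norm_smul_measure _ (simplexVol_pos H.indep).le]

/-- The Sobolev seminorm on one element. -/
def elementSeminorm (Ω : Set (Pt (n + 1))) (T : Finset (Pt (n + 1))) (m : ℕ)
    (u : VectorField (n + 1)) : ℝ :=
  Real.sqrt (∑ i, ∑ α ∈ Finset.piAntidiag (Finset.univ : Finset (Fin (n + 1))) m,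
    ∫ x, weakDeriv Ω α (u i) x ^ 2 ∂elementMeasure T)

/-- The norm of the gradient on one element. -/
def elementGradNorm (T : Finset (Pt (n + 1))) (v : VectorField (n + 1)) : ℝ :=
  Real.sqrt (∫ x, ∑ i, ∑ j, elementDeriv T j (v i) x ^ 2 ∂elementMeasure T)

theorem l2Norm_le_elementSeminorm (T : Finset (Pt (n + 1))) (u : VectorField (n + 1)) {m : ℕ}
    (l : Fin (n + 1)) {α : Fin (n + 1) → ℕ} (hα : ∑ i, α i = m) :
    l2Norm (elementMeasure T) (weakDeriv Ω α (u l)) ≤ elementSeminorm Ω T m u := by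
  refine Real.sqrt_le_sqrt ?_
  have h0 : ∀ l α, 0 ≤ ∫ x, weakDeriv Ω α (u l) x ^ 2 ∂elementMeasure T := fun l α =>
    integral_nonneg fun x => sq_nonneg _
  refine (Finset.single_le_sum (f := fun α => ∫ x, weakDeriv Ω α (u l) x ^ 2 ∂elementMeasure T)
    (fun α _ => h0 l α) (mem_multiIndices.2 hα)).trans ?_
  exact Finset.single_le_sum (f := fun l => ∑ α ∈ Finset.piAntidiag Finset.univ m,
    ∫ x, weakDeriv Ω α (u l) x ^ 2 ∂elementMeasure T)
    (fun l _ => Finset.sum_nonneg fun α _ => h0 l α) (Finset.mem_univ l)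

/-- The number of components of the derivative of order `m` of a vector field. -/
def derivCount (n m : ℕ) : ℝ :=
  ∑ _l : Fin (n + 1), ∑ _α ∈ Finset.piAntidiag (Finset.univ : Finset (Fin (n + 1))) m, (1 : ℝ)

theorem derivCount_nonneg (n m : ℕ) : 0 ≤ derivCount n m :=
  Finset.sum_nonneg fun _ _ => Finset.sum_nonneg fun _ _ => zero_le_one

theorem sum_l2Norm_le_elementSeminorm (H : IsElement B T) (u : VectorField (n + 1)) (m : ℕ) :
    Real.sqrt (simplexVol B) * ∑ l, ∑ α ∈ Finset.piAntidiag Finset.univ m,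
      l2Norm (simplexMeasure B) (weakDeriv Ω α (u l)) ≤
        derivCount n m * elementSeminorm Ω T m u := by
  rw [derivCount, Finset.mul_sum, Finset.sum_mul]
  refine Finset.sum_le_sum fun l _ => ?_
  rw [Finset.mul_sum, Finset.sum_mul]
  refine Finset.sum_le_sum fun α hα => ?_
  rw [← l2Norm_elementMeasure H, one_mul]
  exact l2Norm_le_elementSeminorm T u l (mem_multiIndices.1 hα)

theorem weakDeriv_interior_ae_eq (H : IsElement B T) (hΩ : interior (hull T) ⊆ Ω)
    {f g : Pt (n + 1) → ℝ} {α : Fin (n + 1) → ℕ} (h : HasWeakDeriv Ω α f g) :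
    weakDeriv (interior (hull T)) α f =ᵐ[simplexMeasure B] g :=
  H.ae_iff.1 ((h.mono hΩ).weakDeriv_ae_eq isOpen_interior)

/-- The error of the Raviart–Thomas projection of `u` in `L²(F)`. -/
theorem exists_rtProj_face_bound (n k : ℕ) (hk : 1 ≤ k) (σ : ℝ) : ∃ C ≥ (0 : ℝ),
    ∀ (B : AffineBasis (Fin (n + 2)) ℝ (Pt (n + 1))) (T F : Finset (Pt (n + 1)))
      (i : Fin (n + 2)) (Ω : Set (Pt (n + 1))), IsElement B T →
      elementDiam T ≤ σ * inscribedDiam T → interior (hull T) ⊆ Ω →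
      (F : Set (Pt (n + 1))) = Set.range (faceVerts B i) →
      ∀ u : VectorField (n + 1), (∀ l, MemSobolev Ω (k + 1) (u l)) → ∀ l,
        l2Norm (faceMeasure F) (faceTrace T F fun x => rtProj k T u l x - u l x) ≤
          C * (Real.sqrt (elementDiam T) *
            (elementDiam T ^ k * elementSeminorm Ω T (k + 1) u)) := by
  obtain ⟨C₁, hC₁, h1⟩ := exists_rtProj_error_bound n k hk σ
  obtain ⟨C₂, hC₂, h2⟩ := exists_faceVol_le n σ
  have hN := derivCount_nonneg n (k + 1)
  refine ⟨C₁ * Real.sqrt C₂ * derivCount n (k + 1), by positivity,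
    fun B T F i Ω H hσ hΩ hF u hu l => ?_⟩
  have e1 := h1 B T F i H hσ hF u (fun l => (hu l).mono hΩ le_rfl) l
  have e2 : ∑ l, ∑ α ∈ Finset.piAntidiag Finset.univ (k + 1),
      l2Norm (simplexMeasure B) (weakDeriv (interior (hull T)) α (u l)) =
      ∑ l, ∑ α ∈ Finset.piAntidiag Finset.univ (k + 1),
      l2Norm (simplexMeasure B) (weakDeriv Ω α (u l)) :=
    Finset.sum_congr rfl fun l _ => Finset.sum_congr rfl fun α hα => l2Norm_congr_ae
      (weakDeriv_interior_ae_eq H hΩ ((hu l).hasWeakDeriv (mem_multiIndices.1 hα).le))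
  rw [e2] at e1
  have e3 := sum_l2Norm_le_elementSeminorm (Ω := Ω) H u (k + 1)
  set U := ∑ l, ∑ α ∈ Finset.piAntidiag Finset.univ (k + 1),
      l2Norm (simplexMeasure B) (weakDeriv Ω α (u l)) with hU
  have hU0 : 0 ≤ U := Finset.sum_nonneg fun _ _ => Finset.sum_nonneg fun _ _ => l2Norm_nonneg _ _
  rw [l2Norm_faceMeasure H hF]
  set h := elementDiam T with hh
  have hh0 : 0 < h := H.elementDiam_pos
  have e4 : Real.sqrt (simplexVol (faceVerts B i)) * Real.sqrt h ≤
      Real.sqrt C₂ * Real.sqrt (simplexVol B) := by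
    rw [← Real.sqrt_mul (simplexVol_pos (affineIndependent_faceVerts H.indep i)).le,
      ← Real.sqrt_mul hC₂]
    exact Real.sqrt_le_sqrt (h2 B T H hσ i)
  have hθ : Real.sqrt h * Real.sqrt h = h := Real.mul_self_sqrt hh0.le
  set φ := Real.sqrt (simplexVol (faceVerts B i)) with hφ
  set θ := Real.sqrt h with hθd
  set s := Real.sqrt (simplexVol B) with hs
  set A := elementSeminorm Ω T (k + 1) u with hA
  have hφ0 : 0 ≤ φ := Real.sqrt_nonneg _
  have hθ0 : 0 ≤ θ := Real.sqrt_nonneg _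
  calc φ * l2Norm (simplexMeasure (faceVerts B i)) (faceTrace T F fun x => rtProj k T u l x - u l x)
      ≤ φ * (C₁ * (h ^ (k + 1) * U)) := mul_le_mul_of_nonneg_left e1 hφ0
    _ = C₁ * (φ * θ) * θ * h ^ k * U := by rw [pow_succ, ← hθ]; ring
    _ ≤ C₁ * (Real.sqrt C₂ * s) * θ * h ^ k * U := by gcongr
    _ = C₁ * Real.sqrt C₂ * θ * h ^ k * (s * U) := by ring
    _ ≤ C₁ * Real.sqrt C₂ * θ * h ^ k * (derivCount n (k + 1) * A) := by gcongr
    _ = _ := by ring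

/-- The error of the `L²`-projection of `L = ν ∇u` in `L²(F)`. -/
theorem exists_elementProj_face_bound (n k : ℕ) (hk : 1 ≤ k) (σ : ℝ) : ∃ C ≥ (0 : ℝ),
    ∀ (B : AffineBasis (Fin (n + 2)) ℝ (Pt (n + 1))) (T F : Finset (Pt (n + 1)))
      (i : Fin (n + 2)) (Ω : Set (Pt (n + 1))), IsElement B T →
      elementDiam T ≤ σ * inscribedDiam T → interior (hull T) ⊆ Ω →
      (F : Set (Pt (n + 1))) = Set.range (faceVerts B i) →
      ∀ (ν : ℝ) (L : TensorField (n + 1)) (u : VectorField (n + 1)), 0 < ν →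
        (∀ l j, MemSobolev Ω k (L l j)) → (∀ l, MemSobolev Ω (k + 1) (u l)) →
        IsWeakGradient Ω u (fun l j x => ν⁻¹ * L l j x) → ∀ l j,
        Real.sqrt (elementDiam T) *
          l2Norm (faceMeasure F) (faceTrace T F fun x => elementProj k T (L l j) x - L l j x) ≤
            C * (ν * (elementDiam T ^ k * elementSeminorm Ω T (k + 1) u)) := by
  obtain ⟨C₁, hC₁, h1⟩ := exists_elementProj_error_bound n k hk
  obtain ⟨C₂, hC₂, h2⟩ := exists_faceVol_le n σ
  set N : ℝ := ∑ _α ∈ Finset.piAntidiag (Finset.univ : Finset (Fin (n + 1))) k, (1 : ℝ) with hN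
  have hN0 : 0 ≤ N := Finset.sum_nonneg fun _ _ => zero_le_one
  refine ⟨C₁ * Real.sqrt C₂ * N, by positivity,
    fun B T F i Ω H hσ hΩ hF ν L u hν hL hu hg l j => ?_⟩
  have e1 := h1 B T F i H hF (L l j) ((hL l j).mono hΩ le_rfl)
  set A := elementSeminorm Ω T (k + 1) u with hA
  set s := Real.sqrt (simplexVol B) with hs
  have hs0 : 0 ≤ s := Real.sqrt_nonneg _
  have e2 : s * ∑ α ∈ Finset.piAntidiag Finset.univ k,
      l2Norm (simplexMeasure B) (weakDeriv (interior (hull T)) α (L l j)) ≤ N * (ν * A) := by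
    rw [Finset.mul_sum, hN, Finset.sum_mul]
    refine Finset.sum_le_sum fun α hα => ?_
    have hα' : ∑ i, (α + Pi.single j 1 : Fin (n + 1) → ℕ) i = k + 1 := by
      rw [sum_add_single, mem_multiIndices.1 hα]
    have hw := HasWeakDeriv.of_gradient hν.ne' (hg l j) ((hu l).hasWeakDeriv hα'.le)
    rw [l2Norm_congr_ae (weakDeriv_interior_ae_eq H hΩ hw), l2Norm_const_mul, abs_of_pos hν, one_mul,
      mul_left_comm, ← l2Norm_elementMeasure H]
    exact mul_le_mul_of_nonneg_left (l2Norm_le_elementSeminorm T u l hα') hν.le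
  set U := ∑ α ∈ Finset.piAntidiag Finset.univ k,
      l2Norm (simplexMeasure B) (weakDeriv (interior (hull T)) α (L l j)) with hU
  have hU0 : 0 ≤ U := Finset.sum_nonneg fun _ _ => l2Norm_nonneg _ _
  rw [l2Norm_faceMeasure H hF]
  set h := elementDiam T with hh
  have hh0 : 0 < h := H.elementDiam_pos
  have e4 : Real.sqrt (simplexVol (faceVerts B i)) * Real.sqrt h ≤ Real.sqrt C₂ * s := by
    rw [hs, ← Real.sqrt_mul (simplexVol_pos (affineIndependent_faceVerts H.indep i)).le,
      ← Real.sqrt_mul hC₂]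
    exact Real.sqrt_le_sqrt (h2 B T H hσ i)
  set φ := Real.sqrt (simplexVol (faceVerts B i)) with hφ
  set θ := Real.sqrt h with hθd
  have hφ0 : 0 ≤ φ := Real.sqrt_nonneg _
  have hθ0 : 0 ≤ θ := Real.sqrt_nonneg _
  calc θ * (φ * l2Norm (simplexMeasure (faceVerts B i))
        (faceTrace T F fun x => elementProj k T (L l j) x - L l j x))
      ≤ θ * (φ * (C₁ * (h ^ k * U))) := by gcongr
    _ = C₁ * (φ * θ) * h ^ k * U := by ring
    _ ≤ C₁ * (Real.sqrt C₂ * s) * h ^ k * U := by gcongr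
    _ = C₁ * Real.sqrt C₂ * h ^ k * (s * U) := by ring
    _ ≤ C₁ * Real.sqrt C₂ * h ^ k * (N * (ν * A)) := by gcongr
    _ = _ := by ring

/-- The face projection error of a piecewise polynomial field in `L²(F)`. -/
theorem exists_faceProj_face_bound (n k : ℕ) (σ : ℝ) : ∃ C ≥ (0 : ℝ),
    ∀ (B : AffineBasis (Fin (n + 2)) ℝ (Pt (n + 1))) (T F : Finset (Pt (n + 1)))
      (i : Fin (n + 2)), IsElement B T → elementDiam T ≤ σ * inscribedDiam T →
      (F : Set (Pt (n + 1))) = Set.range (faceVerts B i) →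
      ∀ (v : VectorField (n + 1)) (q : Fin (n + 1) → MvPolynomial (Fin (n + 1)) ℝ),
        (∀ l, v l =ᵐ[simplexMeasure B] polyFun (q l)) → ∀ l,
        l2Norm (faceMeasure F)
          (fun x => faceProj k F (faceTrace T F (v l)) x - faceTrace T F (v l) x) ≤
            C * (Real.sqrt (elementDiam T) * elementGradNorm T v) := by
  obtain ⟨C₁, hC₁, h1⟩ := exists_faceProj_sub_le n k
  obtain ⟨C₂, hC₂, h2⟩ := exists_faceVol_le n σ
  refine ⟨C₁ * Real.sqrt C₂ * (n + 1), by positivity, fun B T F i H hσ hF v q hv l => ?_⟩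
  have e1 := h1 B T F i H hF (v l) (q l) (hv l)
  have hvS : ∀ l, MemSobolev (interior (hull T)) 1 (v l) := fun l =>
    (memSobolev_one_of_contDiff T (contDiff_polyFun (q l))).congr isOpen_interior
      (H.ae_iff.2 (hv l).symm)
  set s := Real.sqrt (simplexVol B) with hs
  have hs0 : 0 ≤ s := Real.sqrt_nonneg _
  have hI : ∀ l j, Integrable (fun x => elementDeriv T j (v l) x ^ 2) (elementMeasure T) := by
    intro l j
    have : MemLp (elementDeriv T j (v l)) 2 (elementMeasure T) := by
      rw [H.elementMeasure_eq, memLp_ofReal_smul_iff (simplexVol_pos H.indep)]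
      exact H.memLp_deriv (hvS l) j
    exact this.integrable_sq
  have e2 : s * ∑ j, l2Norm (simplexMeasure B) (elementDeriv T j (v l)) ≤
      (n + 1) * elementGradNorm T v := by
    rw [Finset.mul_sum]
    calc _ ≤ ∑ _j : Fin (n + 1), elementGradNorm T v := by
          refine Finset.sum_le_sum fun j _ => ?_
          rw [← l2Norm_elementMeasure H]
          refine Real.sqrt_le_sqrt (integral_mono (hI l j) (integrable_finsetSum _ fun l _ =>
            integrable_finsetSum _ fun j _ => hI l j) fun x => ?_)
          refine (Finset.single_le_sum (f := fun j => elementDeriv T j (v l) x ^ 2)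
            (fun j _ => sq_nonneg _) (Finset.mem_univ j)).trans ?_
          exact Finset.single_le_sum (f := fun l => ∑ j, elementDeriv T j (v l) x ^ 2)
            (fun l _ => Finset.sum_nonneg fun j _ => sq_nonneg _) (Finset.mem_univ l)
      _ = _ := by simp
  set U := ∑ j, l2Norm (simplexMeasure B) (elementDeriv T j (v l)) with hU
  have hU0 : 0 ≤ U := Finset.sum_nonneg fun _ _ => l2Norm_nonneg _ _
  rw [l2Norm_faceMeasure H hF]
  set h := elementDiam T with hh
  have hh0 : 0 < h := H.elementDiam_pos
  have e4 : Real.sqrt (simplexVol (faceVerts B i)) * Real.sqrt h ≤ Real.sqrt C₂ * s := by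
    rw [hs, ← Real.sqrt_mul (simplexVol_pos (affineIndependent_faceVerts H.indep i)).le,
      ← Real.sqrt_mul hC₂]
    exact Real.sqrt_le_sqrt (h2 B T H hσ i)
  have hθ : Real.sqrt h * Real.sqrt h = h := Real.mul_self_sqrt hh0.le
  set φ := Real.sqrt (simplexVol (faceVerts B i)) with hφ
  set θ := Real.sqrt h with hθd
  have hφ0 : 0 ≤ φ := Real.sqrt_nonneg _
  have hθ0 : 0 ≤ θ := Real.sqrt_nonneg _
  calc φ * l2Norm (simplexMeasure (faceVerts B i))
        (fun x => faceProj k F (faceTrace T F (v l)) x - faceTrace T F (v l) x)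
      ≤ φ * (C₁ * (h * U)) := by gcongr
    _ = C₁ * (φ * θ) * θ * U := by rw [← hθ]; ring
    _ ≤ C₁ * (Real.sqrt C₂ * s) * θ * U := by gcongr
    _ = C₁ * Real.sqrt C₂ * θ * (s * U) := by ring
    _ ≤ C₁ * Real.sqrt C₂ * θ * ((n + 1) * elementGradNorm T v) := by gcongr
    _ = _ := by ring

end

end HDG

end

noncomputable section

namespace HDG

/-! ### The contribution of one face -/

section

variable {α : Type*} [MeasurableSpace α] {μ : Measure α}

theorem abs_integral_sum_mul_le {ι : Type*} [Fintype ι] {f g : ι → α → ℝ} {a b : ℝ}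
    (hf : ∀ i, MemLp (f i) 2 μ) (hg : ∀ i, MemLp (g i) 2 μ) (ha : ∀ i, l2Norm μ (f i) ≤ a)
    (hb : ∀ i, l2Norm μ (g i) ≤ b) :
    |∫ x, ∑ i, f i x * g i x ∂μ| ≤ Fintype.card ι * (a * b) := by
  have hi : ∀ i ∈ (Finset.univ : Finset ι), Integrable (fun x => f i x * g i x) μ :=
    fun i _ => (hf i).integrable_mul (hg i)
  rw [integral_finsetSum _ hi]
  refine (Finset.abs_sum_le_sum_abs _ _).trans ?_
  calc _ ≤ ∑ _i : ι, a * b := Finset.sum_le_sum fun i _ =>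
        (abs_integral_mul_le (hf i) (hg i)).trans (mul_le_mul (ha i) (hb i) (l2Norm_nonneg _ _)
          ((l2Norm_nonneg _ _).trans (ha i)))
    _ = _ := by simp

theorem l2Norm_le_sqrt_integral_sum {ι : Type*} [Fintype ι] {f : ι → α → ℝ}
    (hf : ∀ i, MemLp (f i) 2 μ) (i : ι) :
    l2Norm μ (f i) ≤ Real.sqrt (∫ x, ∑ j, f j x ^ 2 ∂μ) := by
  refine Real.sqrt_le_sqrt (integral_mono (hf i).integrable_sq
    (integrable_finsetSum _ fun j _ => (hf j).integrable_sq) fun x => ?_)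
  exact Finset.single_le_sum (f := fun j => f j x ^ 2) (fun j _ => sq_nonneg _) (Finset.mem_univ i)

end

variable {n k : ℕ} {B : AffineBasis (Fin (n + 2)) ℝ (Pt (n + 1))} {T F : Finset (Pt (n + 1))}
  {i : Fin (n + 2)} {Ω : Set (Pt (n + 1))}

theorem memLp_faceMeasure_iff (H : IsElement B T)
    (hF : (F : Set (Pt (n + 1))) = Set.range (faceVerts B i)) {f : Pt (n + 1) → ℝ} :
    MemLp f 2 (faceMeasure F) ↔ MemLp f 2 (simplexMeasure (faceVerts B i)) := by
  rw [faceMeasure_eq hF]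
  exact memLp_ofReal_smul_iff (simplexVol_pos (affineIndependent_faceVerts H.indep i))

theorem memLp_faceTrace_polyFun_sub (H : IsElement B T)
    (hF : (F : Set (Pt (n + 1))) = Set.range (faceVerts B i)) {w : Pt (n + 1) → ℝ}
    (hw : MemSobolev (interior (hull T)) 1 w) (p : MvPolynomial (Fin (n + 1)) ℝ) :
    MemLp (faceTrace T F fun x => polyFun p x - w x) 2 (faceMeasure F) :=
  (memLp_faceMeasure_iff H hF).2
    (H.memLp_faceTrace hF ((memSobolev_one_of_contDiff T (contDiff_polyFun p)).sub hw))

theorem memLp_faceTrace_elementProj_sub (H : IsElement B T)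
    (hF : (F : Set (Pt (n + 1))) = Set.range (faceVerts B i)) {w : Pt (n + 1) → ℝ}
    (hw : MemSobolev (interior (hull T)) 1 w) :
    MemLp (faceTrace T F fun x => elementProj k T w x - w x) 2 (faceMeasure F) := by
  obtain ⟨p, -, hp⟩ := isL2Proj_l2Proj (simplexVol_pos H.indep) H.elementMeasure_eq k (H.memLp hw)
  rw [elementProj, hp]
  exact memLp_faceTrace_polyFun_sub H hF hw p

theorem memLp_faceTrace_rtProj_sub (H : IsElement B T) (hk : 1 ≤ k)
    (hF : (F : Set (Pt (n + 1))) = Set.range (faceVerts B i)) {w : VectorField (n + 1)}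
    (hw : ∀ l, MemSobolev (interior (hull T)) 1 (w l)) (l : Fin (n + 1)) :
    MemLp (faceTrace T F fun x => rtProj k T w l x - w l x) 2 (faceMeasure F) := by
  choose Fc hFc using exists_finset_face (n := n) B
  obtain ⟨q, -, hq⟩ := H.exists_rtProj hk hFc hw
  rw [hq]
  exact memLp_faceTrace_polyFun_sub H hF (hw l) (q l)

/-- The norm of the jump `Π_k^∂ v - v̂` on one face of `T`, weighted by `h_T⁻¹`. -/
def faceJump (k : ℕ) (T F : Finset (Pt (n + 1))) (v vhat : VectorField (n + 1)) : ℝ :=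
  Real.sqrt ((elementDiam T)⁻¹ *
    ∫ x, ∑ i, (faceProj k F (faceTrace T F (v i)) x - vhat i x) ^ 2 ∂faceMeasure F)

/-- The two contributions of a face to the consistency error. -/
theorem exists_face_consistency_bound (n k : ℕ) (hk : 1 ≤ k) (σ : ℝ) : ∃ C ≥ (0 : ℝ),
    ∀ (B : AffineBasis (Fin (n + 2)) ℝ (Pt (n + 1))) (T F : Finset (Pt (n + 1)))
      (i : Fin (n + 2)) (Ω : Set (Pt (n + 1))), IsElement B T →
      elementDiam T ≤ σ * inscribedDiam T → interior (hull T) ⊆ Ω →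
      (F : Set (Pt (n + 1))) = Set.range (faceVerts B i) →
      ∀ (ν : ℝ) (L : TensorField (n + 1)) (u : VectorField (n + 1)), 0 < ν →
        (∀ l j, MemSobolev Ω k (L l j)) → (∀ l, MemSobolev Ω (k + 1) (u l)) →
        IsWeakGradient Ω u (fun l j x => ν⁻¹ * L l j x) →
      ∀ (v vhat : VectorField (n + 1)) (q : Fin (n + 1) → MvPolynomial (Fin (n + 1)) ℝ),
        (∀ l, v l =ᵐ[elementMeasure T] polyFun (q l)) →
        (∀ l, MemLp (vhat l) 2 (faceMeasure F)) →
        |∫ x, ∑ i, (∑ j, faceTrace T F (fun y => elementProj k T (L i j) y - L i j y) x *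
          outwardNormal T F j) * (vhat i x - faceTrace T F (v i) x) ∂(faceMeasure F)| ≤
            C * (ν * (elementDiam T ^ k * elementSeminorm Ω T (k + 1) u *
              (faceJump k T F v vhat + elementGradNorm T v))) ∧
        |(elementDiam T)⁻¹ * ∫ x, ∑ i, faceTrace T F (fun y => rtProj k T u i y - u i y) x *
          (faceProj k F (faceTrace T F (v i)) x - vhat i x) ∂(faceMeasure F)| ≤
            C * (elementDiam T ^ k * elementSeminorm Ω T (k + 1) u *
              (faceJump k T F v vhat + elementGradNorm T v)) := by
  obtain ⟨C₁, hC₁, h1⟩ := exists_elementProj_face_bound n k hk σ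
  obtain ⟨C₂, hC₂, h2⟩ := exists_rtProj_face_bound n k hk σ
  obtain ⟨C₃, hC₃, h3⟩ := exists_faceProj_face_bound n k σ
  set N : ℝ := n + 1 with hN
  have hN0 : 0 < N := by positivity
  refine ⟨N * N * C₁ * (1 + C₃) + N * C₂, by positivity,
    fun B T F i Ω H hσ hΩ hF ν L u hν hL hu hg v vhat q hv hvhat => ?_⟩
  have hv' : ∀ l, v l =ᵐ[simplexMeasure B] polyFun (q l) := fun l => by
    have := hv l
    rw [H.elementMeasure_eq] at this
    exact (ae_ofReal_smul_iff (simplexVol_pos H.indep)).1 this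
  have g1 := h1 B T F i Ω H hσ hΩ hF ν L u hν hL hu hg
  have g2 := h2 B T F i Ω H hσ hΩ hF u hu
  have g3 := h3 B T F i H hσ hF v q hv'
  have mL : ∀ l j, MemLp (faceTrace T F fun x => elementProj k T (L l j) x - L l j x) 2
      (faceMeasure F) := fun l j =>
    memLp_faceTrace_elementProj_sub H hF ((hL l j).mono hΩ hk)
  have mu : ∀ l, MemLp (faceTrace T F fun x => rtProj k T u l x - u l x) 2 (faceMeasure F) :=
    memLp_faceTrace_rtProj_sub H hk hF fun l => (hu l).mono hΩ (by lia)
  have mvS : ∀ l, MemLp (faceTrace T F (v l)) 2 (simplexMeasure (faceVerts B i)) := fun l =>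
    (memLp_congr_ae (H.faceTrace_of_contDiff hF (contDiff_polyFun (q l)) (hv' l))).2
      (memLp_polyFun _ _)
  have mv : ∀ l, MemLp (faceTrace T F (v l)) 2 (faceMeasure F) := fun l =>
    (memLp_faceMeasure_iff H hF).2 (mvS l)
  have mp : ∀ l, MemLp (faceProj k F (faceTrace T F (v l))) 2 (faceMeasure F) := fun l => by
    obtain ⟨p, -, hp⟩ := isL2Proj_l2Proj
      (simplexVol_pos (affineIndependent_faceVerts H.indep i)) (faceMeasure_eq hF) k (mvS l)
    rw [faceProj, hp]
    exact (memLp_faceMeasure_iff H hF).2 (memLp_polyFun _ _)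
  have hh := H.elementDiam_pos
  obtain ⟨h, hhe⟩ : ∃ h, h = elementDiam T := ⟨_, rfl⟩
  obtain ⟨A, hA⟩ : ∃ A, A = elementSeminorm Ω T (k + 1) u := ⟨_, rfl⟩
  obtain ⟨G, hG⟩ : ∃ G, G = elementGradNorm T v := ⟨_, rfl⟩
  obtain ⟨J, hJ⟩ : ∃ J, J = faceJump k T F v vhat := ⟨_, rfl⟩
  have hA0 : 0 ≤ A := hA ▸ Real.sqrt_nonneg _
  have hG0 : 0 ≤ G := hG ▸ Real.sqrt_nonneg _
  have hJ0 : 0 ≤ J := hJ ▸ Real.sqrt_nonneg _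
  have mj : ∀ l, MemLp (fun x => faceProj k F (faceTrace T F (v l)) x - vhat l x) 2
      (faceMeasure F) := fun l => (mp l).sub (hvhat l)
  have hj : ∀ l, l2Norm (faceMeasure F)
      (fun x => faceProj k F (faceTrace T F (v l)) x - vhat l x) ≤ Real.sqrt h * J := by
    intro l
    refine (l2Norm_le_sqrt_integral_sum mj l).trans (le_of_eq ?_)
    rw [hJ, faceJump, hhe, ← Real.sqrt_mul hh.le, mul_inv_cancel_left₀ hh.ne']
  have hd : ∀ l, l2Norm (faceMeasure F) (fun x => vhat l x - faceTrace T F (v l) x) ≤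
      Real.sqrt h * (J + C₃ * G) := by
    intro l
    have e : (fun x => vhat l x - faceTrace T F (v l) x) = fun x =>
        (faceProj k F (faceTrace T F (v l)) x - faceTrace T F (v l) x) -
        (faceProj k F (faceTrace T F (v l)) x - vhat l x) := by funext x; ring
    rw [e]
    refine (l2Norm_sub_le ((mp l).sub (mv l)) (mj l)).trans ?_
    have := add_le_add (g3 l) (hj l)
    rw [← hhe, ← hG] at this
    exact this.trans (le_of_eq (by ring))
  rw [← hhe] at hh
  have hs : 0 < Real.sqrt h := Real.sqrt_pos.2 hh
  have hss : Real.sqrt h * Real.sqrt h = h := Real.mul_self_sqrt hh.le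
  rw [← hhe, ← hA] at g2
  simp only [← hhe, ← hA, ← hG, ← hJ] at g1 ⊢
  constructor
  · have mt : ∀ l, MemLp (fun x => ∑ j, faceTrace T F
        (fun y => elementProj k T (L l j) y - L l j y) x * outwardNormal T F j) 2
        (faceMeasure F) := fun l => memLp_finset_sum _ fun j _ => (mL l j).mul_const _
    have ht : ∀ l, l2Norm (faceMeasure F) (fun x => ∑ j, faceTrace T F
        (fun y => elementProj k T (L l j) y - L l j y) x * outwardNormal T F j) ≤
        (Real.sqrt h)⁻¹ * (N * (C₁ * (ν * (h ^ k * A)))) := by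
      intro l
      refine (l2Norm_sum_le _ fun j _ => (mL l j).mul_const _).trans ?_
      calc _ ≤ ∑ _j : Fin (n + 1), (Real.sqrt h)⁻¹ * (C₁ * (ν * (h ^ k * A))) := by
            refine Finset.sum_le_sum fun j _ => ?_
            simp only [mul_comm _ (outwardNormal T F j)]
            rw [l2Norm_const_mul]
            refine (mul_le_of_le_one_left (l2Norm_nonneg _ _) (abs_outwardNormal_le T F j)).trans ?_
            rw [le_inv_mul_iff₀ hs]
            exact g1 l j
        _ = _ := by
            rw [Finset.sum_const, Finset.card_univ, Fintype.card_fin, nsmul_eq_mul, hN]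
            push_cast; ring
    refine (abs_integral_sum_mul_le mt (fun l => (hvhat l).sub (mv l)) ht hd).trans ?_
    have e : (Fintype.card (Fin (n + 1)) : ℝ) * ((Real.sqrt h)⁻¹ * (N * (C₁ * (ν * (h ^ k * A)))) *
        (Real.sqrt h * (J + C₃ * G))) = N * N * C₁ * (ν * (h ^ k * A * (J + C₃ * G))) := by
      rw [Fintype.card_fin]; push_cast; rw [← hN]; field_simp
    rw [e]
    have hX : 0 ≤ ν * (h ^ k * A * (J + G)) := by positivity
    calc _ ≤ N * N * C₁ * (ν * (h ^ k * A * ((1 + C₃) * (J + G)))) := by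
          gcongr
          nlinarith [mul_nonneg hC₃ hJ0]
      _ = N * N * C₁ * (1 + C₃) * (ν * (h ^ k * A * (J + G))) := by ring
      _ ≤ _ := mul_le_mul_of_nonneg_right (le_add_of_nonneg_right (by positivity)) hX
  · rw [abs_mul, abs_of_pos (inv_pos.2 hh), inv_mul_le_iff₀ hh]
    refine (abs_integral_sum_mul_le mu mj g2 hj).trans ?_
    have e : (Fintype.card (Fin (n + 1)) : ℝ) * (C₂ * (Real.sqrt h * (h ^ k * A)) *
        (Real.sqrt h * J)) = h * (N * C₂ * (h ^ k * A * J)) := by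
      rw [Fintype.card_fin, ← hss]; push_cast; rw [← hN, hss]; linear_combination
        N * C₂ * (h ^ k * A) * J * hss
    rw [e]
    refine mul_le_mul_of_nonneg_left ?_ hh.le
    refine mul_le_mul (le_add_of_nonneg_left (by positivity)) ?_ (by positivity) (by positivity)
    gcongr
    linarith

end HDG

end

noncomputable section

namespace HDG

/-! ### Summation over the triangulation -/

namespace Triangulation

variable {n : ℕ} {Ω : Set (Pt (n + 1))} (𝒯 : Triangulation Ω)

theorem mem_elements {T : Finset (Pt (n + 1))} :
    T ∈ 𝒯.elements ↔ T ∈ 𝒯.complex.faces ∧ T.card = n + 1 + 1 := by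
  simp [elements]

theorem exists_affineBasis {T : Finset (Pt (n + 1))} (hT : T ∈ 𝒯.elements) :
    ∃ B : AffineBasis (Fin (n + 2)) ℝ (Pt (n + 1)), IsElement B T := by
  obtain ⟨h1, h2⟩ := 𝒯.mem_elements.1 hT
  obtain ⟨b, hb⟩ := exists_isElement (𝒯.complex.indep h1) h2
  obtain ⟨B, rfl⟩ := hb.exists_basis
  exact ⟨B, hb⟩

theorem mem_skeleton {T F : Finset (Pt (n + 1))} (hT : T ∈ 𝒯.elements)
    (hF : F ∈ T.powersetCard (n + 1)) : F ∈ 𝒯.skeleton := by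
  obtain ⟨h1, h2⟩ := Finset.mem_powersetCard.1 hF
  have hne : F.Nonempty := Finset.card_pos.1 (by lia)
  simpa [skeleton, h2] using 𝒯.complex.down_closed (𝒯.mem_elements.1 hT).1 h1 hne

theorem elementDiam_le_meshSize {T : Finset (Pt (n + 1))} (hT : T ∈ 𝒯.elements) :
    elementDiam T ≤ 𝒯.meshSize :=
  le_csSup ((Finset.finite_toSet _).image _).bddAbove (Set.mem_image_of_mem _ hT)

theorem disjoint_interior_hull {S T : Finset (Pt (n + 1))} (hS : S ∈ 𝒯.elements)
    (hT : T ∈ 𝒯.elements) (hne : S ≠ T) :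
    Disjoint (interior (hull S)) (interior (hull T)) := by
  obtain ⟨hS1, hS2⟩ := 𝒯.mem_elements.1 hS
  obtain ⟨hT1, hT2⟩ := 𝒯.mem_elements.1 hT
  rw [Set.disjoint_iff_inter_eq_empty, ← Set.not_nonempty_iff_eq_empty, ← interior_inter]
  intro h
  have h' := h.mono (interior_mono (𝒯.complex.inter_subset_convexHull hS1 hT1))
  rw [interior_convexHull_nonempty_iff_affineSpan_eq_top] at h'
  obtain ⟨p, hpS, hpT⟩ : ∃ p ∈ S, p ∉ T := by
    by_contra! hc
    exact hne (Finset.eq_of_subset_of_card_le hc (by lia))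
  have hp := ((𝒯.complex.indep hS1).mem_affineSpan_iff ⟨p, hpS⟩ {q | (q : Pt (n + 1)) ∈ T}).1 (by
    have e : ((↑) : S → Pt (n + 1)) '' {q | (q : Pt (n + 1)) ∈ T} = (S ∩ T : Set _) := by
      ext x; simp [and_comm]
    rw [e, h']
    exact AffineSubspace.mem_top _ _ _)
  exact hpT hp

theorem sum_integral_le {f : Pt (n + 1) → ℝ} (hf : IntegrableOn f Ω) (h0 : ∀ x, 0 ≤ f x) :
    ∑ T ∈ 𝒯.elements, ∫ x, f x ∂elementMeasure T ≤ ∫ x in Ω, f x := by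
  have hsub : ∀ T ∈ 𝒯.elements, interior (hull T) ⊆ Ω := fun T hT =>
    𝒯.interior_subset T (𝒯.mem_elements.1 hT).1 (𝒯.mem_elements.1 hT).2
  simp only [← elementMeasure_eq_interior]
  rw [← integral_biUnion_finset 𝒯.elements (fun T _ => isOpen_interior.measurableSet)
    (fun S hS T hT hne => 𝒯.disjoint_interior_hull hS hT hne)
    (fun T hT => hf.mono_set (hsub T hT))]
  exact setIntegral_mono_set hf (ae_of_all _ h0)
    (HasSubset.Subset.eventuallyLE (Set.iUnion₂_subset hsub))

theorem sum_elementSeminorm_sq_le (hΩ : IsOpen Ω) {m : ℕ} {u : VectorField (n + 1)}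
    (hu : ∀ l, MemSobolev Ω m (u l)) :
    ∑ T ∈ 𝒯.elements, elementSeminorm Ω T m u ^ 2 ≤ sobolevSeminorm Ω m u ^ 2 := by
  have h0 : ∀ (μ : Measure (Pt (n + 1))) l α, 0 ≤ ∫ x, weakDeriv Ω α (u l) x ^ 2 ∂μ :=
    fun μ l α => integral_nonneg fun x => sq_nonneg _
  rw [sobolevSeminorm, Real.sq_sqrt (Finset.sum_nonneg fun l _ => Finset.sum_nonneg fun α _ =>
    h0 _ l α)]
  have e : ∀ T ∈ 𝒯.elements, elementSeminorm Ω T m u ^ 2 =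
      ∑ i, ∑ α ∈ Finset.piAntidiag (Finset.univ : Finset (Fin (n + 1))) m,
        ∫ x, weakDeriv Ω α (u i) x ^ 2 ∂elementMeasure T := fun T _ =>
    Real.sq_sqrt (Finset.sum_nonneg fun l _ => Finset.sum_nonneg fun α _ => h0 _ l α)
  rw [Finset.sum_congr rfl e, Finset.sum_comm]
  refine Finset.sum_le_sum fun l _ => ?_
  rw [Finset.sum_comm]
  refine Finset.sum_le_sum fun α hα => ?_
  exact 𝒯.sum_integral_le ((hu l).memLp_weakDeriv hΩ (mem_multiIndices.1 hα).le).integrable_sq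
    fun x => sq_nonneg _

theorem sum_elementGradNorm_sq (v : VectorField (n + 1)) :
    ∑ T ∈ 𝒯.elements, elementGradNorm T v ^ 2 = 𝒯.gradNormSq v :=
  Finset.sum_congr rfl fun T _ => Real.sq_sqrt (integral_nonneg fun x =>
    Finset.sum_nonneg fun i _ => Finset.sum_nonneg fun j _ => sq_nonneg _)

theorem sum_faceJump_sq (k : ℕ) (v vhat : VectorField (n + 1)) :
    ∑ T ∈ 𝒯.elements, ∑ F ∈ T.powersetCard (n + 1), faceJump k T F v vhat ^ 2 =
      𝒯.jumpNormSq k v vhat :=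
  Finset.sum_congr rfl fun T _ => Finset.sum_congr rfl fun F _ => Real.sq_sqrt
    (mul_nonneg (inv_nonneg.2 (elementDiam_nonneg T)) (integral_nonneg fun x =>
      Finset.sum_nonneg fun i _ => sq_nonneg _))

theorem tensorNormSq_nonneg (G : TensorField (n + 1)) : 0 ≤ 𝒯.tensorNormSq G :=
  Finset.sum_nonneg fun T _ => integral_nonneg fun x =>
    Finset.sum_nonneg fun i _ => Finset.sum_nonneg fun j _ => sq_nonneg _

theorem mul_sqrt_gradNormSq_add_jumpNormSq_le (k : ℕ) {ν : ℝ} (hν : 0 < ν)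
    (G : TensorField (n + 1)) (v vhat : VectorField (n + 1)) :
    ν * Real.sqrt (𝒯.gradNormSq v + 𝒯.jumpNormSq k v vhat) ≤
      Real.sqrt ν * 𝒯.tripleNorm k ν G v vhat := by
  rw [tripleNorm, ← Real.sqrt_mul hν.le]
  nth_rewrite 1 [← Real.sqrt_sq hν.le]
  rw [← Real.sqrt_mul (sq_nonneg ν)]
  refine Real.sqrt_le_sqrt ?_
  have := mul_nonneg hν.le (mul_nonneg (inv_nonneg.2 hν.le) (𝒯.tensorNormSq_nonneg G))
  nlinarith

/-- Summation of the contributions of the faces by the Cauchy–Schwarz inequality. -/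
theorem sum_face_bound_le (hΩ : IsOpen Ω) (k : ℕ) {m : ℕ} {u : VectorField (n + 1)}
    (hu : ∀ l, MemSobolev Ω m (u l)) (v vhat : VectorField (n + 1)) :
    ∑ T ∈ 𝒯.elements, ∑ F ∈ T.powersetCard (n + 1),
      elementDiam T ^ k * elementSeminorm Ω T m u * (faceJump k T F v vhat + elementGradNorm T v) ≤
    𝒯.meshSize ^ k * (sobolevSeminorm Ω m u *
      (2 * (n + 2) * Real.sqrt (𝒯.gradNormSq v + 𝒯.jumpNormSq k v vhat))) := by
  set S : Finset (Pt (n + 1)) → ℝ := fun T =>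
    ∑ F ∈ T.powersetCard (n + 1), (faceJump k T F v vhat + elementGradNorm T v) with hS
  have hA0 : ∀ T, 0 ≤ elementSeminorm Ω T m u := fun T => Real.sqrt_nonneg _
  have hS0 : ∀ T, 0 ≤ S T := fun T => Finset.sum_nonneg fun F _ =>
    add_nonneg (Real.sqrt_nonneg _) (Real.sqrt_nonneg _)
  have h1 : ∀ T ∈ 𝒯.elements, S T ^ 2 ≤ (2 * (n + 2)) ^ 2 * (elementGradNorm T v ^ 2 +
      ∑ F ∈ T.powersetCard (n + 1), faceJump k T F v vhat ^ 2) := by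
    intro T hT
    have hc : ((T.powersetCard (n + 1)).card : ℝ) = n + 2 := by
      rw [Finset.card_powersetCard, (𝒯.mem_elements.1 hT).2, Nat.choose_succ_self_right]
      push_cast; ring
    have hn : (0 : ℝ) ≤ n := Nat.cast_nonneg n
    have hJ : 0 ≤ ∑ F ∈ T.powersetCard (n + 1), faceJump k T F v vhat ^ 2 :=
      Finset.sum_nonneg fun F _ => sq_nonneg _
    have hb : ∑ F ∈ T.powersetCard (n + 1), (faceJump k T F v vhat + elementGradNorm T v) ^ 2 ≤
        2 * ∑ F ∈ T.powersetCard (n + 1), faceJump k T F v vhat ^ 2 +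
          2 * (n + 2) * elementGradNorm T v ^ 2 := by
      calc _ ≤ ∑ F ∈ T.powersetCard (n + 1),
            (2 * faceJump k T F v vhat ^ 2 + 2 * elementGradNorm T v ^ 2) :=
            Finset.sum_le_sum fun F _ => by
              nlinarith [sq_nonneg (faceJump k T F v vhat - elementGradNorm T v)]
        _ = _ := by
            rw [Finset.sum_add_distrib, ← Finset.mul_sum, Finset.sum_const, nsmul_eq_mul, hc]
            ring
    calc S T ^ 2 ≤ (n + 2) * ∑ F ∈ T.powersetCard (n + 1),
          (faceJump k T F v vhat + elementGradNorm T v) ^ 2 := by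
          rw [← hc]; exact sq_sum_le_card_mul_sum_sq
      _ ≤ (n + 2) * (2 * ∑ F ∈ T.powersetCard (n + 1), faceJump k T F v vhat ^ 2 +
          2 * (n + 2) * elementGradNorm T v ^ 2) := by gcongr
      _ ≤ _ := by
          have h2 := sq_nonneg (elementGradNorm T v)
          have h3 := mul_nonneg (mul_nonneg hn hn) hJ
          have h4 := mul_nonneg (mul_nonneg hn hn) h2
          nlinarith [mul_nonneg hn hJ, mul_nonneg hn h2]
  have h2 : Real.sqrt (∑ T ∈ 𝒯.elements, S T ^ 2) ≤
      2 * (n + 2) * Real.sqrt (𝒯.gradNormSq v + 𝒯.jumpNormSq k v vhat) := by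
    rw [← Real.sqrt_sq (show (0 : ℝ) ≤ 2 * (n + 2) by positivity),
      ← Real.sqrt_mul (sq_nonneg _)]
    refine Real.sqrt_le_sqrt ((Finset.sum_le_sum h1).trans (le_of_eq ?_))
    rw [← Finset.mul_sum, Finset.sum_add_distrib, sum_elementGradNorm_sq, sum_faceJump_sq]
  have h3 : Real.sqrt (∑ T ∈ 𝒯.elements, elementSeminorm Ω T m u ^ 2) ≤ sobolevSeminorm Ω m u :=
    (Real.sqrt_le_sqrt (𝒯.sum_elementSeminorm_sq_le hΩ hu)).trans
      (le_of_eq (Real.sqrt_sq (Real.sqrt_nonneg _)))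
  have hm : 0 ≤ 𝒯.meshSize := Real.sSup_nonneg (by
    rintro _ ⟨T, -, rfl⟩; exact elementDiam_nonneg T)
  calc _ ≤ ∑ T ∈ 𝒯.elements, 𝒯.meshSize ^ k * (elementSeminorm Ω T m u * S T) := by
        refine Finset.sum_le_sum fun T hT => ?_
        rw [← Finset.mul_sum, mul_assoc]
        exact mul_le_mul_of_nonneg_right (pow_le_pow_left₀ (elementDiam_nonneg T)
          (𝒯.elementDiam_le_meshSize hT) k) (mul_nonneg (hA0 T) (hS0 T))
    _ ≤ _ := by
        rw [← Finset.mul_sum]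
        refine mul_le_mul_of_nonneg_left ?_ (pow_nonneg hm k)
        exact (Real.sum_mul_le_sqrt_mul_sqrt _ _ _).trans
          (mul_le_mul h3 h2 (Real.sqrt_nonneg _) (Real.sqrt_nonneg _))

/-- The consistency error bound in dimension `n + 1`. -/
theorem exists_consistencyError_bound (n k : ℕ) (hk : 1 ≤ k) (σ : ℝ) : ∃ C > (0 : ℝ),
    ∀ (Ω : Set (Pt (n + 1))), IsOpen Ω → ∀ 𝒯 : Triangulation Ω, 𝒯.ShapeRegular σ →
      ∀ ν : ℝ, 0 < ν → ∀ (L : TensorField (n + 1)) (u : VectorField (n + 1)),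
        (∀ i j, MemSobolev Ω k (L i j)) → (∀ i, MemSobolev Ω (k + 1) (u i)) →
        IsWeakGradient Ω u (fun i j x => ν⁻¹ * L i j x) →
      ∀ G ∈ 𝒯.SigmaSpace k, ∀ v ∈ 𝒯.VSpace k, ∀ vhat ∈ 𝒯.VhatSpace k,
        |𝒯.consistencyError k ν L u v vhat| ≤
          C * Real.sqrt ν * 𝒯.meshSize ^ k * sobolevSeminorm Ω (k + 1) u *
            𝒯.tripleNorm k ν G v vhat := by
  obtain ⟨C, hC, hb⟩ := exists_face_consistency_bound n k hk σ
  refine ⟨4 * C * (n + 2) + 1, by positivity,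
    fun Ω hΩ 𝒯 hσ ν hν L u hL hu hg G _ v hv vhat hvhat => ?_⟩
  have key : ∀ T ∈ 𝒯.elements, ∀ F ∈ T.powersetCard (n + 1), ∃ (B : AffineBasis (Fin (n + 2)) ℝ (Pt (n + 1)))
      (i : Fin (n + 2)) (q : Fin (n + 1) → MvPolynomial (Fin (n + 1)) ℝ), IsElement B T ∧
      (F : Set (Pt (n + 1))) = Set.range (faceVerts B i) ∧
      (∀ l, v l =ᵐ[elementMeasure T] polyFun (q l)) ∧
      ∀ l, MemLp (vhat l) 2 (faceMeasure F) := by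
    intro T hT F hF
    obtain ⟨B, H⟩ := 𝒯.exists_affineBasis hT
    obtain ⟨i, hi⟩ := H.exists_face hF
    obtain ⟨q, -, hq⟩ := hv.2.1 T hT
    refine ⟨B, i, q, H, hi, hq, fun l => ?_⟩
    obtain ⟨p, -, hp⟩ := hvhat.1 F (𝒯.mem_skeleton hT hF) l
    exact (memLp_congr_ae hp).2 ((memLp_faceMeasure_iff H hi).2 (memLp_polyFun _ p))
  have hsub : ∀ T ∈ 𝒯.elements, interior (hull T) ⊆ Ω := fun T hT =>
    𝒯.interior_subset T (𝒯.mem_elements.1 hT).1 (𝒯.mem_elements.1 hT).2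
  have hsum := 𝒯.sum_face_bound_le hΩ k hu v vhat
  obtain ⟨X, hX⟩ : ∃ X, X = ∑ T ∈ 𝒯.elements, ∑ F ∈ T.powersetCard (n + 1),
      elementDiam T ^ k * elementSeminorm Ω T (k + 1) u *
        (faceJump k T F v vhat + elementGradNorm T v) := ⟨_, rfl⟩
  rw [← hX] at hsum
  have hE : |𝒯.consistencyError k ν L u v vhat| ≤ C * (ν * X) + ν * (C * X) := by
    rw [consistencyError]
    refine (abs_add_le _ _).trans (add_le_add ?_ ?_)
    · rw [hX, Finset.mul_sum, Finset.mul_sum]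
      refine (Finset.abs_sum_le_sum_abs _ _).trans (Finset.sum_le_sum fun T hT => ?_)
      rw [Finset.mul_sum, Finset.mul_sum]
      refine (Finset.abs_sum_le_sum_abs _ _).trans (Finset.sum_le_sum fun F hF => ?_)
      obtain ⟨B, i, q, H, hi, hq, hm⟩ := key T hT F hF
      exact (hb B T F i Ω H (hσ T hT) (hsub T hT) hi ν L u hν hL hu hg v vhat q hq hm).1
    · rw [abs_mul, abs_of_pos hν]
      refine mul_le_mul_of_nonneg_left ?_ hν.le
      rw [hX, Finset.mul_sum]
      refine (Finset.abs_sum_le_sum_abs _ _).trans (Finset.sum_le_sum fun T hT => ?_)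
      rw [Finset.mul_sum]
      refine (Finset.abs_sum_le_sum_abs _ _).trans (Finset.sum_le_sum fun F hF => ?_)
      obtain ⟨B, i, q, H, hi, hq, hm⟩ := key T hT F hF
      exact (hb B T F i Ω H (hσ T hT) (hsub T hT) hi ν L u hν hL hu hg v vhat q hq hm).2
  have hm : 0 ≤ 𝒯.meshSize := Real.sSup_nonneg (by
    rintro _ ⟨T, -, rfl⟩; exact elementDiam_nonneg T)
  have hs : 0 ≤ sobolevSeminorm Ω (k + 1) u := Real.sqrt_nonneg _
  have ht : 0 ≤ 𝒯.tripleNorm k ν G v vhat := Real.sqrt_nonneg _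
  have hMs : 0 ≤ 𝒯.meshSize ^ k * sobolevSeminorm Ω (k + 1) u := mul_nonneg (pow_nonneg hm k) hs
  have hn := 𝒯.mul_sqrt_gradNormSq_add_jumpNormSq_le k hν G v vhat
  calc _ ≤ 2 * C * ν * X := hE.trans (le_of_eq (by ring))
    _ ≤ 2 * C * ν * (𝒯.meshSize ^ k * (sobolevSeminorm Ω (k + 1) u *
        (2 * (n + 2) * Real.sqrt (𝒯.gradNormSq v + 𝒯.jumpNormSq k v vhat)))) :=
      mul_le_mul_of_nonneg_left hsum (by positivity)
    _ = 4 * C * (n + 2) * (𝒯.meshSize ^ k * sobolevSeminorm Ω (k + 1) u) *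
        (ν * Real.sqrt (𝒯.gradNormSq v + 𝒯.jumpNormSq k v vhat)) := by ring
    _ ≤ (4 * C * (n + 2) + 1) * (𝒯.meshSize ^ k * sobolevSeminorm Ω (k + 1) u) *
        (Real.sqrt ν * 𝒯.tripleNorm k ν G v vhat) := by
      refine mul_le_mul (mul_le_mul_of_nonneg_right (by linarith) hMs) hn
        (mul_nonneg hν.le (Real.sqrt_nonneg _)) (by positivity)
    _ = _ := by ring

end Triangulation

end HDG

end


theorem RT_consistency_error_bound (d : ℕ) (hd : d = 2 ∨ d = 3) (k : ℕ) (hk : 1 ≤ k) (σ : ℝ) :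
    ∃ C > (0 : ℝ), ∀ (Ω : Set (HDG.Pt d)), IsOpen Ω →
      ∀ 𝒯 : HDG.Triangulation Ω, 𝒯.ShapeRegular σ →
      ∀ ν : ℝ, 0 < ν →
      ∀ (L : HDG.TensorField d) (u : HDG.VectorField d),
        (∀ i j, HDG.MemSobolev Ω k (L i j)) → (∀ i, HDG.MemSobolev Ω (k + 1) (u i)) →
        HDG.IsWeakGradient Ω u (fun i j x => ν⁻¹ * L i j x) →
      ∀ G ∈ 𝒯.SigmaSpace k, ∀ v ∈ 𝒯.VSpace k, ∀ vhat ∈ 𝒯.VhatSpace k,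
        |𝒯.consistencyError k ν L u v vhat| ≤
          C * Real.sqrt ν * 𝒯.meshSize ^ k * HDG.sobolevSeminorm Ω (k + 1) u *
            𝒯.tripleNorm k ν G v vhat := by
  obtain rfl | rfl := hd
  · exact HDG.Triangulation.exists_consistencyError_bound 1 k hk σ
  · exact HDG.Triangulation.exists_consistencyError_bound 2 k hk σ
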